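/- arXiv:1806.08559 — 3 statements merged into one kernel-verified Lean document; each statement's English description precedes it below -/
import Mathlib

section
/- Let u : ℝ² → ℝ be a smooth function satisfying -Δu = f(u) in all of ℝ², where f is smooth and f(0) ≥ 0. Assume that (0,0) is the only critical point of u, and that every nonempty level set {u = c} with c ≠ u(0,0) is a Jordan curve (the image of an injective continuous map of the unit circle). Then the following alternative holds: either the Hessian matrix of u at (0,0) is invertible (i.e. (0,0) is nondegenerate), or every such level set of u contains a point p at which (u_xx u_y² - 2 u_xy u_x u_y + u_yy u_x²)(p) ≥ 0, i.e. a point where the curvature of the level curve is nonpositive. -/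
open Filter Metric Set

/-- Partial derivative in the first variable. -/
noncomputable def pdx (u : ℝ → ℝ → ℝ) : ℝ → ℝ → ℝ := fun x y => deriv (fun t => u t y) x

/-- Partial derivative in the second variable. -/
noncomputable def pdy (u : ℝ → ℝ → ℝ) : ℝ → ℝ → ℝ := fun x y => deriv (fun t => u x t) y

/-- `pd u i j = ∂^(i+j) u / ∂x^i ∂y^j`. -/
noncomputable def pd (u : ℝ → ℝ → ℝ) (i j : ℕ) : ℝ → ℝ → ℝ := pdx^[i] (pdy^[j] u)

/-- The open unit ball of `ℝ²`. -/
def B1 : Set (ℝ × ℝ) := Metric.ball (0 : ℝ × ℝ) 1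

/-- Real part of `(x+iy)^n`. -/
noncomputable def ReZ (n : ℕ) (x y : ℝ) : ℝ := (((x : ℂ) + (y : ℂ) * Complex.I) ^ n).re

/-- Imaginary part of `(x+iy)^n`. -/
noncomputable def ImZ (n : ℕ) (x y : ℝ) : ℝ := (((x : ℂ) + (y : ℂ) * Complex.I) ^ n).im

/-- The numerator `u_xx u_y² - 2 u_xy u_x u_y + u_yy u_x²` whose negativity expresses
strictly positive curvature of the level curve of `u`. -/
noncomputable def curvNum (u : ℝ → ℝ → ℝ) (x y : ℝ) : ℝ :=
  pd u 2 0 x y * (pd u 0 1 x y) ^ 2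
    - 2 * pd u 1 1 x y * pd u 1 0 x y * pd u 0 1 x y
    + pd u 0 2 x y * (pd u 1 0 x y) ^ 2

/-- Smoothness of a curried function of two variables. -/
def Sm (u : ℝ → ℝ → ℝ) : Prop := ContDiff ℝ (⊤ : ℕ∞) (fun p : ℝ × ℝ => u p.1 p.2)

theorem Sm.hasFDerivAt {u : ℝ → ℝ → ℝ} (hu : Sm u) (p : ℝ × ℝ) :
    HasFDerivAt (fun p : ℝ × ℝ => u p.1 p.2) (fderiv ℝ (fun p : ℝ × ℝ => u p.1 p.2) p) p :=
  ((ContDiff.differentiable hu (by simp)) p).hasFDerivAt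

theorem Sm.pdx_eq {u : ℝ → ℝ → ℝ} (hu : Sm u) (x y : ℝ) :
    pdx u x y = fderiv ℝ (fun p : ℝ × ℝ => u p.1 p.2) (x, y) (1, 0) := by
  have h1 : HasDerivAt (fun t : ℝ => ((t, y) : ℝ × ℝ)) (1, 0) x :=
    (hasDerivAt_id x).prodMk (hasDerivAt_const x y)
  have := HasFDerivAt.comp_hasDerivAt (f := fun t : ℝ => ((t, y) : ℝ × ℝ)) x
    (hu.hasFDerivAt (x, y)) h1
  exact this.deriv

theorem Sm.pdy_eq {u : ℝ → ℝ → ℝ} (hu : Sm u) (x y : ℝ) :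
    pdy u x y = fderiv ℝ (fun p : ℝ × ℝ => u p.1 p.2) (x, y) (0, 1) := by
  have h1 : HasDerivAt (fun t : ℝ => ((x, t) : ℝ × ℝ)) (0, 1) y :=
    (hasDerivAt_const y x).prodMk (hasDerivAt_id y)
  have := HasFDerivAt.comp_hasDerivAt (f := fun t : ℝ => ((x, t) : ℝ × ℝ)) y
    (hu.hasFDerivAt (x, y)) h1
  exact this.deriv

theorem Sm.dx {u : ℝ → ℝ → ℝ} (hu : Sm u) : Sm (pdx u) := by
  have h : (fun p : ℝ × ℝ => pdx u p.1 p.2) =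
      fun p => fderiv ℝ (fun p : ℝ × ℝ => u p.1 p.2) p (1, 0) := by
    funext p; exact hu.pdx_eq p.1 p.2
  unfold Sm
  rw [h]
  exact (contDiff_infty_iff_fderiv.1 hu).2.clm_apply contDiff_const

theorem Sm.dy {u : ℝ → ℝ → ℝ} (hu : Sm u) : Sm (pdy u) := by
  have h : (fun p : ℝ × ℝ => pdy u p.1 p.2) =
      fun p => fderiv ℝ (fun p : ℝ × ℝ => u p.1 p.2) p (0, 1) := by
    funext p; exact hu.pdy_eq p.1 p.2
  unfold Sm
  rw [h]
  exact (contDiff_infty_iff_fderiv.1 hu).2.clm_apply contDiff_const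

theorem Sm.hasFD {u : ℝ → ℝ → ℝ} (hu : Sm u) (x y : ℝ) :
    HasFDerivAt (fun p : ℝ × ℝ => u p.1 p.2)
      (pdx u x y • ContinuousLinearMap.fst ℝ ℝ ℝ + pdy u x y • ContinuousLinearMap.snd ℝ ℝ ℝ)
      (x, y) := by
  have h := hu.hasFDerivAt (x, y)
  convert h using 1
  rw [hu.pdx_eq, hu.pdy_eq]
  ext <;> simp

theorem Sm.chain {u : ℝ → ℝ → ℝ} (hu : Sm u) {a b : ℝ → ℝ} {a' b' t : ℝ}
    (ha : HasDerivAt a a' t) (hb : HasDerivAt b b' t) :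
    HasDerivAt (fun s => u (a s) (b s)) (pdx u (a t) (b t) * a' + pdy u (a t) (b t) * b') t := by
  have := HasFDerivAt.comp_hasDerivAt (f := fun s : ℝ => ((a s, b s) : ℝ × ℝ)) t
    (hu.hasFD (a t) (b t)) (ha.prodMk hb)
  simpa [Function.comp_def] using this

theorem Sm.hdx {u : ℝ → ℝ → ℝ} (hu : Sm u) (x y : ℝ) :
    HasDerivAt (fun s => u s y) (pdx u x y) x := by
  simpa using hu.chain (hasDerivAt_id x) (hasDerivAt_const x y)

theorem Sm.hdy {u : ℝ → ℝ → ℝ} (hu : Sm u) (x y : ℝ) :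
    HasDerivAt (fun s => u x s) (pdy u x y) y := by
  simpa using hu.chain (hasDerivAt_const y x) (hasDerivAt_id y)

theorem Sm.comm {u : ℝ → ℝ → ℝ} (hu : Sm u) (x y : ℝ) :
    pdx (pdy u) x y = pdy (pdx u) x y := by
  have hd : Differentiable ℝ (fderiv ℝ (fun p : ℝ × ℝ => u p.1 p.2)) :=
    (contDiff_infty_iff_fderiv.1 hu).2.differentiable (by simp)
  have h2 := second_derivative_symmetric (𝕜 := ℝ) (fun p => hu.hasFDerivAt p)
    (hd (x, y)).hasFDerivAt (1, 0) (0, 1)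
  rw [hu.dy.pdx_eq, hu.dx.pdy_eq]
  have e1 : (fun p : ℝ × ℝ => pdy u p.1 p.2) =
      fun p => fderiv ℝ (fun p : ℝ × ℝ => u p.1 p.2) p (0, 1) := by
    funext p; exact hu.pdy_eq p.1 p.2
  have e2 : (fun p : ℝ × ℝ => pdx u p.1 p.2) =
      fun p => fderiv ℝ (fun p : ℝ × ℝ => u p.1 p.2) p (1, 0) := by
    funext p; exact hu.pdx_eq p.1 p.2
  rw [e1, e2]
  rw [fderiv_clm_apply (hd _) (by fun_prop), fderiv_clm_apply (hd _) (by fun_prop)]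
  simpa using h2

theorem Sm.comp {u a b : ℝ → ℝ → ℝ} (hu : Sm u) (ha : Sm a) (hb : Sm b) :
    Sm (fun x y => u (a x y) (b x y)) :=
  ContDiff.comp (g := fun p : ℝ × ℝ => u p.1 p.2) hu (ContDiff.prodMk ha hb)

theorem Sm.add {a b : ℝ → ℝ → ℝ} (ha : Sm a) (hb : Sm b) : Sm (fun x y => a x y + b x y) :=
  ContDiff.add ha hb
theorem Sm.sub {a b : ℝ → ℝ → ℝ} (ha : Sm a) (hb : Sm b) : Sm (fun x y => a x y - b x y) :=
  ContDiff.sub ha hb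
theorem Sm.mul {a b : ℝ → ℝ → ℝ} (ha : Sm a) (hb : Sm b) : Sm (fun x y => a x y * b x y) :=
  ContDiff.mul ha hb
theorem Sm.const (c : ℝ) : Sm (fun _ _ => c) := contDiff_const
theorem Sm.fst : Sm (fun x _ => x) := contDiff_fst
theorem Sm.snd : Sm (fun _ y => y) := contDiff_snd

theorem Sm.cont {a : ℝ → ℝ → ℝ} (ha : Sm a) : Continuous (fun p : ℝ × ℝ => a p.1 p.2) :=
  ContDiff.continuous ha

theorem Sm.cont2 {X : Type*} [TopologicalSpace X] {a : ℝ → ℝ → ℝ} (ha : Sm a) {f g : X → ℝ}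
    (hf : Continuous f) (hg : Continuous g) : Continuous (fun p => a (f p) (g p)) :=
  ha.cont.comp (hf.prodMk hg)

/-- derivative under the integral sign -/
theorem hasDerivAt_param {F F' : ℝ → ℝ → ℝ} (a b : ℝ)
    (hF : Continuous (fun p : ℝ × ℝ => F p.1 p.2))
    (hF' : Continuous (fun p : ℝ × ℝ => F' p.1 p.2))
    (hd : ∀ x t, HasDerivAt (fun s => F s t) (F' x t) x) (x₀ : ℝ) :
    HasDerivAt (fun x => ∫ t in a..b, F x t) (∫ t in a..b, F' x₀ t) x₀ := by
  have hK : IsCompact (closedBall x₀ 1 ×ˢ uIcc a b) :=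
    (isCompact_closedBall x₀ 1).prod isCompact_uIcc
  obtain ⟨C, hC⟩ := hK.exists_bound_of_continuousOn hF'.continuousOn
  refine (intervalIntegral.hasDerivAt_integral_of_dominated_loc_of_deriv_le (bound := fun _ => C)
    (F' := F') (closedBall_mem_nhds x₀ one_pos) ?_ ?_ ?_ ?_ ?_ ?_).2
  · exact Eventually.of_forall fun x =>
      (hF.comp (continuous_const.prodMk continuous_id)).aestronglyMeasurable
  · exact (hF.comp (continuous_const.prodMk continuous_id)).intervalIntegrable _ _
  · exact (hF'.comp (continuous_const.prodMk continuous_id)).aestronglyMeasurable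
  · exact Eventually.of_forall fun t ht x hx => hC (x, t) ⟨hx, uIoc_subset_uIcc ht⟩
  · exact intervalIntegrable_const
  · exact Eventually.of_forall fun t ht x hx => hd x t

theorem hasFDerivAt_param {E V : Type*} [NormedAddCommGroup E] [NormedSpace ℝ E] [ProperSpace E]
    [NormedAddCommGroup V] [NormedSpace ℝ V] [CompleteSpace V]
    {F : E → ℝ → V} {F' : E → ℝ → E →L[ℝ] V} (a b : ℝ)
    (hF : Continuous (fun p : E × ℝ => F p.1 p.2))
    (hF' : Continuous (fun p : E × ℝ => F' p.1 p.2))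
    (hd : ∀ x t, HasFDerivAt (fun s => F s t) (F' x t) x) (x₀ : E) :
    HasFDerivAt (fun x => ∫ t in a..b, F x t) (∫ t in a..b, F' x₀ t) x₀ := by
  have hK : IsCompact (closedBall x₀ 1 ×ˢ uIcc a b) :=
    (isCompact_closedBall x₀ 1).prod isCompact_uIcc
  obtain ⟨C, hC⟩ := hK.exists_bound_of_continuousOn hF'.continuousOn
  refine (intervalIntegral.hasFDerivAt_integral_of_dominated_of_fderiv_le (bound := fun _ => C)
    (F' := F') (closedBall_mem_nhds x₀ one_pos) ?_ ?_ ?_ ?_ ?_ ?_)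
  · exact Eventually.of_forall fun x =>
      (hF.comp (continuous_const.prodMk continuous_id)).aestronglyMeasurable
  · exact (hF.comp (continuous_const.prodMk continuous_id)).intervalIntegrable _ _
  · exact (hF'.comp (continuous_const.prodMk continuous_id)).aestronglyMeasurable
  · exact Eventually.of_forall fun t ht x hx => hC (x, t) ⟨hx, uIoc_subset_uIcc ht⟩
  · exact intervalIntegrable_const
  · exact Eventually.of_forall fun t ht x hx => hd x t

theorem contDiff_param_nat {E : Type} [NormedAddCommGroup E] [NormedSpace ℝ E] [ProperSpace E]
    (a b : ℝ) (n : ℕ) : ∀ {V : Type} [NormedAddCommGroup V] [NormedSpace ℝ V] [CompleteSpace V]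
    {F : E → ℝ → V}, ContDiff ℝ (⊤ : ℕ∞) (fun p : E × ℝ => F p.1 p.2) →
    ContDiff ℝ n (fun x => ∫ t in a..b, F x t) := by
  induction n with
  | zero =>
    intro V _ _ _ F hF
    simp only [Nat.cast_zero, contDiff_zero]
    exact intervalIntegral.continuous_parametric_intervalIntegral_of_continuous' hF.continuous a b
  | succ n ih =>
    intro V _ _ _ F hF
    have hs := (contDiff_infty_iff_fderiv.1 hF).2
    let F' : E → ℝ → E →L[ℝ] V := fun x t =>
      (fderiv ℝ (fun p : E × ℝ => F p.1 p.2) (x, t)).comp (ContinuousLinearMap.inl ℝ E ℝ)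
    have hF'c : ContDiff ℝ (⊤ : ℕ∞) (fun p : E × ℝ => F' p.1 p.2) :=
      hs.clm_comp contDiff_const
    have hd : ∀ x t, HasFDerivAt (fun s => F s t) (F' x t) x := by
      intro x t
      have h1 : HasFDerivAt (fun p : E × ℝ => F p.1 p.2) _ (x, t) :=
        ((contDiff_infty_iff_fderiv.1 hF).1 (x, t)).hasFDerivAt
      exact HasFDerivAt.comp (f := fun s : E => ((s, t) : E × ℝ)) x h1
        (hasFDerivAt_prodMk_left x t)
    push_cast
    rw [contDiff_succ_iff_hasFDerivAt]
    exact ⟨fun x => ∫ t in a..b, F' x t, ih hF'c,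
      fun x => hasFDerivAt_param a b hF.continuous hF'c.continuous hd x⟩

/-- Hadamard division. -/
theorem Sm.hadamard {g : ℝ → ℝ → ℝ} (hg : Sm g) (h0 : ∀ α, g 0 α = 0) :
    ∃ G : ℝ → ℝ → ℝ, Sm G ∧ (∀ r α, g r α = r * G r α) ∧ ∀ α, G 0 α = pdx g 0 α := by
  refine ⟨fun r α => ∫ s in (0:ℝ)..1, pdx g (s * r) α, ?_, ?_, ?_⟩
  · refine contDiff_infty.2 fun n => ?_
    refine contDiff_param_nat (E := ℝ × ℝ) 0 1 n (F := fun p s => pdx g (s * p.1) p.2) ?_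
    exact ContDiff.comp (g := fun p : ℝ × ℝ => pdx g p.1 p.2)
      (f := fun p : (ℝ × ℝ) × ℝ => (p.2 * p.1.1, p.1.2)) hg.dx (by fun_prop)
  · intro r α
    have hc : Continuous fun s : ℝ => pdx g (s * r) α * r :=
      (hg.dx.cont2 (by fun_prop) continuous_const).mul continuous_const
    have := intervalIntegral.integral_eq_sub_of_hasDerivAt (a := (0:ℝ)) (b := 1)
      (f := fun s => g (s * r) α) (f' := fun s => pdx g (s * r) α * r)
      (fun s _ => by
        have := hg.chain ((hasDerivAt_id s).mul_const r) (hasDerivAt_const s α)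
        simpa using this) (hc.intervalIntegrable _ _)
    rw [intervalIntegral.integral_mul_const] at this
    simp only [one_mul, zero_mul, h0, sub_zero] at this
    rw [← this, mul_comm]
  · intro α; simp

/-- Poincare lemma in the plane. -/
theorem exists_potential {P Q : ℝ → ℝ → ℝ} (hP : Sm P) (hQ : Sm Q)
    (hc : ∀ x y, pdy P x y = pdx Q x y) :
    ∃ h : ℝ → ℝ → ℝ, Sm h ∧ (∀ x y, pdx h x y = P x y) ∧ ∀ x y, pdy h x y = Q x y := by
  let w : ℝ × ℝ → (ℝ × ℝ →L[ℝ] ℝ) := fun p =>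
    P p.1 p.2 • ContinuousLinearMap.fst ℝ ℝ ℝ + Q p.1 p.2 • ContinuousLinearMap.snd ℝ ℝ ℝ
  have hwc : ContDiff ℝ (⊤ : ℕ∞) w :=
    (ContDiff.smul hP contDiff_const).add (ContDiff.smul hQ contDiff_const)
  have hwd : ∀ p : ℝ × ℝ, HasFDerivAt w
      ((pdx P p.1 p.2 • ContinuousLinearMap.fst ℝ ℝ ℝ +
        pdy P p.1 p.2 • ContinuousLinearMap.snd ℝ ℝ ℝ).smulRight (ContinuousLinearMap.fst ℝ ℝ ℝ) +
       (pdx Q p.1 p.2 • ContinuousLinearMap.fst ℝ ℝ ℝ +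
        pdy Q p.1 p.2 • ContinuousLinearMap.snd ℝ ℝ ℝ).smulRight
          (ContinuousLinearMap.snd ℝ ℝ ℝ)) p := by
    intro p
    have h1 := HasFDerivAt.smul_const (hP.hasFD p.1 p.2) (ContinuousLinearMap.fst ℝ ℝ ℝ)
    have h2 := HasFDerivAt.smul_const (hQ.hasFD p.1 p.2) (ContinuousLinearMap.snd ℝ ℝ ℝ)
    exact h1.add h2
  obtain ⟨H, hH⟩ := Convex.exists_forall_hasFDerivAt_of_fderiv_symmetric (E := ℝ × ℝ) (F := ℝ)
    (s := Set.univ) (ω := w) convex_univ isOpen_univ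
    (fun p _ => (hwd p).differentiableAt.differentiableWithinAt) (by
      intro p _ a b
      rw [(hwd p).fderiv]
      have := hc p.1 p.2
      simp
      rw [this]; ring)
  have hSm : Sm (fun x y => H (x, y)) := by
    refine contDiff_infty_iff_fderiv.2 ⟨fun p => (hH p trivial).differentiableAt, ?_⟩
    have : fderiv ℝ (fun p : ℝ × ℝ => H (p.1, p.2)) = w := by
      funext p; exact (hH p trivial).fderiv
    rw [this]; exact hwc
  refine ⟨fun x y => H (x, y), hSm, fun x y => ?_, fun x y => ?_⟩
  · rw [hSm.pdx_eq]
    have : fderiv ℝ (fun p : ℝ × ℝ => H (p.1, p.2)) (x, y) = w (x, y) := (hH (x, y) trivial).fderiv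
    rw [this]; simp [w]
  · rw [hSm.pdy_eq]
    have : fderiv ℝ (fun p : ℝ × ℝ => H (p.1, p.2)) (x, y) = w (x, y) := (hH (x, y) trivial).fderiv
    rw [this]; simp [w]

/-- Polar coordinates. -/
noncomputable def polar (v : ℝ → ℝ → ℝ) : ℝ → ℝ → ℝ :=
  fun r α => v (r * Real.cos α) (r * Real.sin α)

/-- Laplacian. -/
noncomputable def lap (v : ℝ → ℝ → ℝ) : ℝ → ℝ → ℝ :=
  fun x y => pdx (pdx v) x y + pdy (pdy v) x y

theorem Sm.cosS : Sm (fun _ α => Real.cos α) := Real.contDiff_cos.comp contDiff_snd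
theorem Sm.sinS : Sm (fun _ α => Real.sin α) := Real.contDiff_sin.comp contDiff_snd

theorem Sm.polar {v : ℝ → ℝ → ℝ} (hv : Sm v) : Sm (polar v) :=
  hv.comp (Sm.fst.mul Sm.cosS) (Sm.fst.mul Sm.sinS)

theorem pdx_polar {v : ℝ → ℝ → ℝ} (hv : Sm v) :
    pdx (polar v) = fun r α => pdx v (r * Real.cos α) (r * Real.sin α) * Real.cos α +
      pdy v (r * Real.cos α) (r * Real.sin α) * Real.sin α := by
  funext r α
  have := (hv.chain ((hasDerivAt_id r).mul_const (Real.cos α))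
    ((hasDerivAt_id r).mul_const (Real.sin α))).deriv
  exact this.trans (by simp)

theorem pdy_polar {v : ℝ → ℝ → ℝ} (hv : Sm v) :
    pdy (polar v) = fun r α => pdx v (r * Real.cos α) (r * Real.sin α) * (r * -Real.sin α) +
      pdy v (r * Real.cos α) (r * Real.sin α) * (r * Real.cos α) := by
  funext r α
  exact (hv.chain ((Real.hasDerivAt_cos α).const_mul r)
    ((Real.hasDerivAt_sin α).const_mul r)).deriv

theorem polar_lap {v : ℝ → ℝ → ℝ} (hv : Sm v) (r α : ℝ) :
    r ^ 2 * pdx (pdx (polar v)) r α + r * pdx (polar v) r α + pdy (pdy (polar v)) r α =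
      r ^ 2 * lap v (r * Real.cos α) (r * Real.sin α) := by
  have h1 : pdx (pdx (polar v)) r α =
      (pdx (pdx v) (r * Real.cos α) (r * Real.sin α) * Real.cos α +
        pdy (pdx v) (r * Real.cos α) (r * Real.sin α) * Real.sin α) * Real.cos α +
      (pdx (pdy v) (r * Real.cos α) (r * Real.sin α) * Real.cos α +
        pdy (pdy v) (r * Real.cos α) (r * Real.sin α) * Real.sin α) * Real.sin α := by
    rw [pdx_polar hv]
    have hx := (hv.dx.chain ((hasDerivAt_id r).mul_const (Real.cos α))
      ((hasDerivAt_id r).mul_const (Real.sin α))).mul_const (Real.cos α)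
    have hy := (hv.dy.chain ((hasDerivAt_id r).mul_const (Real.cos α))
      ((hasDerivAt_id r).mul_const (Real.sin α))).mul_const (Real.sin α)
    exact (hx.add hy).deriv.trans (by simp)
  have h2 : pdy (pdy (polar v)) r α =
      (pdx (pdx v) (r * Real.cos α) (r * Real.sin α) * (r * -Real.sin α) +
        pdy (pdx v) (r * Real.cos α) (r * Real.sin α) * (r * Real.cos α)) * (r * -Real.sin α) +
      pdx v (r * Real.cos α) (r * Real.sin α) * (r * -Real.cos α) +
      ((pdx (pdy v) (r * Real.cos α) (r * Real.sin α) * (r * -Real.sin α) +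
        pdy (pdy v) (r * Real.cos α) (r * Real.sin α) * (r * Real.cos α)) * (r * Real.cos α) +
      pdy v (r * Real.cos α) (r * Real.sin α) * (r * -Real.sin α)) := by
    rw [pdy_polar hv]
    have hx := (hv.dx.chain ((Real.hasDerivAt_cos α).const_mul r)
      ((Real.hasDerivAt_sin α).const_mul r)).mul (((Real.hasDerivAt_sin α).neg).const_mul r)
    have hy := (hv.dy.chain ((Real.hasDerivAt_cos α).const_mul r)
      ((Real.hasDerivAt_sin α).const_mul r)).mul ((Real.hasDerivAt_cos α).const_mul r)
    exact (hx.add hy).deriv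
  rw [h1, h2, pdx_polar hv, lap, hv.comm]
  have := Real.sin_sq_add_cos_sq α
  have e : Real.sin α ^ 2 = 1 - Real.cos α ^ 2 := by linarith
  ring_nf
  rw [e]; ring

theorem pow_dx {Y : ℝ → ℝ → ℝ} (hY : Sm Y) (k : ℕ) (r α : ℝ) :
    r * pdx (fun r α => r ^ k * Y r α) r α = r ^ k * (k * Y r α + r * pdx Y r α) := by
  have h := ((hasDerivAt_pow k r).mul (hY.hdx r α)).deriv
  have : pdx (fun r α => r ^ k * Y r α) r α = ↑k * r ^ (k - 1) * Y r α + r ^ k * pdx Y r α := h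
  rw [this]
  rcases k with _ | k
  · simp
  · simp only [Nat.add_sub_cancel]; ring

theorem Sm.powS (k : ℕ) : Sm (fun r _ => r ^ k) := contDiff_fst.pow k

theorem polar_pow {v Y : ℝ → ℝ → ℝ} (hv : Sm v) (hY : Sm Y) {k : ℕ}
    (hg : ∀ r α, polar v r α = r ^ k * Y r α) (r α : ℝ) :
    r ^ k * (k ^ 2 * Y r α + (2 * k + 1) * r * pdx Y r α + r ^ 2 * pdx (pdx Y) r α
      + pdy (pdy Y) r α) = r ^ 2 * lap v (r * Real.cos α) (r * Real.sin α) := by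
  have hg' : polar v = fun r α => r ^ k * Y r α := by funext r α; exact hg r α
  rw [← polar_lap hv]
  have e1 : r * pdx (polar v) r α = r ^ k * (k * Y r α + r * pdx Y r α) := by
    rw [hg']; exact pow_dx hY k r α
  have hY2 : Sm (fun r α => k * Y r α + r * pdx Y r α) :=
    ((Sm.const _).mul hY).add (Sm.fst.mul hY.dx)
  have e2 : r * pdx (fun r α => r * pdx (polar v) r α) r α =
      r ^ k * (k * (k * Y r α + r * pdx Y r α) +
        r * (k * pdx Y r α + (pdx Y r α + r * pdx (pdx Y) r α))) := by
    have : (fun r α => r * pdx (polar v) r α) =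
        fun r α => r ^ k * (k * Y r α + r * pdx Y r α) := by
      funext r α; rw [hg']; exact pow_dx hY k r α
    rw [this, pow_dx hY2]
    congr 3
    have := (((hY.hdx r α).const_mul (k:ℝ)).add ((hasDerivAt_id r).mul (hY.dx.hdx r α))).deriv
    exact this.trans (by simp)
  have e3 : pdx (fun r α => r * pdx (polar v) r α) r α =
      pdx (polar v) r α + r * pdx (pdx (polar v)) r α := by
    have := ((hasDerivAt_id r).mul (hv.polar.dx.hdx r α)).deriv
    exact this.trans (by simp)
  have e4 : pdy (pdy (polar v)) r α = r ^ k * pdy (pdy Y) r α := by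
    have : pdy (polar v) = fun r α => r ^ k * pdy Y r α := by
      funext r α
      rw [hg']
      exact ((hY.hdy r α).const_mul (r ^ k)).deriv
    rw [this]
    exact ((hY.dy.hdy r α).const_mul (r ^ k)).deriv
  rw [e3] at e2
  rw [e4]
  linear_combination -e2

theorem polar_bound {v Y : ℝ → ℝ → ℝ} (hv : Sm v) (hY : Sm Y) {k : ℕ}
    (hg : ∀ r α, polar v r α = r ^ k * Y r α) {M ρ : ℝ}
    (hb : ∀ r α, 0 < r → r < ρ → |lap v (r * Real.cos α) (r * Real.sin α)| ≤ M * |polar v r α|)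
    {r α : ℝ} (hr : 0 < r) (hr' : r < ρ) :
    |k ^ 2 * Y r α + (2 * k + 1) * r * pdx Y r α + r ^ 2 * pdx (pdx Y) r α
      + pdy (pdy Y) r α| ≤ M * r ^ 2 * |Y r α| := by
  have h1 := polar_pow hv hY hg r α
  have h2 := hb r α hr hr'
  have hp : 0 < r ^ k := pow_pos hr k
  have h3 := congrArg abs h1
  rw [abs_mul, abs_mul, abs_of_pos hp, abs_of_pos (pow_pos hr 2)] at h3
  rw [hg, abs_mul, abs_of_pos hp] at h2
  have h4 : r ^ k * |k ^ 2 * Y r α + (2 * k + 1) * r * pdx Y r α + r ^ 2 * pdx (pdx Y) r α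
      + pdy (pdy Y) r α| ≤ r ^ k * (M * r ^ 2 * |Y r α|) := by
    rw [h3]
    calc _ ≤ r ^ 2 * (M * (r ^ k * |Y r α|)) := by gcongr
      _ = _ := by ring
  exact le_of_mul_le_mul_left h4 hp

theorem polar_ode {v Y : ℝ → ℝ → ℝ} (hv : Sm v) (hY : Sm Y) {k : ℕ}
    (hg : ∀ r α, polar v r α = r ^ k * Y r α) {M ρ : ℝ} (hρ : 0 < ρ)
    (hb : ∀ r α, 0 < r → r < ρ → |lap v (r * Real.cos α) (r * Real.sin α)| ≤ M * |polar v r α|)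
    (α : ℝ) : pdy (pdy Y) 0 α = - k ^ 2 * Y 0 α := by
  have c0 := hY.cont2 (f := fun r : ℝ => r) (g := fun _ => α) continuous_id continuous_const
  have c1 := hY.dx.cont2 (f := fun r : ℝ => r) (g := fun _ => α) continuous_id continuous_const
  have c2 := hY.dx.dx.cont2 (f := fun r : ℝ => r) (g := fun _ => α) continuous_id continuous_const
  have c3 := hY.dy.dy.cont2 (f := fun r : ℝ => r) (g := fun _ => α) continuous_id continuous_const
  have cL : Continuous fun r : ℝ => |k ^ 2 * Y r α + (2 * k + 1) * r * pdx Y r α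
      + r ^ 2 * pdx (pdx Y) r α + pdy (pdy Y) r α| := by fun_prop
  have cR : Continuous fun r : ℝ => M * r ^ 2 * |Y r α| := by fun_prop
  have := le_of_tendsto_of_tendsto (b := nhdsWithin (0:ℝ) (Ioi 0))
    (cL.continuousWithinAt (x := 0)) (cR.continuousWithinAt (x := 0)) (by
      filter_upwards [Ioo_mem_nhdsGT hρ] with r hr
      exact polar_bound hv hY hg hb hr.1 hr.2)
  simp at this
  linarith

theorem polar_periodic {v Y : ℝ → ℝ → ℝ} (hY : Sm Y) {k : ℕ}
    (hg : ∀ r α, polar v r α = r ^ k * Y r α) (α : ℝ) :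
    Y 0 (α + 2 * Real.pi) = Y 0 α := by
  have c0 := hY.cont2 (f := fun r : ℝ => r) (g := fun _ => α) continuous_id continuous_const
  have c1 := hY.cont2 (f := fun r : ℝ => r) (g := fun _ => α + 2 * Real.pi) continuous_id
    continuous_const
  refine tendsto_nhds_unique_of_eventuallyEq (l := nhdsWithin (0:ℝ) (Ioi 0))
    (c1.continuousWithinAt (x := 0)) (c0.continuousWithinAt (x := 0)) ?_
  filter_upwards [self_mem_nhdsWithin] with r hr
  have h1 := hg r α
  have h2 := hg r (α + 2 * Real.pi)
  have h3 : polar v r (α + 2 * Real.pi) = polar v r α := by simp [polar]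
  have hp : r ^ k ≠ 0 := pow_ne_zero _ (ne_of_gt hr)
  rw [h3, h1] at h2
  exact (mul_left_cancel₀ hp h2).symm

theorem polar_periodic' {v Y : ℝ → ℝ → ℝ} {k : ℕ}
    (hg : ∀ r α, polar v r α = r ^ k * Y r α) {r : ℝ} (hr : 0 < r) (α : ℝ) :
    Y r (α + 2 * Real.pi) = Y r α := by
  have h1 := hg r α
  have h2 := hg r (α + 2 * Real.pi)
  have h3 : polar v r (α + 2 * Real.pi) = polar v r α := by simp [polar]
  have hp : r ^ k ≠ 0 := pow_ne_zero _ (ne_of_gt hr)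
  rw [h3, h1] at h2
  exact (mul_left_cancel₀ hp h2).symm

theorem carleman_pointwise {N M κ r y p S : ℝ} (hN : 1 ≤ N) (hMN : M ^ 2 ≤ 6 * N)
    (hκ : 1 / 2 ≤ κ) (hκ1 : κ ≤ 1) (hr : 0 < r) (hr1 : r ≤ 1) (hM : 0 ≤ M)
    (hS : |S| ≤ M * r ^ 2 * |y|) :
    p * S - 2 * N * r * p ^ 2 - κ * (4 * r ^ 3 * y ^ 2 + 2 * r ^ 4 * (y * p)) ≤ 0 := by
  have h1 : p * S ≤ |p| * (M * r ^ 2 * |y|) := by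
    calc p * S ≤ |p * S| := le_abs_self _
      _ = |p| * |S| := abs_mul _ _
      _ ≤ _ := by gcongr
  have h2 : |p| * (M * r ^ 2 * |y|) ≤ N * r * p ^ 2 + 3 / 2 * r ^ 3 * y ^ 2 := by
    have ha : y ^ 2 = |y| ^ 2 := (sq_abs y).symm
    have hb : p ^ 2 = |p| ^ 2 := (sq_abs p).symm
    rw [ha, hb]
    set a := |y|
    set b := |p|
    have h3 : N * (N * b ^ 2 + 3 / 2 * (r * a) ^ 2 - M * (r * a) * b) ≥ 0 := by
      nlinarith [sq_nonneg (2 * N * b - M * (r * a)),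
        mul_nonneg (sub_nonneg.2 hMN) (sq_nonneg (r * a))]
    have h4 : 0 ≤ N * b ^ 2 + 3 / 2 * (r * a) ^ 2 - M * (r * a) * b :=
      nonneg_of_mul_nonneg_right h3 (by linarith)
    nlinarith [mul_nonneg hr.le h4]
  have h5 : -(2 * r ^ 4 * (y * p)) ≤ r ^ 3 * y ^ 2 + r ^ 5 * p ^ 2 := by
    have : 0 ≤ r ^ 3 * (y + r * p) ^ 2 := by positivity
    nlinarith
  have h6 : κ * (-(2 * r ^ 4 * (y * p))) ≤ κ * (r ^ 3 * y ^ 2 + r ^ 5 * p ^ 2) :=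
    mul_le_mul_of_nonneg_left h5 (by linarith)
  have h7 : κ * (r ^ 5 * p ^ 2) ≤ N * (r * p ^ 2) := by
    have : r ^ 5 * p ^ 2 ≤ r * p ^ 2 := by
      gcongr
      calc r ^ 5 ≤ r ^ 1 := pow_le_pow_of_le_one hr.le hr1 (by norm_num)
        _ = r := pow_one r
    have h0 : 0 ≤ r * p ^ 2 := by positivity
    have h0' : 0 ≤ r ^ 5 * p ^ 2 := by positivity
    nlinarith
  have h8 : 0 ≤ (κ - 1 / 2) * (r ^ 3 * y ^ 2) := mul_nonneg (by linarith) (by positivity)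
  nlinarith

theorem pdx_periodic {Y : ℝ → ℝ → ℝ}
    (hper : ∀ r, 0 < r → ∀ α, Y r (α + 2 * Real.pi) = Y r α) {r : ℝ} (hr : 0 < r) (α : ℝ) :
    pdx Y r (α + 2 * Real.pi) = pdx Y r α := by
  refine Filter.EventuallyEq.deriv_eq ?_
  filter_upwards [lt_mem_nhds hr] with s hs
  exact hper s hs α

theorem pdy_periodic {Y : ℝ → ℝ → ℝ} {r : ℝ}
    (hper : ∀ α, Y r (α + 2 * Real.pi) = Y r α) (α : ℝ) :
    pdy Y r (α + 2 * Real.pi) = pdy Y r α := by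
  have h : (fun t => Y r (t + 2 * Real.pi)) = fun t => Y r t := by funext t; exact hper t
  have := deriv_comp_add_const (fun t => Y r t) (2 * Real.pi) α
  rw [h] at this
  exact this.symm

theorem carleman_antitone {Y : ℝ → ℝ → ℝ} (hY : Sm Y)
    (hper : ∀ r, 0 < r → ∀ α, Y r (α + 2 * Real.pi) = Y r α) {N M κ R : ℝ}
    (hN : 1 ≤ N) (hMN : M ^ 2 ≤ 6 * N) (hκ : 1 / 2 ≤ κ) (hκ1 : κ ≤ 1) (hR1 : R ≤ 1) (hM : 0 ≤ M)
    (hS : ∀ r α, 0 < r → r < R → |N ^ 2 * Y r α + (2 * N + 1) * r * pdx Y r α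
      + r ^ 2 * pdx (pdx Y) r α + pdy (pdy Y) r α| ≤ M * r ^ 2 * |Y r α|) :
    AntitoneOn (fun r => ∫ α in (-Real.pi)..Real.pi,
      (1 / 2 * ((r * pdx Y r α) ^ 2 + N ^ 2 * Y r α ^ 2 - pdy Y r α ^ 2) - κ * r ^ 4 * Y r α ^ 2))
      (Icc 0 R) := by
  let F' : ℝ → ℝ → ℝ := fun r α => r * pdx Y r α * (pdx Y r α + r * pdx (pdx Y) r α)
    + N ^ 2 * (Y r α * pdx Y r α) - pdy Y r α * pdx (pdy Y) r α
    - κ * (4 * r ^ 3 * Y r α ^ 2 + 2 * r ^ 4 * (Y r α * pdx Y r α))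
  have c0 := hY.cont
  have c1 := hY.dx.cont
  have c2 := hY.dx.dx.cont
  have c3 := hY.dy.cont
  have c4 := hY.dy.dx.cont
  have hd : ∀ r₀, HasDerivAt (fun r => ∫ α in (-Real.pi)..Real.pi,
      (1 / 2 * ((r * pdx Y r α) ^ 2 + N ^ 2 * Y r α ^ 2 - pdy Y r α ^ 2) - κ * r ^ 4 * Y r α ^ 2))
      (∫ α in (-Real.pi)..Real.pi, F' r₀ α) r₀ := by
    intro r₀
    refine hasDerivAt_param (F := fun r α => 1 / 2 * ((r * pdx Y r α) ^ 2 + N ^ 2 * Y r α ^ 2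
      - pdy Y r α ^ 2) - κ * r ^ 4 * Y r α ^ 2) (F' := F') _ _ (by fun_prop)
      (by simp only [F']; fun_prop) ?_ r₀
    intro r α
    have a0 := hY.hdx r α
    have a1 := hY.dx.hdx r α
    have a2 := hY.dy.hdx r α
    have := ((((((hasDerivAt_id r).mul a1).pow 2).add ((a0.pow 2).const_mul (N ^ 2))).sub
      (a2.pow 2)).const_mul (1 / 2)).sub ((((hasDerivAt_id r).pow 4).const_mul κ).mul (a0.pow 2))
    refine HasDerivAt.congr_deriv this ?_
    simp [F']
    ring
  refine antitoneOn_of_deriv_nonpos (convex_Icc 0 R)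
    (fun r _ => (hd r).continuousAt.continuousWithinAt)
    (fun r _ => (hd r).differentiableAt.differentiableWithinAt) ?_
  intro r hr
  rw [interior_Icc] at hr
  rw [(hd r).deriv]
  have i0 := hY.cont2 (f := fun _ : ℝ => r) (g := fun α : ℝ => α) continuous_const continuous_id
  have i1 := hY.dx.cont2 (f := fun _ : ℝ => r) (g := fun α : ℝ => α) continuous_const continuous_id
  have i2 := hY.dx.dx.cont2 (f := fun _ : ℝ => r) (g := fun α : ℝ => α) continuous_const
    continuous_id
  have i3 := hY.dy.cont2 (f := fun _ : ℝ => r) (g := fun α : ℝ => α) continuous_const continuous_id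
  have i4 := hY.dy.dx.cont2 (f := fun _ : ℝ => r) (g := fun α : ℝ => α) continuous_const
    continuous_id
  have i5 := hY.dx.dy.cont2 (f := fun _ : ℝ => r) (g := fun α : ℝ => α) continuous_const
    continuous_id
  have i6 := hY.dy.dy.cont2 (f := fun _ : ℝ => r) (g := fun α : ℝ => α) continuous_const
    continuous_id
  have hB : ∫ α in (-Real.pi)..Real.pi,
      (pdy (pdx Y) r α * pdy Y r α + pdx Y r α * pdy (pdy Y) r α) = 0 := by
    have := intervalIntegral.integral_eq_sub_of_hasDerivAt (a := -Real.pi) (b := Real.pi)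
      (f := fun α => pdx Y r α * pdy Y r α)
      (f' := fun α => pdy (pdx Y) r α * pdy Y r α + pdx Y r α * pdy (pdy Y) r α)
      (fun α _ => (hY.dx.hdy r α).mul (hY.dy.hdy r α))
      (Continuous.intervalIntegrable (by fun_prop) _ _)
    rw [this]
    have e : Real.pi = -Real.pi + 2 * Real.pi := by ring
    have p1 := pdx_periodic hper hr.1 (-Real.pi)
    have p2 := pdy_periodic (hper r hr.1) (-Real.pi)
    rw [← e] at p1 p2
    simp only [p1, p2, sub_self]
  have hA : (∫ α in (-Real.pi)..Real.pi, F' r α) = ∫ α in (-Real.pi)..Real.pi,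
      (F' r α + (pdy (pdx Y) r α * pdy Y r α + pdx Y r α * pdy (pdy Y) r α)) := by
    rw [intervalIntegral.integral_add _ _, hB, add_zero]
    · exact Continuous.intervalIntegrable (by simp only [F']; fun_prop) _ _
    · exact Continuous.intervalIntegrable (by fun_prop) _ _
  rw [hA]
  have hle : -Real.pi ≤ Real.pi := by linarith [Real.pi_pos]
  rw [← neg_nonneg, ← intervalIntegral.integral_neg]
  refine intervalIntegral.integral_nonneg hle fun α _ => ?_
  have := carleman_pointwise (p := pdx Y r α) hN hMN hκ hκ1 hr.1 (hr.2.le.trans hR1) hM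
    (hS r α hr.1 hr.2)
  have hc := hY.comm r α
  simp only [F']
  rw [hc]
  nlinarith

theorem flat_zero {v : ℝ → ℝ → ℝ} (hv : Sm v) {M ρ : ℝ} (hM : 0 ≤ M)
    (hb : ∀ r α, 0 < r → r < ρ → |lap v (r * Real.cos α) (r * Real.sin α)| ≤ M * |polar v r α|)
    (hflat : ∀ k : ℕ, ∃ G, Sm G ∧ ∀ r α, polar v r α = r ^ k * G r α)
    {r₀ α : ℝ} (h0 : 0 < r₀) (h1 : r₀ < ρ) (h2 : r₀ < 1) (hα : α ∈ Icc (-Real.pi) Real.pi) :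
    polar v r₀ α = 0 := by
  set R := min ρ 1 with hR
  have hR0 : r₀ < R := lt_min h1 h2
  have hRp : 0 < R := h0.trans hR0
  have hR1 : R ≤ 1 := min_le_right _ _
  have hle : -Real.pi ≤ Real.pi := by linarith [Real.pi_pos]
  have hg := hv.polar
  set C : ℝ := ∫ α in (-Real.pi)..Real.pi,
    (1 / 2 * pdy (polar v) R α ^ 2 + R ^ 4 * polar v R α ^ 2) with hC
  set I : ℝ := ∫ α in (-Real.pi)..Real.pi, polar v r₀ α ^ 2 with hI
  have key : ∀ N : ℕ, 1 ≤ N → M ^ 2 ≤ 6 * N →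
      1 / 2 * r₀ ^ 4 * I ≤ C * ((r₀ / R) ^ 2) ^ N := by
    intro N hN1 hMN
    obtain ⟨G, hG, hgG⟩ := hflat (N + 1)
    set Y : ℝ → ℝ → ℝ := fun r α => r * G r α with hYdef
    have hY : Sm Y := Sm.fst.mul hG
    have hgY : ∀ r α, polar v r α = r ^ N * Y r α := by
      intro r α; rw [hgG, hYdef]; ring
    have hper : ∀ r, 0 < r → ∀ α, Y r (α + 2 * Real.pi) = Y r α :=
      fun r hr α => polar_periodic' hgY hr α
    have hS : ∀ r α, 0 < r → r < R → |(N:ℝ) ^ 2 * Y r α + (2 * N + 1) * r * pdx Y r α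
      + r ^ 2 * pdx (pdx Y) r α + pdy (pdy Y) r α| ≤ M * r ^ 2 * |Y r α| :=
      fun r α hr hr' => polar_bound hv hY hgY hb hr (hr'.trans_le (min_le_left _ _))
    have hN1' : (1:ℝ) ≤ N := by exact_mod_cast hN1
    have A1 := carleman_antitone hY hper hN1' hMN (κ := 1 / 2) le_rfl (by norm_num) hR1 hM hS
      (left_mem_Icc.2 hRp.le) ⟨h0.le, hR0.le⟩ h0.le
    have A2 := carleman_antitone hY hper hN1' hMN (κ := 1) (by norm_num) le_rfl hR1 hM hS
      ⟨h0.le, hR0.le⟩ (right_mem_Icc.2 hRp.le) hR0.le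
    simp only at A1 A2
    have z0 : ∀ α, Y 0 α = 0 := by intro α; simp [hYdef]
    have z1 : ∀ α, pdy Y 0 α = 0 := by
      intro α
      have : (fun t => Y 0 t) = fun _ => 0 := by funext t; exact z0 t
      simp [pdy, this]
    simp only [z0, z1] at A1
    have ci : ∀ r : ℝ, Continuous (fun α => Y r α) ∧ Continuous (fun α => pdx Y r α) ∧
        Continuous (fun α => pdy Y r α) := fun r =>
      ⟨hY.cont2 continuous_const continuous_id, hY.dx.cont2 continuous_const continuous_id,
        hY.dy.cont2 continuous_const continuous_id⟩
    obtain ⟨i0, i1, i2⟩ := ci r₀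
    obtain ⟨j0, j1, j2⟩ := ci R
    -- combine
    have B1 : (∫ α in (-Real.pi)..Real.pi,
        (1 / 2 * ((r₀ * pdx Y r₀ α) ^ 2 + (N:ℝ) ^ 2 * Y r₀ α ^ 2 - pdy Y r₀ α ^ 2)
          - 1 / 2 * r₀ ^ 4 * Y r₀ α ^ 2)) ≤ 0 := by
      simpa using A1
    have B2 : (∫ α in (-Real.pi)..Real.pi,
        (1 / 2 * ((r₀ * pdx Y r₀ α) ^ 2 + (N:ℝ) ^ 2 * Y r₀ α ^ 2 - pdy Y r₀ α ^ 2)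
          - 1 * r₀ ^ 4 * Y r₀ α ^ 2)) = (∫ α in (-Real.pi)..Real.pi,
        (1 / 2 * ((r₀ * pdx Y r₀ α) ^ 2 + (N:ℝ) ^ 2 * Y r₀ α ^ 2 - pdy Y r₀ α ^ 2)
          - 1 / 2 * r₀ ^ 4 * Y r₀ α ^ 2))
        - 1 / 2 * r₀ ^ 4 * ∫ α in (-Real.pi)..Real.pi, Y r₀ α ^ 2 := by
      rw [← intervalIntegral.integral_const_mul, ← intervalIntegral.integral_sub]
      · congr 1; funext α; ring
      · exact Continuous.intervalIntegrable (by fun_prop) _ _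
      · exact Continuous.intervalIntegrable (by fun_prop) _ _
    have B3 : -(∫ α in (-Real.pi)..Real.pi, (1 / 2 * pdy Y R α ^ 2 + R ^ 4 * Y R α ^ 2)) ≤
      (∫ α in (-Real.pi)..Real.pi,
        (1 / 2 * ((R * pdx Y R α) ^ 2 + (N:ℝ) ^ 2 * Y R α ^ 2 - pdy Y R α ^ 2)
          - 1 * R ^ 4 * Y R α ^ 2)) := by
      rw [← intervalIntegral.integral_neg]
      refine intervalIntegral.integral_mono_on hle ?_ ?_ ?_
      · exact Continuous.intervalIntegrable (by fun_prop) _ _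
      · exact Continuous.intervalIntegrable (by fun_prop) _ _
      · intro α _
        nlinarith [sq_nonneg (R * pdx Y R α), sq_nonneg ((N:ℝ) * Y R α)]
    have B4 : C = (R ^ N) ^ 2 *
        ∫ α in (-Real.pi)..Real.pi, (1 / 2 * pdy Y R α ^ 2 + R ^ 4 * Y R α ^ 2) := by
      rw [hC, ← intervalIntegral.integral_const_mul]
      congr 1; funext α
      have : pdy (polar v) R α = R ^ N * pdy Y R α := by
        have hg' : polar v = fun r α => r ^ N * Y r α := by funext r α; exact hgY r α
        rw [hg']
        exact ((hY.hdy R α).const_mul (R ^ N)).deriv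
      rw [this, hgY]; ring
    have B5 : I = (r₀ ^ N) ^ 2 * ∫ α in (-Real.pi)..Real.pi, Y r₀ α ^ 2 := by
      rw [hI, ← intervalIntegral.integral_const_mul]
      congr 1; funext α
      rw [hgY]; ring
    have hRN : 0 < (R ^ N) ^ 2 := by positivity
    have B6 : 1 / 2 * r₀ ^ 4 * (∫ α in (-Real.pi)..Real.pi, Y r₀ α ^ 2) ≤
        ∫ α in (-Real.pi)..Real.pi, (1 / 2 * pdy Y R α ^ 2 + R ^ 4 * Y R α ^ 2) := by
      rw [B2] at A2
      linarith
    rw [B4, B5]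
    have e : ((r₀ / R) ^ 2) ^ N = (r₀ ^ N) ^ 2 / (R ^ N) ^ 2 := by
      rw [div_pow, div_pow, ← pow_mul, ← pow_mul, ← pow_mul, ← pow_mul, mul_comm 2 N]
    rw [e]
    have hr : 0 ≤ (r₀ ^ N) ^ 2 := by positivity
    calc _ = (r₀ ^ N) ^ 2 * (1 / 2 * r₀ ^ 4 * ∫ α in (-Real.pi)..Real.pi, Y r₀ α ^ 2) := by ring
      _ ≤ (r₀ ^ N) ^ 2 * _ := mul_le_mul_of_nonneg_left B6 hr
      _ = _ := by field_simp
  have hI0 : I ≤ 0 := by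
    have hq : (r₀ / R) ^ 2 < 1 := by
      have : r₀ / R < 1 := (div_lt_one hRp).2 hR0
      have h3 : 0 ≤ r₀ / R := by positivity
      nlinarith
    have ht := (tendsto_pow_atTop_nhds_zero_of_lt_one (by positivity) hq).const_mul C
    rw [mul_zero] at ht
    have : 1 / 2 * r₀ ^ 4 * I ≤ 0 := by
      refine ge_of_tendsto ht ?_
      obtain ⟨n0, hn0⟩ := exists_nat_ge (M ^ 2)
      filter_upwards [eventually_ge_atTop (n0 + 1)] with N hN
      have hN' : (n0:ℝ) + 1 ≤ N := by exact_mod_cast hN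
      exact key N (by omega) (by nlinarith [Nat.cast_nonneg (α := ℝ) n0])
    have hp : 0 < 1 / 2 * r₀ ^ 4 := by positivity
    by_contra hcon
    push Not at hcon
    nlinarith [mul_pos hp hcon]
  by_contra hne
  have hcont : Continuous fun α => polar v r₀ α ^ 2 :=
    (hg.cont2 continuous_const continuous_id).pow 2
  have hpos : 0 < I := by
    refine intervalIntegral.integral_pos (by linarith [Real.pi_pos]) hcont.continuousOn
      (fun x _ => sq_nonneg _) ⟨α, hα, by positivity⟩
  linarith

theorem divide_all {v G₀ : ℝ → ℝ → ℝ} (k₀ : ℕ) (hG₀ : Sm G₀)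
    (hg : ∀ r α, polar v r α = r ^ k₀ * G₀ r α)
    (hstep : ∀ k, k₀ ≤ k → ∀ G, Sm G → (∀ r α, polar v r α = r ^ k * G r α) → ∀ α, G 0 α = 0)
    (k : ℕ) : ∃ G, Sm G ∧ ∀ r α, polar v r α = r ^ k * G r α := by
  have h1 : ∀ j, ∃ G, Sm G ∧ ∀ r α, polar v r α = r ^ (k₀ + j) * G r α := by
    intro j
    induction j with
    | zero => exact ⟨G₀, hG₀, hg⟩
    | succ j ih =>
      obtain ⟨G, hG, hgG⟩ := ih
      obtain ⟨G', hG', he, _⟩ := hG.hadamard (hstep _ (by omega) G hG hgG)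
      exact ⟨G', hG', fun r α => by rw [hgG, he]; ring⟩
  rcases le_total k₀ k with h | h
  · obtain ⟨j, rfl⟩ := Nat.exists_eq_add_of_le h
    exact h1 j
  · obtain ⟨j, rfl⟩ := Nat.exists_eq_add_of_le h
    exact ⟨fun r α => r ^ j * G₀ r α, (Sm.powS j).mul hG₀, fun r α => by rw [hg]; ring⟩

theorem zero_of_int {φ : ℝ → ℝ} (hφ : Continuous φ) (h0 : ∀ x, 0 ≤ φ x) (a : ℝ)
    (hi : ∫ x in a..(a + 2 * Real.pi), φ x = 0) : φ a = 0 := by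
  by_contra hne
  have hpos : 0 < φ a := lt_of_le_of_ne (h0 a) (Ne.symm hne)
  have := intervalIntegral.integral_pos (a := a) (b := a + 2 * Real.pi)
    (by linarith [Real.pi_pos]) hφ.continuousOn (fun x _ => h0 x)
    ⟨a, ⟨le_rfl, by linarith [Real.pi_pos]⟩, hpos⟩
  linarith

/-- a one-signed solution of `|Δv| ≤ M |v|` vanishing at the origin vanishes near the origin -/
theorem onesign_zero {v : ℝ → ℝ → ℝ} (hv : Sm v) {M ρ : ℝ} (hM : 0 ≤ M) (hρ : 0 < ρ)
    (hb : ∀ r α, 0 < r → r < ρ → |lap v (r * Real.cos α) (r * Real.sin α)| ≤ M * |polar v r α|)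
    (s : ℝ) (hs : s ≠ 0) (hsgn : ∀ x y, 0 ≤ s * v x y) (h00 : v 0 0 = 0)
    {r₀ α : ℝ} (h0 : 0 < r₀) (h1 : r₀ < ρ) (h2 : r₀ < 1) (hα : α ∈ Icc (-Real.pi) Real.pi) :
    polar v r₀ α = 0 := by
  refine flat_zero hv hM hb ?_ h0 h1 h2 hα
  obtain ⟨G₁, hG₁, he, _⟩ := hv.polar.hadamard (by intro α; simp [polar, h00])
  refine divide_all 1 hG₁ (by simpa using he) ?_
  intro k hk G hG hgG a
  have hode := polar_ode hv hG hgG hρ hb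
  have hper := polar_periodic hG hgG
  have hdper := pdy_periodic (Y := G) (r := 0) hper
  have i0 := hG.cont2 (f := fun _ : ℝ => (0:ℝ)) (g := fun α : ℝ => α) continuous_const continuous_id
  have hpos : ∀ α, 0 ≤ s * G 0 α := by
    intro α
    have c0 := hG.cont2 (f := fun r : ℝ => r) (g := fun _ => α) continuous_id continuous_const
    have c1 : Continuous fun r => s * G r α := c0.const_mul s
    have T : Tendsto (fun r => s * G r α) (nhdsWithin 0 (Ioi 0)) (nhds (s * G 0 α)) :=
      c1.continuousWithinAt
    refine ge_of_tendsto T ?_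
    filter_upwards [self_mem_nhdsWithin] with r hr
    have h3 : 0 ≤ s * polar v r α := hsgn _ _
    rw [hgG] at h3
    have hp : 0 < r ^ k := pow_pos hr k
    refine nonneg_of_mul_nonneg_right (a := r ^ k) ?_ hp
    linarith
  have hint : ∫ x in a..(a + 2 * Real.pi), s * G 0 x = 0 := by
    have hFTC := intervalIntegral.integral_eq_sub_of_hasDerivAt (a := a) (b := a + 2 * Real.pi)
      (f := fun α => s * pdy G 0 α) (f' := fun α => -(k:ℝ) ^ 2 * (s * G 0 α))
      (fun α _ => by
        refine ((hG.dy.hdy 0 α).const_mul s).congr_deriv ?_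
        rw [hode]; ring)
      (Continuous.intervalIntegrable (by fun_prop) _ _)
    rw [intervalIntegral.integral_const_mul, hdper, sub_self] at hFTC
    have hk' : (k:ℝ) ≠ 0 := by
      have : (1:ℝ) ≤ k := by exact_mod_cast hk
      linarith
    rcases mul_eq_zero.1 hFTC with h | h
    · exact absurd h (by simpa using hk')
    · exact h
  have := zero_of_int (φ := fun x => s * G 0 x) (by fun_prop) hpos a hint
  exact (mul_eq_zero.1 this).resolve_left hs

theorem degenerate_zero {v w h : ℝ → ℝ → ℝ} (hv : Sm v) (hw : Sm w) (hh : Sm h)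
    (hx : ∀ x y, pdx h x y = v x y * pdy w x y - w x y * pdy v x y)
    (hy : ∀ x y, pdy h x y = -(v x y * pdx w x y - w x y * pdx v x y))
    {M ρ : ℝ} (hM : 0 ≤ M) (hρ : 0 < ρ)
    (hb : ∀ r α, 0 < r → r < ρ → |lap v (r * Real.cos α) (r * Real.sin α)| ≤ M * |polar v r α|)
    (s : ℝ) (hmin : ∀ r α, 0 < r → r < ρ →
      s * h 0 0 ≤ s * h (r * Real.cos α) (r * Real.sin α)) (hs : s ≠ 0)
    (hv0 : v 0 0 = 0) (hw0 : w 0 0 = 0) (hvx : pdx v 0 0 = 0) (hvy : pdy v 0 0 = 0)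
    {a b l : ℝ} (hwx : pdx w 0 0 = -(b * l)) (hwy : pdy w 0 0 = a * l) (hl : l ≠ 0)
    (hab : a ^ 2 + b ^ 2 = 1)
    {r₀ α : ℝ} (h0 : 0 < r₀) (h1 : r₀ < ρ) (h2 : r₀ < 1) (hα : α ∈ Icc (-Real.pi) Real.pi) :
    polar v r₀ α = 0 := by
  refine flat_zero hv hM hb ?_ h0 h1 h2 hα
  obtain ⟨G₁, hG₁, he₁, hz₁⟩ := hv.polar.hadamard (by intro α; simp [polar, hv0])
  obtain ⟨G₂, hG₂, he₂, _⟩ := hG₁.hadamard (by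
    intro α; rw [hz₁, pdx_polar hv]; simp [hvx, hvy])
  obtain ⟨w₁, hw₁, hew, hzw⟩ := hw.polar.hadamard (by intro α; simp [polar, hw0])
  have hψ : ∀ α, w₁ 0 α = -(b * l) * Real.cos α + a * l * Real.sin α := by
    intro α; rw [hzw, pdx_polar hw]; simp [hwx, hwy]
  have hψ' : ∀ α, pdy w₁ 0 α = (b * l) * Real.sin α + a * l * Real.cos α := by
    intro α
    have e : (fun t => w₁ 0 t) = fun t => -(b * l) * Real.cos t + a * l * Real.sin t := by
      funext t; exact hψ t
    have := (((Real.hasDerivAt_cos α).const_mul (-(b * l))).add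
      ((Real.hasDerivAt_sin α).const_mul (a * l))).deriv
    unfold pdy
    rw [e]
    exact this.trans (by ring)
  refine divide_all 2 hG₂ (fun r α => by rw [he₁, he₂]; ring) ?_
  intro k hk G hG hgG
  have hode := polar_ode hv hG hgG hρ hb
  have hper := polar_periodic hG hgG
  have hdper := pdy_periodic (Y := G) (r := 0) hper
  set B : ℝ → ℝ → ℝ := fun r α => G r α * pdy w₁ r α - w₁ r α * pdy G r α with hB
  have hBS : Sm B := (hG.mul hw₁.dy).sub (hw₁.mul hG.dy)
  have hk2 : (2:ℝ) ≤ k := by exact_mod_cast hk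
  have hk1 : (k:ℝ) ^ 2 - 1 ≠ 0 := by nlinarith
  -- sign of B at r = 0
  have hBpos : ∀ α, 0 ≤ s * B 0 α := by
    intro α
    by_contra hneg
    push Not at hneg
    have cB : Continuous fun r => s * B r α :=
      (hBS.cont2 (f := fun r : ℝ => r) continuous_id continuous_const).const_mul s
    have hev : ∀ᶠ r in nhds (0:ℝ), s * B r α < 0 := cB.continuousAt.eventually_lt_const hneg
    obtain ⟨ε, hε, hball⟩ := Metric.eventually_nhds_iff.1 hev
    set t := min (ε / 2) (ρ / 2) with ht
    have ht0 : 0 < t := lt_min (by linarith) (by linarith)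
    have htε : t < ε := (min_le_left _ _).trans_lt (by linarith)
    have htρ : t < ρ := (min_le_right _ _).trans_lt (by linarith)
    have hder : ∀ r, HasDerivAt (fun r => s * polar h r α) (s * pdx (polar h) r α) r := fun r =>
      (hh.polar.hdx r α).const_mul s
    have hrd : ∀ r, r * pdx (polar h) r α = r ^ (k + 1) * B r α := by
      intro r
      have q1 : pdy (polar v) r α = r ^ k * pdy G r α := by
        have hg' : polar v = fun r α => r ^ k * G r α := by funext r α; exact hgG r α
        rw [hg']; exact ((hG.hdy r α).const_mul (r ^ k)).deriv
      have q2 : pdy (polar w) r α = r * pdy w₁ r α := by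
        have hg' : polar w = fun r α => r * w₁ r α := by funext r α; exact hew r α
        rw [hg']; exact ((hw₁.hdy r α).const_mul r).deriv
      have q3 : r * pdx (polar h) r α = polar v r α * pdy (polar w) r α
          - polar w r α * pdy (polar v) r α := by
        rw [pdx_polar hh, pdy_polar hw, pdy_polar hv]
        simp only [hx, hy, polar]
        ring
      rw [q3, q1, q2, hgG, hew, hB]
      ring
    have hanti : StrictAntiOn (fun r => s * polar h r α) (Icc 0 t) := by
      refine strictAntiOn_of_deriv_neg (convex_Icc 0 t)
        (fun r _ => (hder r).continuousAt.continuousWithinAt) ?_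
      intro r hr
      rw [interior_Icc] at hr
      rw [(hder r).deriv]
      have hn : s * B r α < 0 := hball (by
        rw [Real.dist_eq, sub_zero, abs_of_pos hr.1]; exact hr.2.trans htε)
      have e := hrd r
      have hp : 0 < r ^ (k + 1) := pow_pos hr.1 _
      by_contra hcon
      push Not at hcon
      have : 0 ≤ r * (s * pdx (polar h) r α) := mul_nonneg hr.1.le hcon
      have e2 : r * (s * pdx (polar h) r α) = r ^ (k + 1) * (s * B r α) := by
        linear_combination s * e
      rw [e2] at this
      nlinarith [mul_neg_of_pos_of_neg hp hn]
    have := hanti (left_mem_Icc.2 ht0.le) (right_mem_Icc.2 ht0.le) ht0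
    have hm := hmin t α ht0 htρ
    simp only [polar, zero_mul] at this
    linarith
  -- the mean of B vanishes
  have iG := hG.cont2 (f := fun _ : ℝ => (0:ℝ)) (g := fun α : ℝ => α) continuous_const continuous_id
  have iB := hBS.cont2 (f := fun _ : ℝ => (0:ℝ)) (g := fun α : ℝ => α) continuous_const
    continuous_id
  have hψ'' : ∀ α, pdy (pdy w₁) 0 α = - w₁ 0 α := by
    intro α
    have e : (fun t => pdy w₁ 0 t) = fun t => (b * l) * Real.sin t + a * l * Real.cos t := by
      funext t; exact hψ' t
    have := (((Real.hasDerivAt_sin α).const_mul (b * l)).add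
      ((Real.hasDerivAt_cos α).const_mul (a * l))).deriv
    have e2 : pdy (pdy w₁) 0 α = deriv (fun t => pdy w₁ 0 t) α := rfl
    rw [e2, e, hψ]
    exact this.trans (by ring)
  have hBz : ∀ α, B 0 α = 0 := by
    intro c
    have hFTC := intervalIntegral.integral_eq_sub_of_hasDerivAt (a := c) (b := c + 2 * Real.pi)
      (f := fun α => -2 * (G 0 α * w₁ 0 α) - 2 * (pdy G 0 α * pdy w₁ 0 α)
        - ((k:ℝ) ^ 2 - 1) * (w₁ 0 α * G 0 α))
      (f' := fun α => (((k:ℝ) ^ 2 - 1) * B 0 α))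
      (fun α _ => by
        refine (((((hG.hdy 0 α).mul (hw₁.hdy 0 α)).const_mul (-2)).sub
          (((hG.dy.hdy 0 α).mul (hw₁.dy.hdy 0 α)).const_mul 2)).sub
          (((hw₁.hdy 0 α).mul (hG.hdy 0 α)).const_mul ((k:ℝ) ^ 2 - 1))).congr_deriv ?_
        rw [hode, hψ'', hB]; ring)
      (Continuous.intervalIntegrable (by fun_prop) _ _)
    rw [intervalIntegral.integral_const_mul] at hFTC
    simp only [hdper, hper, hψ, hψ', Real.cos_add_two_pi, Real.sin_add_two_pi, sub_self] at hFTC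
    have hi := (mul_eq_zero.1 hFTC).resolve_left hk1
    have hi2 : ∫ x in c..(c + 2 * Real.pi), s * B 0 x = 0 := by
      rw [intervalIntegral.integral_const_mul, hi, mul_zero]
    have := zero_of_int (φ := fun x => s * B 0 x) (by fun_prop) hBpos c hi2
    exact (mul_eq_zero.1 this).resolve_left hs
  intro α
  have hprod : ((k:ℝ) ^ 2 - 1) * (w₁ 0 α * G 0 α) = 0 := by
    have hd := ((hG.hdy 0 α).mul (hw₁.dy.hdy 0 α)).sub ((hw₁.hdy 0 α).mul (hG.dy.hdy 0 α))
    have e : (fun t => B 0 t) = fun _ => 0 := by funext t; exact hBz t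
    have hd2 : HasDerivAt (fun t => B 0 t) 0 α := by rw [e]; exact hasDerivAt_const _ _
    have hu := HasDerivAt.unique hd2 hd
    rw [hode, hψ''] at hu
    linear_combination -hu
  have hp2 := (mul_eq_zero.1 hprod).resolve_left hk1
  rcases mul_eq_zero.1 hp2 with hw' | hG'
  · have hb0 := hBz α
    simp only [hB, hw', zero_mul, sub_zero] at hb0
    rcases mul_eq_zero.1 hb0 with h | h
    · exact h
    · exfalso
      rw [hψ] at hw'
      rw [hψ'] at h
      have t := Real.sin_sq_add_cos_sq α
      have : l ^ 2 = 0 := by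
        have e1 : (-(b * l) * Real.cos α + a * l * Real.sin α) ^ 2
          + ((b * l) * Real.sin α + a * l * Real.cos α) ^ 2 = l ^ 2 := by
          linear_combination (l ^ 2) * hab + (a ^ 2 + b ^ 2) * l ^ 2 * t
        rw [hw', h] at e1
        linarith
      exact hl (by simpa using this)
  · exact hG'


theorem crit_of_max {u : ℝ → ℝ → ℝ} (hu : Sm u) {s a b : ℝ} (hs : s ≠ 0)
    (h : ∀ x y, s * u x y ≤ s * u a b) : pdx u a b = 0 ∧ pdy u a b = 0 := by
  constructor
  · have h1 : IsLocalMax (fun t => s * u t b) a := Filter.Eventually.of_forall fun t => h t b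
    have h2 := h1.hasDerivAt_eq_zero ((hu.hdx a b).const_mul s)
    exact (mul_eq_zero.1 h2).resolve_left hs
  · have h1 : IsLocalMax (fun t => s * u a t) b := Filter.Eventually.of_forall fun t => h a t
    have h2 := h1.hasDerivAt_eq_zero ((hu.hdy a b).const_mul s)
    exact (mul_eq_zero.1 h2).resolve_left hs

theorem polar_surj (x y : ℝ) : ∃ r α : ℝ, 0 ≤ r ∧ r ^ 2 = x ^ 2 + y ^ 2 ∧ α ∈ Icc (-Real.pi) Real.pi ∧
    x = r * Real.cos α ∧ y = r * Real.sin α := by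
  refine ⟨‖(⟨x, y⟩ : ℂ)‖, Complex.arg ⟨x, y⟩, norm_nonneg _, ?_, ?_, ?_, ?_⟩
  · rw [Complex.sq_norm, Complex.normSq_mk]; ring
  · exact ⟨(Complex.neg_pi_lt_arg _).le, Complex.arg_le_pi _⟩
  · rw [Complex.norm_mul_cos_arg]
  · rw [Complex.norm_mul_sin_arg]

theorem ext_preconn {R : ℝ} (hR : 0 ≤ R) :
    IsPreconnected {p : ℝ × ℝ | R ^ 2 < p.1 ^ 2 + p.2 ^ 2} := by
  have h : {p : ℝ × ℝ | R ^ 2 < p.1 ^ 2 + p.2 ^ 2} =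
      (fun q : ℝ × ℝ => (q.1 * Real.cos q.2, q.1 * Real.sin q.2)) '' (Ioi R ×ˢ univ) := by
    ext ⟨x, y⟩
    simp only [mem_setOf_eq, mem_image, mem_prod, mem_Ioi, mem_univ, and_true, Prod.exists,
      Prod.mk.injEq]
    constructor
    · intro hxy
      obtain ⟨r, α, h0, h1, -, h2, h3⟩ := polar_surj x y
      refine ⟨r, α, ?_, h2.symm, h3.symm⟩
      rw [← h1] at hxy
      exact lt_of_pow_lt_pow_left₀ 2 h0 hxy
    · rintro ⟨r, α, hr, rfl, rfl⟩
      have := Real.sin_sq_add_cos_sq α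
      have h2 : (r * Real.cos α) ^ 2 + (r * Real.sin α) ^ 2 = r ^ 2 := by
        linear_combination r ^ 2 * this
      rw [h2]
      exact pow_lt_pow_left₀ hr hR (by norm_num)
  rw [h]
  refine IsPreconnected.image (isPreconnected_Ioi.prod isPreconnected_univ) _ ?_
  fun_prop

theorem extremum {u : ℝ → ℝ → ℝ} (hu : Sm u)
    (huniq : ∀ x y, pdx u x y = 0 → pdy u x y = 0 → x = 0 ∧ y = 0) {c : ℝ}
    (hnon : ∃ x y, u x y = c) (hcomp : IsCompact {p : ℝ × ℝ | u p.1 p.2 = c}) :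
    ∃ s : ℝ, s * s = 1 ∧ IsCompact {p : ℝ × ℝ | s * c ≤ s * u p.1 p.2} ∧
      ∀ x y, s * u x y ≤ s * u 0 0 := by
  obtain ⟨R, hR⟩ := hcomp.isBounded.subset_closedBall (0 : ℝ × ℝ)
  have hR' : ∀ x y, u x y = c → |x| ≤ R ∧ |y| ≤ R := by
    intro x y h
    have := hR (show ((x, y) : ℝ × ℝ) ∈ _ from h)
    rw [mem_closedBall, dist_zero_right, Prod.norm_def] at this
    exact ⟨(le_max_left _ _).trans this, (le_max_right _ _).trans this⟩
  obtain ⟨x₁, y₁, hxy₁⟩ := hnon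
  have hR0 : 0 ≤ R := (abs_nonneg _).trans (hR' x₁ y₁ hxy₁).1
  have hpre := ext_preconn (R := 2 * R) (by linarith)
  set S := {p : ℝ × ℝ | (2 * R) ^ 2 < p.1 ^ 2 + p.2 ^ 2} with hS
  have hne : ∀ p ∈ S, u p.1 p.2 ≠ c := by
    intro p hp hc
    obtain ⟨h1, h2⟩ := hR' _ _ hc
    have h3 := sq_le_sq' (abs_le.1 h1).1 (abs_le.1 h1).2
    have h4 := sq_le_sq' (abs_le.1 h2).1 (abs_le.1 h2).2
    rw [hS, mem_setOf_eq] at hp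
    nlinarith
  have hq : ((2 * R + 1, 0) : ℝ × ℝ) ∈ S := by
    rw [hS, mem_setOf_eq]; dsimp only; nlinarith
  obtain ⟨s, hs, hsq⟩ : ∃ s : ℝ, s * s = 1 ∧ s * u (2 * R + 1) 0 < s * c := by
    rcases lt_or_gt_of_ne (hne _ hq) with h | h
    · exact ⟨1, by norm_num, by simpa using h⟩
    · exact ⟨-1, by norm_num, by simpa using h⟩
  have hs0 : s ≠ 0 := by rintro rfl; norm_num at hs
  have hcont : Continuous fun p : ℝ × ℝ => s * u p.1 p.2 := hu.cont.const_mul s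
  have hlt : ∀ p ∈ S, s * u p.1 p.2 < s * c := by
    intro p hp
    by_contra hcon
    push Not at hcon
    obtain ⟨p', hp', he⟩ := hpre.intermediate_value hq hp hcont.continuousOn
      (show s * c ∈ Icc _ _ from ⟨hsq.le, hcon⟩)
    exact hne p' hp' (mul_left_cancel₀ hs0 he)
  have hK : IsCompact {p : ℝ × ℝ | s * c ≤ s * u p.1 p.2} := by
    refine Metric.isCompact_of_isClosed_isBounded (isClosed_le continuous_const hcont) ?_
    refine (Metric.isBounded_closedBall (x := (0 : ℝ × ℝ)) (r := 2 * R)).subset ?_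
    intro p hp
    have h1 : p ∉ S := fun h => absurd (hlt p h) (not_lt.2 hp)
    rw [hS, mem_setOf_eq, not_lt] at h1
    rw [mem_closedBall, dist_zero_right, Prod.norm_def]
    refine max_le ?_ ?_
    · exact abs_le_of_sq_le_sq (by nlinarith [sq_nonneg p.2]) (by linarith)
    · exact abs_le_of_sq_le_sq (by nlinarith [sq_nonneg p.1]) (by linarith)
  refine ⟨s, hs, hK, ?_⟩
  obtain ⟨m, hm, hmax⟩ := hK.exists_isMaxOn ⟨(x₁, y₁), by simp [hxy₁]⟩ hcont.continuousOn
  have hglob : ∀ x y, s * u x y ≤ s * u m.1 m.2 := by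
    intro x y
    by_cases h : s * c ≤ s * u x y
    · exact hmax (show ((x, y) : ℝ × ℝ) ∈ _ from h)
    · exact (not_le.1 h).le.trans hm
  have hc := crit_of_max hu hs0 hglob
  have h0 := huniq _ _ hc.1 hc.2
  rw [h0.1, h0.2] at hglob
  exact hglob

theorem lap_dx {u : ℝ → ℝ → ℝ} {f : ℝ → ℝ} (hu : Sm u) (hf : ContDiff ℝ (⊤ : ℕ∞) f)
    (hpde : ∀ x y, -(pdx (pdx u) x y + pdy (pdy u) x y) = f (u x y)) (x y : ℝ) :
    lap (pdx u) x y = -(deriv f (u x y)) * pdx u x y := by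
  have hfd : HasDerivAt f (deriv f (u x y)) (u x y) :=
    ((hf.differentiable (by simp)) _).hasDerivAt
  have h1 : HasDerivAt (fun t => f (u t y)) (deriv f (u x y) * pdx u x y) x :=
    HasDerivAt.comp (h₂ := f) (h := fun t => u t y) x hfd (hu.hdx x y)
  have h2 := ((hu.dx.dx.hdx x y).add (hu.dy.dy.hdx x y)).neg
  have h3 : (fun t => f (u t y)) = -((fun s => pdx (pdx u) s y) + fun s => pdy (pdy u) s y) := by
    funext t; exact (hpde t y).symm
  rw [h3] at h1
  have h4 := h1.unique h2
  have e : pdx (pdy u) = pdy (pdx u) := by funext x y; exact hu.comm x y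
  rw [hu.dy.comm, e] at h4
  unfold lap
  linarith

theorem lap_dy {u : ℝ → ℝ → ℝ} {f : ℝ → ℝ} (hu : Sm u) (hf : ContDiff ℝ (⊤ : ℕ∞) f)
    (hpde : ∀ x y, -(pdx (pdx u) x y + pdy (pdy u) x y) = f (u x y)) (x y : ℝ) :
    lap (pdy u) x y = -(deriv f (u x y)) * pdy u x y := by
  have hfd : HasDerivAt f (deriv f (u x y)) (u x y) :=
    ((hf.differentiable (by simp)) _).hasDerivAt
  have h1 : HasDerivAt (fun t => f (u x t)) (deriv f (u x y) * pdy u x y) y :=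
    HasDerivAt.comp (h₂ := f) (h := fun t => u x t) y hfd (hu.hdy x y)
  have h2 := ((hu.dx.dx.hdy x y).add (hu.dy.dy.hdy x y)).neg
  have h3 : (fun t => f (u x t)) = -((fun s => pdx (pdx u) x s) + fun s => pdy (pdy u) x s) := by
    funext t; exact (hpde x t).symm
  rw [h3] at h1
  have h4 := h1.unique h2
  have e : pdx (pdy u) = pdy (pdx u) := by funext x y; exact hu.comm x y
  rw [← hu.dx.comm, ← e] at h4
  unfold lap
  linarith

theorem exists_stream {u : ℝ → ℝ → ℝ} {f : ℝ → ℝ} (hu : Sm u) (hf : ContDiff ℝ (⊤ : ℕ∞) f)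
    (hpde : ∀ x y, -(pdx (pdx u) x y + pdy (pdy u) x y) = f (u x y)) :
    ∃ h : ℝ → ℝ → ℝ, Sm h ∧
      (∀ x y, pdx h x y = pdx u x y * pdy (pdy u) x y - pdy u x y * pdy (pdx u) x y) ∧
      (∀ x y, pdy h x y = -(pdx u x y * pdy (pdx u) x y - pdy u x y * pdx (pdx u) x y)) ∧
      (∀ x y, pdx (pdx h) x y + pdy (pdy h) x y =
        2 * (pdx (pdx u) x y * pdy (pdy u) x y - pdy (pdx u) x y ^ 2)) := by
  have e : pdx (pdy u) = pdy (pdx u) := by funext x y; exact hu.comm x y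
  have e2 : ∀ x y, pdx (pdy (pdy u)) x y = pdy (pdy (pdx u)) x y := by
    intro x y; rw [hu.dy.comm, e]
  have e3 : ∀ x y, pdx (pdy (pdx u)) x y = pdy (pdx (pdx u)) x y := hu.dx.comm
  set P : ℝ → ℝ → ℝ := fun x y => pdx u x y * pdy (pdy u) x y - pdy u x y * pdy (pdx u) x y with hP
  set Q : ℝ → ℝ → ℝ := fun x y => pdy u x y * pdx (pdx u) x y - pdx u x y * pdy (pdx u) x y with hQ
  have sP : Sm P := (hu.dx.mul hu.dy.dy).sub (hu.dy.mul hu.dx.dy)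
  have sQ : Sm Q := (hu.dy.mul hu.dx.dx).sub (hu.dx.mul hu.dx.dy)
  have dPx : ∀ x y, pdx P x y = pdx (pdx u) x y * pdy (pdy u) x y
      + pdx u x y * pdx (pdy (pdy u)) x y - (pdx (pdy u) x y * pdy (pdx u) x y
      + pdy u x y * pdx (pdy (pdx u)) x y) := fun x y =>
    (((hu.dx.hdx x y).mul (hu.dy.dy.hdx x y)).sub ((hu.dy.hdx x y).mul (hu.dx.dy.hdx x y))).deriv
  have dPy : ∀ x y, pdy P x y = pdy (pdx u) x y * pdy (pdy u) x y
      + pdx u x y * pdy (pdy (pdy u)) x y - (pdy (pdy u) x y * pdy (pdx u) x y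
      + pdy u x y * pdy (pdy (pdx u)) x y) := fun x y =>
    (((hu.dx.hdy x y).mul (hu.dy.dy.hdy x y)).sub ((hu.dy.hdy x y).mul (hu.dx.dy.hdy x y))).deriv
  have dQx : ∀ x y, pdx Q x y = pdx (pdy u) x y * pdx (pdx u) x y
      + pdy u x y * pdx (pdx (pdx u)) x y - (pdx (pdx u) x y * pdy (pdx u) x y
      + pdx u x y * pdx (pdy (pdx u)) x y) := fun x y =>
    (((hu.dy.hdx x y).mul (hu.dx.dx.hdx x y)).sub ((hu.dx.hdx x y).mul (hu.dx.dy.hdx x y))).deriv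
  have dQy : ∀ x y, pdy Q x y = pdy (pdy u) x y * pdx (pdx u) x y
      + pdy u x y * pdy (pdx (pdx u)) x y - (pdy (pdx u) x y * pdy (pdx u) x y
      + pdx u x y * pdy (pdy (pdx u)) x y) := fun x y =>
    (((hu.dy.hdy x y).mul (hu.dx.dx.hdy x y)).sub ((hu.dx.hdy x y).mul (hu.dx.dy.hdy x y))).deriv
  obtain ⟨h, sh, hx, hy⟩ := exists_potential sP sQ (by
    intro x y
    have l1 := lap_dx hu hf hpde x y
    have l2 := lap_dy hu hf hpde x y
    unfold lap at l1 l2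
    rw [dPy, dQx]
    rw [e] at *
    linear_combination pdx u x y * l2 - pdy u x y * l1)
  refine ⟨h, sh, hx, ?_, ?_⟩
  · intro x y; rw [hy, hQ]; ring
  · intro x y
    have a1 : pdx h = P := by funext x y; exact hx x y
    have a2 : pdy h = Q := by funext x y; exact hy x y
    rw [a1, a2, dPx, dQy, e2, e3, e]
    ring

theorem second_deriv_nonneg {f f1 : ℝ → ℝ} {d x : ℝ} (hf : ∀ t, HasDerivAt f (f1 t) t)
    (h1 : HasDerivAt f1 d x) (hmin : IsLocalMin f x) : 0 ≤ d := by
  by_contra hd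
  push Not at hd
  have e : deriv f = f1 := by funext t; exact (hf t).deriv
  have hz : f1 x = 0 := hmin.hasDerivAt_eq_zero (hf x)
  have hmax : IsLocalMax f x := by
    refine isLocalMax_of_deriv_deriv_neg ?_ ?_ (hf x).continuousAt
    · rw [e, h1.deriv]; exact hd
    · rw [e, hz]
  have hc : f =ᶠ[nhds x] fun _ => f x := by
    filter_upwards [hmin, hmax] with t h2 h3
    exact le_antisymm h3 h2
  have h4 := hc.deriv
  rw [e] at h4
  have h5 : HasDerivAt f1 0 x := by
    refine (hasDerivAt_const x (0:ℝ)).congr_of_eventuallyEq ?_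
    filter_upwards [h4] with t ht
    rw [ht]; simp
  have := h1.unique h5
  linarith

theorem eventually_gt_of_deriv_pos {f : ℝ → ℝ} {d : ℝ} (hf : HasDerivAt f d 0) (hd : 0 < d) :
    ∀ᶠ t in nhdsWithin (0:ℝ) (Ioi 0), f 0 < f t := by
  have h1 := (hasDerivAt_iff_tendsto_slope.1 hf).eventually (lt_mem_nhds hd)
  have h2 : nhdsWithin (0:ℝ) (Ioi 0) ≤ nhdsWithin (0:ℝ) {0}ᶜ :=
    nhdsWithin_mono _ (fun t ht => ne_of_gt ht)
  filter_upwards [h2 h1, self_mem_nhdsWithin] with t ht h0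
  have h0' : (0:ℝ) < t := h0
  rw [slope_def_field, sub_zero] at ht
  have := (div_pos_iff_of_pos_right h0').1 ht
  linarith

theorem weak_min {W G N a b : ℝ → ℝ → ℝ} (hW : Sm W) (hG : Sm G) (hN : Sm N) (ha : Sm a)
    {c : ℝ} (hK : IsCompact {p : ℝ × ℝ | c ≤ W p.1 p.2})
    (hbd : ∀ x y, W x y = c → pdx W x y * pdx G x y + pdy W x y * pdy G x y < 0)
    (hN0 : ∀ x y, (x = 0 ∧ y = 0) ∨ 0 < N x y)
    (heq : ∀ x y, N x y * (pdx (pdx G) x y + pdy (pdy G) x y)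
      = a x y * pdx G x y + b x y * pdy G x y) (x₁ y₁ : ℝ) (h₁ : c ≤ W x₁ y₁) :
    G 0 0 ≤ G x₁ y₁ := by
  by_contra hcon
  push Not at hcon
  set K := {p : ℝ × ℝ | c ≤ W p.1 p.2} with hKdef
  set η := (G 0 0 - G x₁ y₁) / 2 with hη
  have hηpos : 0 < η := by rw [hη]; linarith
  have hK1 : IsCompact (K ∩ {p : ℝ × ℝ | G p.1 p.2 ≤ G x₁ y₁ + η}) :=
    hK.inter_right (isClosed_le hG.cont continuous_const)
  have hNpos : ∀ p : ℝ × ℝ, G p.1 p.2 ≤ G x₁ y₁ + η → 0 < N p.1 p.2 := by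
    intro p hp
    rcases hN0 p.1 p.2 with h | h
    · rw [h.1, h.2] at hp; exfalso; rw [hη] at hp; linarith
    · exact h
  obtain ⟨C, hC⟩ := hK1.exists_bound_of_continuousOn (f := fun p => a p.1 p.2 / N p.1 p.2)
    (ContinuousOn.div ha.cont.continuousOn hN.cont.continuousOn
      (fun p hp => (hNpos p hp.2).ne'))
  set k := |C| + 1 with hk
  have hkpos : 0 < k := by positivity
  have hak : ∀ x y, c ≤ W x y → G x y ≤ G x₁ y₁ + η → a x y < k * N x y := by
    intro x y h1 h2
    have h3 := hC (x, y) ⟨h1, h2⟩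
    have h4 := hNpos (x, y) h2
    dsimp only at h3 h4
    rw [Real.norm_eq_abs] at h3
    have h5 : a x y / N x y < k := by
      rw [hk]; linarith [le_abs_self (a x y / N x y), le_abs_self C]
    rwa [div_lt_iff₀ h4] at h5
  have hexp : Continuous fun p : ℝ × ℝ => Real.exp (k * p.1) := by fun_prop
  obtain ⟨B, hB⟩ := hK.exists_bound_of_continuousOn hexp.continuousOn
  have hL : IsCompact (K ∩ {p : ℝ × ℝ | W p.1 p.2 = c}) :=
    hK.inter_right (isClosed_eq hW.cont continuous_const)
  obtain ⟨C2, hC2⟩ := hL.exists_bound_of_continuousOn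
    (f := fun p => k * Real.exp (k * p.1) * pdx W p.1 p.2 /
      (pdx W p.1 p.2 * pdx G p.1 p.2 + pdy W p.1 p.2 * pdy G p.1 p.2))
    (ContinuousOn.div ((hexp.const_mul k).mul hW.dx.cont).continuousOn
      ((hW.dx.cont.mul hG.dx.cont).add (hW.dy.cont.mul hG.dy.cont)).continuousOn
      (fun p hp => (hbd _ _ hp.2).ne))
  set S := |B| + |C2| + 1 with hS
  have hSpos : 0 < S := by positivity
  set ε := min η 1 / S with hε
  have hmin : 0 < min η 1 := lt_min hηpos one_pos
  have hεpos : 0 < ε := div_pos hmin hSpos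
  have hεS : ε * S = min η 1 := by rw [hε]; field_simp
  have hεB : ∀ x y, c ≤ W x y → ε * Real.exp (k * x) < η := by
    intro x y h
    have h1 := hB (x, y) h
    dsimp only at h1
    rw [Real.norm_eq_abs, abs_of_pos (Real.exp_pos _)] at h1
    have h2 : Real.exp (k * x) < S := by
      rw [hS]; linarith [le_abs_self B, abs_nonneg C2]
    have h3 := mul_lt_mul_of_pos_left h2 hεpos
    rw [hεS] at h3
    exact h3.trans_le (min_le_left _ _)
  have hFc : Continuous fun p : ℝ × ℝ => G p.1 p.2 - ε * Real.exp (k * p.1) :=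
    hG.cont.sub (hexp.const_mul ε)
  obtain ⟨⟨x, y⟩, hp, hpmin⟩ := hK.exists_isMinOn ⟨(x₁, y₁), h₁⟩ hFc.continuousOn
  have hp' : c ≤ W x y := hp
  have hmn : ∀ x' y', c ≤ W x' y' →
      G x y - ε * Real.exp (k * x) ≤ G x' y' - ε * Real.exp (k * x') := by
    intro x' y' h
    exact hpmin (show ((x', y') : ℝ × ℝ) ∈ K from h)
  have hGp : G x y ≤ G x₁ y₁ + η := by
    have h1 := hmn x₁ y₁ h₁
    have h2 := hεB x y hp'
    have h3 : 0 < ε * Real.exp (k * x₁) := by positivity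
    linarith
  have hexd : ∀ t, HasDerivAt (fun t => ε * Real.exp (k * t)) (ε * (k * Real.exp (k * t))) t := by
    intro t
    have h0 : HasDerivAt (fun t : ℝ => k * t) k t := by
      simpa using (hasDerivAt_id t).const_mul k
    have := h0.exp.const_mul ε
    exact this.congr_deriv (by ring)
  rcases hp'.eq_or_lt with hc | hc
  · -- boundary point
    have hD := hbd x y hc.symm
    set D := pdx W x y * pdx G x y + pdy W x y * pdy G x y with hDdef
    have hq := hC2 (x, y) ⟨hp, hc.symm⟩
    dsimp only at hq
    rw [← hDdef, Real.norm_eq_abs] at hq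
    set q := k * Real.exp (k * x) * pdx W x y / D with hqdef
    have hqD : q * D = k * Real.exp (k * x) * pdx W x y := by
      rw [hqdef]; field_simp [hD.ne]
    have hεq : ε * q < 1 := by
      have h2 : q < S := by
        rw [hS]; linarith [le_abs_self q, le_abs_self C2, abs_nonneg B]
      have h3 := mul_lt_mul_of_pos_left h2 hεpos
      rw [hεS] at h3
      exact h3.trans_le (min_le_right _ _)
    have lx : HasDerivAt (fun t : ℝ => x + t * pdx W x y) (pdx W x y) 0 := by
      simpa using ((hasDerivAt_id (0:ℝ)).mul_const (pdx W x y)).const_add x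
    have ly : HasDerivAt (fun t : ℝ => y + t * pdy W x y) (pdy W x y) 0 := by
      simpa using ((hasDerivAt_id (0:ℝ)).mul_const (pdy W x y)).const_add y
    have dW := hW.chain lx ly
    have dG := hG.chain lx ly
    have hex := hexd (x + 0 * pdx W x y)
    have dE := HasDerivAt.comp (h₂ := fun t => ε * Real.exp (k * t))
      (h := fun t : ℝ => x + t * pdx W x y) 0 hex lx
    have dF := (dG.sub dE).neg
    have e1 := eventually_gt_of_deriv_pos dW (by
      simp only [zero_mul, add_zero]
      have : pdx W x y ≠ 0 ∨ pdy W x y ≠ 0 := by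
        by_contra hh
        push Not at hh
        rw [hDdef, hh.1, hh.2] at hD
        simp at hD
      rcases this with h | h
      · have := mul_self_pos.2 h
        nlinarith [mul_self_nonneg (pdy W x y)]
      · have := mul_self_pos.2 h
        nlinarith [mul_self_nonneg (pdx W x y)])
    have e2 := eventually_gt_of_deriv_pos dF (by
      simp only [zero_mul, add_zero]
      have : 0 < -(D * (1 - ε * q)) := by
        have := mul_pos (neg_pos.2 hD) (sub_pos.2 hεq)
        linarith
      have h2 : -(pdx G x y * pdx W x y + pdy G x y * pdy W x y
          - ε * (k * Real.exp (k * x)) * pdx W x y) = -(D * (1 - ε * q)) := by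
        rw [hDdef] at hqD ⊢
        linear_combination -ε * hqD
      rw [h2]; exact this)
    obtain ⟨t, h1, h2⟩ := (e1.and e2).exists
    simp only [zero_mul, add_zero, Pi.neg_apply, Pi.sub_apply, Function.comp_apply] at h1 h2
    have h3 := hmn (x + t * pdx W x y) (y + t * pdy W x y) (by linarith)
    linarith
  · -- interior point
    have hopen : ∀ᶠ p : ℝ × ℝ in nhds (x, y), c < W p.1 p.2 :=
      (hW.cont.continuousAt (x := (x, y))).eventually (lt_mem_nhds hc)
    have hlx : ∀ᶠ t in nhds x, c < W t y :=
      (Continuous.tendsto (f := fun t : ℝ => ((t, y) : ℝ × ℝ)) (by fun_prop) x).eventually hopen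
    have hly : ∀ᶠ t in nhds y, c < W x t :=
      (Continuous.tendsto (f := fun t : ℝ => ((x, t) : ℝ × ℝ)) (by fun_prop) y).eventually hopen
    have mx : IsLocalMin (fun t => G t y - ε * Real.exp (k * t)) x := by
      filter_upwards [hlx] with t ht
      exact hmn t y ht.le
    have my : IsLocalMin (fun t => G x t - ε * Real.exp (k * x)) y := by
      filter_upwards [hly] with t ht
      exact hmn x t ht.le
    have dx : ∀ t, HasDerivAt (fun t => G t y - ε * Real.exp (k * t))
        (pdx G t y - k * (ε * Real.exp (k * t))) t := by
      intro t
      exact ((hG.hdx t y).sub (hexd t)).congr_deriv (by ring)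
    have dy : ∀ t, HasDerivAt (fun t => G x t - ε * Real.exp (k * x)) (pdy G x t) t := by
      intro t
      exact (hG.hdy x t).sub_const _
    have dxx := (hG.dx.hdx x y).sub ((hexd x).const_mul k)
    have fx := mx.hasDerivAt_eq_zero (dx x)
    have fy := my.hasDerivAt_eq_zero (dy y)
    have fxx := second_deriv_nonneg dx dxx mx
    have fyy := second_deriv_nonneg dy (hG.dy.hdy x y) my
    have h1 := hak x y hp' hGp
    have h2 := hNpos (x, y) hGp
    dsimp only at h2
    have h3 := heq x y
    have hE : 0 < ε * Real.exp (k * x) := by positivity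
    rw [fy, mul_zero, add_zero] at h3
    have h4 : pdx G x y = k * (ε * Real.exp (k * x)) := by linarith
    rw [h4] at h3
    have h5 := mul_lt_mul_of_pos_right h1 (mul_pos hkpos hE)
    have h6 : k * k * (ε * Real.exp (k * x)) ≤ pdx (pdx G) x y + pdy (pdy G) x y := by
      linarith
    have h7 := mul_le_mul_of_nonneg_left h6 h2.le
    linarith

theorem lip_local {u : ℝ → ℝ → ℝ} {f : ℝ → ℝ} (hu : Sm u) (hf : ContDiff ℝ (⊤ : ℕ∞) f) :
    ∃ M : ℝ, 0 ≤ M ∧ ∀ x y, |x| ≤ 1 → |y| ≤ 1 → |deriv f (u x y)| ≤ M ∧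
      |f (u x y) - f (u 0 0)| ≤ M * |u x y - u 0 0| := by
  obtain ⟨T, hT⟩ := (isCompact_closedBall (0 : ℝ × ℝ) 1).exists_bound_of_continuousOn
    hu.cont.continuousOn
  have hT' : ∀ x y, |x| ≤ 1 → |y| ≤ 1 → u x y ∈ Icc (-T) T := by
    intro x y hx hy
    have := hT (x, y) (by
      rw [mem_closedBall, dist_zero_right, Prod.norm_def]; exact max_le hx hy)
    exact abs_le.1 this
  obtain ⟨M, hM⟩ := (isCompact_Icc (a := -T) (b := T)).exists_bound_of_continuousOn
    (hf.continuous_deriv (by simp)).continuousOn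
  have h00 := hT' 0 0 (by simp) (by simp)
  have hM0 : 0 ≤ M := (norm_nonneg _).trans (hM _ h00)
  refine ⟨M, hM0, fun x y hx hy => ⟨hM _ (hT' x y hx hy), ?_⟩⟩
  exact Convex.norm_image_sub_le_of_norm_deriv_le (s := Icc (-T) T)
    (fun z _ => (hf.differentiable (by simp)) z) hM (convex_Icc _ _) h00 (hT' x y hx hy)

theorem polar_le_one {r α : ℝ} (h0 : 0 < r) (h1 : r < 1) :
    |r * Real.cos α| ≤ 1 ∧ |r * Real.sin α| ≤ 1 := by
  rw [abs_mul, abs_mul, abs_of_pos h0]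
  exact ⟨mul_le_one₀ h1.le (abs_nonneg _) (Real.abs_cos_le_one α),
    mul_le_one₀ h1.le (abs_nonneg _) (Real.abs_sin_le_one α)⟩

theorem f_ne_zero {u : ℝ → ℝ → ℝ} {f : ℝ → ℝ} (hu : Sm u) (hf : ContDiff ℝ (⊤ : ℕ∞) f)
    (hpde : ∀ x y, -(pdx (pdx u) x y + pdy (pdy u) x y) = f (u x y))
    (huniq : ∀ x y, pdx u x y = 0 → pdy u x y = 0 → x = 0 ∧ y = 0)
    {s : ℝ} (hs : s ≠ 0) (hmax : ∀ x y, s * u x y ≤ s * u 0 0) : f (u 0 0) ≠ 0 := by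
  intro hf0
  obtain ⟨M, hM, hL⟩ := lip_local hu hf
  have hv : Sm (fun x y => u x y - u 0 0) := hu.sub (Sm.const (u 0 0))
  have e1 : pdx (fun x y => u x y - u 0 0) = pdx u := by
    funext x y; exact ((hu.hdx x y).sub_const _).deriv
  have e2 : pdy (fun x y => u x y - u 0 0) = pdy u := by
    funext x y; exact ((hu.hdy x y).sub_const _).deriv
  have key := onesign_zero hv (M := M) (ρ := 1) hM one_pos (by
    intro r α h0 h1
    obtain ⟨hc, hs'⟩ := polar_le_one (α := α) h0 h1
    have h2 := (hL _ _ hc hs').2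
    rw [hf0, sub_zero, ← hpde, abs_neg] at h2
    unfold lap polar
    rw [e1, e2]
    exact h2) (-s) (neg_ne_zero.2 hs) (by
      intro x y; have := hmax x y; linarith) (by simp)
    (r₀ := 1 / 2) (α := 0) (by norm_num) (by norm_num) (by norm_num)
    ⟨by linarith [Real.pi_pos], Real.pi_pos.le⟩
  have he : u (1 / 2) 0 = u 0 0 := by
    simp only [polar, Real.cos_zero, Real.sin_zero, mul_one, mul_zero] at key
    linarith
  have hc := crit_of_max hu hs (a := 1 / 2) (b := 0) (by rw [he]; exact hmax)
  have := (huniq _ _ hc.1 hc.2).1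
  norm_num at this

theorem null_dir {A B D : ℝ} (h : A * D - B ^ 2 = 0) :
    ∃ β ∈ Icc (-Real.pi) Real.pi, A * Real.cos β + B * Real.sin β = 0 ∧
      B * Real.cos β + D * Real.sin β = 0 := by
  obtain ⟨a, b, hab, h1, h2⟩ : ∃ a b : ℝ, a ^ 2 + b ^ 2 ≠ 0 ∧ A * a + B * b = 0 ∧
      B * a + D * b = 0 := by
    by_cases hD : D ^ 2 + B ^ 2 = 0
    · have hD0 : D = 0 := by nlinarith [sq_nonneg D, sq_nonneg B]
      have hB0 : B = 0 := by nlinarith [sq_nonneg D, sq_nonneg B]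
      exact ⟨0, 1, by norm_num, by simp [hB0], by simp [hD0]⟩
    · exact ⟨D, -B, by simpa using hD, by linarith, by ring⟩
  obtain ⟨r, β, -, hr, hβ, rfl, rfl⟩ := polar_surj a b
  have hr0 : r ≠ 0 := by rintro rfl; apply hab; rw [← hr]; norm_num
  refine ⟨β, hβ, mul_left_cancel₀ hr0 ?_, mul_left_cancel₀ hr0 ?_⟩
  · linarith
  · linarith

theorem main_aux {u : ℝ → ℝ → ℝ} {f : ℝ → ℝ} (hu : Sm u) (hf : ContDiff ℝ (⊤ : ℕ∞) f)
    (hpde : ∀ x y, -(pdx (pdx u) x y + pdy (pdy u) x y) = f (u x y))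
    (hc1 : pdx u 0 0 = 0) (hc2 : pdy u 0 0 = 0)
    (huniq : ∀ x y, pdx u x y = 0 → pdy u x y = 0 → x = 0 ∧ y = 0)
    (hdet : pdx (pdx u) 0 0 * pdy (pdy u) 0 0 - pdy (pdx u) 0 0 ^ 2 = 0)
    {c : ℝ} (hcne : c ≠ u 0 0)
    (hnon : ∃ x y, u x y = c) (hcomp : IsCompact {p : ℝ × ℝ | u p.1 p.2 = c})
    (hcurv : ∀ x y, u x y = c → pdx (pdx u) x y * pdy u x y ^ 2
      - 2 * pdy (pdx u) x y * pdx u x y * pdy u x y + pdy (pdy u) x y * pdx u x y ^ 2 < 0) :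
    False := by
  obtain ⟨s, hs, hK, hmax⟩ := extremum hu huniq hnon hcomp
  have hs0 : s ≠ 0 := by rintro rfl; norm_num at hs
  have e : pdx (pdy u) = pdy (pdx u) := by funext x y; exact hu.comm x y
  have hlt : s * c < s * u 0 0 := by
    obtain ⟨x, y, hxy⟩ := hnon
    refine lt_of_le_of_ne (by rw [← hxy]; exact hmax x y) fun h => hcne (mul_left_cancel₀ hs0 h)
  obtain ⟨h, hh, hx, hy, hlap⟩ := exists_stream hu hf hpde
  have gx : ∀ g : ℝ → ℝ → ℝ, Sm g → pdx (fun x y => s * g x y) = fun x y => s * pdx g x y := by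
    intro g hg; funext x y; exact ((hg.hdx x y).const_mul s).deriv
  have gy : ∀ g : ℝ → ℝ → ℝ, Sm g → pdy (fun x y => s * g x y) = fun x y => s * pdy g x y := by
    intro g hg; funext x y; exact ((hg.hdy x y).const_mul s).deriv
  have hmin := weak_min (W := fun x y => s * u x y) (G := fun x y => s * h x y)
    (N := fun x y => pdx u x y * pdx u x y + pdy u x y * pdy u x y)
    (a := fun x y => 2 * (pdx u x y * pdx (pdx u) x y + pdy u x y * pdy (pdx u) x y))
    (b := fun x y => 2 * (pdx u x y * pdy (pdx u) x y + pdy u x y * pdy (pdy u) x y))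
    (c := s * c) ((Sm.const s).mul hu) ((Sm.const s).mul hh)
    ((hu.dx.mul hu.dx).add (hu.dy.mul hu.dy))
    ((Sm.const 2).mul ((hu.dx.mul hu.dx.dx).add (hu.dy.mul hu.dx.dy))) hK
    (by
      intro x y hW
      have hc := hcurv x y (mul_left_cancel₀ hs0 hW)
      rw [gx u hu, gy u hu, gx h hh, gy h hh]
      simp only [hx, hy]
      refine lt_of_eq_of_lt ?_ hc
      linear_combination (pdx (pdx u) x y * pdy u x y ^ 2
      - 2 * pdy (pdx u) x y * pdx u x y * pdy u x y + pdy (pdy u) x y * pdx u x y ^ 2) * hs)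
    (by
      intro x y
      by_cases h0 : x = 0 ∧ y = 0
      · exact Or.inl h0
      · right
        have n1 := mul_self_nonneg (pdx u x y)
        have n2 := mul_self_nonneg (pdy u x y)
        refine lt_of_le_of_ne (by linarith) fun hz => h0 ?_
        exact huniq x y (mul_self_eq_zero.1 (by linarith)) (mul_self_eq_zero.1 (by linarith)))
    (by
      intro x y
      rw [gx h hh, gy h hh, gx _ hh.dx, gy _ hh.dy]
      simp only [hx, hy]
      have := hlap x y
      rw [← mul_add, this]
      ring)
  have hopen : ∀ᶠ p : ℝ × ℝ in nhds ((0 : ℝ), (0 : ℝ)), s * c < s * u p.1 p.2 :=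
    ((hu.cont.const_mul s).continuousAt (x := ((0 : ℝ), (0 : ℝ)))).eventually (lt_mem_nhds hlt)
  obtain ⟨δ, hδ, hball⟩ := Metric.eventually_nhds_iff.1 hopen
  set ρ := min δ 1 with hρdef
  have hρ : 0 < ρ := lt_min hδ one_pos
  have hmin' : ∀ r α, 0 < r → r < ρ → s * h 0 0 ≤ s * h (r * Real.cos α) (r * Real.sin α) := by
    intro r α h0 h1
    refine hmin _ _ (le_of_lt ?_)
    refine hball (y := (r * Real.cos α, r * Real.sin α)) ?_
    rw [Prod.dist_eq]
    simp only [Real.dist_eq, sub_zero, abs_mul, abs_of_pos h0]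
    refine max_lt ?_ ?_
    · have := mul_le_mul_of_nonneg_left (Real.abs_cos_le_one α) h0.le
      linarith [min_le_left δ 1]
    · have := mul_le_mul_of_nonneg_left (Real.abs_sin_le_one α) h0.le
      linarith [min_le_left δ 1]
  have hfne := f_ne_zero hu hf hpde huniq hs0 hmax
  obtain ⟨M, hM, hL⟩ := lip_local hu hf
  obtain ⟨β, hβ, d1, d2⟩ := null_dir hdet
  set a := Real.cos β with ha
  set b := Real.sin β with hb
  have hab : a ^ 2 + b ^ 2 = 1 := by rw [ha, hb]; exact Real.cos_sq_add_sin_sq β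
  have lin_x : ∀ (p q : ℝ) (g k : ℝ → ℝ → ℝ), Sm g → Sm k →
      pdx (fun x y => p * g x y + q * k x y) = fun x y => p * pdx g x y + q * pdx k x y := by
    intro p q g k hg hk
    funext x y
    exact (((hg.hdx x y).const_mul p).add ((hk.hdx x y).const_mul q)).deriv
  have lin_y : ∀ (p q : ℝ) (g k : ℝ → ℝ → ℝ), Sm g → Sm k →
      pdy (fun x y => p * g x y + q * k x y) = fun x y => p * pdy g x y + q * pdy k x y := by
    intro p q g k hg hk
    funext x y
    exact (((hg.hdy x y).const_mul p).add ((hk.hdy x y).const_mul q)).deriv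
  have smlin : ∀ (p q : ℝ), Sm (fun x y => p * pdx u x y + q * pdy u x y) := fun p q =>
    ((Sm.const p).mul hu.dx).add ((Sm.const q).mul hu.dy)
  have hzero : ∀ r, 0 < r → r < ρ → a * pdx u (r * a) (r * b) + b * pdy u (r * a) (r * b) = 0 := by
    intro r h0 h1
    have key := degenerate_zero (smlin a b) (smlin (-b) a) hh
      (by
        intro x y
        rw [lin_y _ _ _ _ hu.dx hu.dy, lin_y _ _ _ _ hu.dx hu.dy, hx]
        linear_combination -(pdx u x y * pdy (pdy u) x y - pdy u x y * pdy (pdx u) x y) * hab)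
      (by
        intro x y
        rw [lin_x _ _ _ _ hu.dx hu.dy, lin_x _ _ _ _ hu.dx hu.dy, hy, e]
        linear_combination (pdx u x y * pdy (pdx u) x y - pdy u x y * pdx (pdx u) x y) * hab)
      hM hρ
      (by
        intro r α h0 h1
        obtain ⟨hc, hs'⟩ := polar_le_one (α := α) h0 (h1.trans_le (min_le_right _ _))
        have h2 := (hL _ _ hc hs').1
        have l1 := lap_dx hu hf hpde (r * Real.cos α) (r * Real.sin α)
        have l2 := lap_dy hu hf hpde (r * Real.cos α) (r * Real.sin α)
        unfold lap at l1 l2 ⊢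
        rw [lin_x _ _ _ _ hu.dx hu.dy, lin_y _ _ _ _ hu.dx hu.dy,
          lin_x _ _ _ _ hu.dx.dx hu.dy.dx, lin_y _ _ _ _ hu.dx.dy hu.dy.dy]
        have l3 : a * pdx (pdx (pdx u)) (r * Real.cos α) (r * Real.sin α)
            + b * pdx (pdx (pdy u)) (r * Real.cos α) (r * Real.sin α)
            + (a * pdy (pdy (pdx u)) (r * Real.cos α) (r * Real.sin α)
            + b * pdy (pdy (pdy u)) (r * Real.cos α) (r * Real.sin α))
            = -(deriv f (u (r * Real.cos α) (r * Real.sin α))) *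
              (a * pdx u (r * Real.cos α) (r * Real.sin α)
                + b * pdy u (r * Real.cos α) (r * Real.sin α)) := by
          linear_combination a * l1 + b * l2
        simp only [polar]
        rw [l3, abs_mul, abs_neg]
        exact mul_le_mul_of_nonneg_right h2 (abs_nonneg _))
      s hmin' hs0 (by simp [hc1, hc2]) (by simp [hc1, hc2])
      (by rw [lin_x _ _ _ _ hu.dx hu.dy, e]; linarith)
      (by rw [lin_y _ _ _ _ hu.dx hu.dy]; linarith)
      (a := a) (b := b) (l := pdx (pdx u) 0 0 + pdy (pdy u) 0 0)
      (by rw [lin_x _ _ _ _ hu.dx hu.dy, e]; linear_combination d2)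
      (by rw [lin_y _ _ _ _ hu.dx hu.dy]; linear_combination -d1)
      (by intro hl; apply hfne; rw [← hpde, hl, neg_zero]) hab
      h0 h1 (h1.trans_le (min_le_right _ _)) hβ
    exact key
  have hdg : ∀ r, HasDerivAt (fun r => u (r * a) (r * b))
      (pdx u (r * a) (r * b) * a + pdy u (r * a) (r * b) * b) r := by
    intro r
    have l1 : HasDerivAt (fun r : ℝ => r * a) a r := by
      simpa using (hasDerivAt_id r).mul_const a
    have l2 : HasDerivAt (fun r : ℝ => r * b) b r := by
      simpa using (hasDerivAt_id r).mul_const b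
    exact hu.chain l1 l2
  have hconst := constant_of_has_deriv_right_zero (f := fun r => u (r * a) (r * b))
    (a := 0) (b := ρ / 2) (fun r _ => (hdg r).continuousAt.continuousWithinAt) (by
      intro r hr
      have h2 : pdx u (r * a) (r * b) * a + pdy u (r * a) (r * b) * b = 0 := by
        rcases hr.1.eq_or_lt with h0 | h0
        · rw [← h0]; simp [hc1, hc2]
        · linarith [hzero r h0 (by linarith [hr.2])]
      have := hdg r
      rw [h2] at this
      exact this.hasDerivWithinAt) (ρ / 2) ⟨by linarith, le_rfl⟩
  simp only [zero_mul] at hconst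
  have hc := crit_of_max hu hs0 (a := ρ / 2 * a) (b := ρ / 2 * b) (by rw [hconst]; exact hmax)
  obtain ⟨z1, z2⟩ := huniq _ _ hc.1 hc.2
  have hρ2 : ρ / 2 ≠ 0 := by linarith
  have ha0 := (mul_eq_zero.1 z1).resolve_left hρ2
  have hb0 := (mul_eq_zero.1 z2).resolve_left hρ2
  rw [ha0, hb0] at hab
  norm_num at hab

/-- entire solutions on `ℝ²` with a unique critical point whose level
sets are Jordan curves: either the critical point is nondegenerate, or every such
level set contains a point of nonpositive curvature. -/
theorem entire_nondegenerate_or_nonconvex_levels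
    (u : ℝ → ℝ → ℝ) (f : ℝ → ℝ)
    (hu : ContDiff ℝ (⊤ : ℕ∞) (fun p : ℝ × ℝ => u p.1 p.2))
    (hf : ContDiff ℝ (⊤ : ℕ∞) f) (hf0 : 0 ≤ f 0)
    (hpde : ∀ x y : ℝ, -(pd u 2 0 x y + pd u 0 2 x y) = f (u x y))
    (hcrit0 : pd u 1 0 0 0 = 0 ∧ pd u 0 1 0 0 = 0)
    (huniq : ∀ x y : ℝ, pd u 1 0 x y = 0 → pd u 0 1 x y = 0 → ((x, y) : ℝ × ℝ) = (0, 0))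
    (hJordan : ∀ c : ℝ, c ≠ u 0 0 → {p : ℝ × ℝ | u p.1 p.2 = c}.Nonempty →
      ∃ γ : Metric.sphere ((0, 0) : ℝ × ℝ) 1 → ℝ × ℝ,
        Continuous γ ∧ Function.Injective γ ∧
          Set.range γ = {p : ℝ × ℝ | u p.1 p.2 = c}) :
    pd u 2 0 0 0 * pd u 0 2 0 0 - (pd u 1 1 0 0) ^ 2 ≠ 0 ∨
    ∀ c : ℝ, c ≠ u 0 0 → {p : ℝ × ℝ | u p.1 p.2 = c}.Nonempty →
      ∃ p : ℝ × ℝ, u p.1 p.2 = c ∧ 0 ≤ curvNum u p.1 p.2 := by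
  have sm : Sm u := hu
  have e : pdx (pdy u) = pdy (pdx u) := by funext x y; exact sm.comm x y
  by_contra hcon
  push Not at hcon
  obtain ⟨hdet, c, hcne, hnon, hall⟩ := hcon
  have e11 : pd u 1 1 = pdy (pdx u) := e
  rw [e11] at hdet
  have hcomp : IsCompact {p : ℝ × ℝ | u p.1 p.2 = c} := by
    obtain ⟨γ, hγ, -, hr⟩ := hJordan c hcne hnon
    have : CompactSpace (Metric.sphere ((0, 0) : ℝ × ℝ) 1) :=
      isCompact_iff_compactSpace.1 (isCompact_sphere _ _)
    rw [← hr]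
    exact isCompact_range hγ
  obtain ⟨⟨x, y⟩, hxy⟩ := hnon
  refine main_aux (c := c) sm hf hpde hcrit0.1 hcrit0.2 ?_ hdet hcne ⟨x, y, hxy⟩ hcomp ?_
  · intro x y h1 h2
    have := huniq x y h1 h2
    rwa [Prod.mk.injEq] at this
  · intro x y h
    have := hall (x, y) h
    unfold curvNum at this
    rw [e11] at this
    exact this
end

section
/- Let Ω ⊂ ℝ² be a bounded open convex set and let u be a smooth function on an open set containing the closure of Ω such that -Δu = f(u) in Ω with f smooth and f(0) ≥ 0, u = 0 on ∂Ω, u not identically 0, and at every boundary point p ∈ ∂Ω one has (u_xx u_y² - 2 u_xy u_x u_y + u_yy u_x²)(p) < 0 (which expresses that ∂Ω, a level curve of u, has strictly positive curvature and that ∇u ≠ 0 on ∂Ω). For θ ∈ [0, π) set u_θ = cos θ · u_x + sin θ · u_y. Then for each θ ∈ [0, π) the set {p ∈ ∂Ω : u_θ(p) = 0} consists of exactly two points. -/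
open Filter Metric Set

open Topology

lemma bz_hasFDerivAt {V : Set (ℝ × ℝ)} (hV : IsOpen V) {w : ℝ → ℝ → ℝ}
    (hw : ContDiffOn ℝ (⊤ : ℕ∞) (fun p : ℝ × ℝ => w p.1 p.2) V) {p : ℝ × ℝ} (hp : p ∈ V) :
    HasFDerivAt (fun p : ℝ × ℝ => w p.1 p.2) (fderiv ℝ (fun p : ℝ × ℝ => w p.1 p.2) p) p :=
  ((hw.contDiffAt (hV.mem_nhds hp)).differentiableAt (by simp)).hasFDerivAt

lemma bz_pdx {V : Set (ℝ × ℝ)} (hV : IsOpen V) {w : ℝ → ℝ → ℝ}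
    (hw : ContDiffOn ℝ (⊤ : ℕ∞) (fun p : ℝ × ℝ => w p.1 p.2) V) {p : ℝ × ℝ} (hp : p ∈ V) :
    pdx w p.1 p.2 = fderiv ℝ (fun p : ℝ × ℝ => w p.1 p.2) p (1, 0) := by
  have h1 : HasDerivAt (fun t : ℝ => (t, p.2)) ((1 : ℝ), (0 : ℝ)) p.1 :=
    (hasDerivAt_id p.1).prodMk (hasDerivAt_const p.1 p.2)
  have h := HasFDerivAt.comp_hasDerivAt (x := p.1) (f := fun t : ℝ => (t, p.2))
    (hl := bz_hasFDerivAt hV hw hp) h1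
  exact h.deriv

lemma bz_pdy {V : Set (ℝ × ℝ)} (hV : IsOpen V) {w : ℝ → ℝ → ℝ}
    (hw : ContDiffOn ℝ (⊤ : ℕ∞) (fun p : ℝ × ℝ => w p.1 p.2) V) {p : ℝ × ℝ} (hp : p ∈ V) :
    pdy w p.1 p.2 = fderiv ℝ (fun p : ℝ × ℝ => w p.1 p.2) p (0, 1) := by
  have h1 : HasDerivAt (fun t : ℝ => (p.1, t)) ((0 : ℝ), (1 : ℝ)) p.2 :=
    (hasDerivAt_const p.2 p.1).prodMk (hasDerivAt_id p.2)
  have h := HasFDerivAt.comp_hasDerivAt (x := p.2) (f := fun t : ℝ => (p.1, t))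
    (hl := bz_hasFDerivAt hV hw hp) h1
  exact h.deriv

lemma bz_fderiv_apply {V : Set (ℝ × ℝ)} (hV : IsOpen V) {w : ℝ → ℝ → ℝ}
    (hw : ContDiffOn ℝ (⊤ : ℕ∞) (fun p : ℝ × ℝ => w p.1 p.2) V) {p : ℝ × ℝ} (hp : p ∈ V)
    (d : ℝ × ℝ) :
    fderiv ℝ (fun p : ℝ × ℝ => w p.1 p.2) p d = d.1 * pdx w p.1 p.2 + d.2 * pdy w p.1 p.2 := by
  have hd : d = d.1 • ((1 : ℝ), (0 : ℝ)) + d.2 • ((0 : ℝ), (1 : ℝ)) := by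
    ext <;> simp
  rw [bz_pdx hV hw hp, bz_pdy hV hw hp]
  conv_lhs => rw [hd]
  rw [map_add, map_smul, map_smul, smul_eq_mul, smul_eq_mul]

lemma bz_fderiv_smooth {V : Set (ℝ × ℝ)} (hV : IsOpen V) {U : ℝ × ℝ → ℝ}
    (hw : ContDiffOn ℝ (⊤ : ℕ∞) U V) : ContDiffOn ℝ (⊤ : ℕ∞) (fderiv ℝ U) V :=
  hw.fderiv_of_isOpen hV (by simp)

lemma bz_pdx_smooth {V : Set (ℝ × ℝ)} (hV : IsOpen V) {w : ℝ → ℝ → ℝ}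
    (hw : ContDiffOn ℝ (⊤ : ℕ∞) (fun p : ℝ × ℝ => w p.1 p.2) V) :
    ContDiffOn ℝ (⊤ : ℕ∞) (fun p : ℝ × ℝ => pdx w p.1 p.2) V :=
  ((bz_fderiv_smooth hV hw).clm_apply contDiffOn_const).congr (fun _ hp => bz_pdx hV hw hp)

lemma bz_pdy_smooth {V : Set (ℝ × ℝ)} (hV : IsOpen V) {w : ℝ → ℝ → ℝ}
    (hw : ContDiffOn ℝ (⊤ : ℕ∞) (fun p : ℝ × ℝ => w p.1 p.2) V) :
    ContDiffOn ℝ (⊤ : ℕ∞) (fun p : ℝ × ℝ => pdy w p.1 p.2) V :=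
  ((bz_fderiv_smooth hV hw).clm_apply contDiffOn_const).congr (fun _ hp => bz_pdy hV hw hp)

lemma bz_symm {V : Set (ℝ × ℝ)} (hV : IsOpen V) {w : ℝ → ℝ → ℝ}
    (hw : ContDiffOn ℝ (⊤ : ℕ∞) (fun p : ℝ × ℝ => w p.1 p.2) V) {p : ℝ × ℝ} (hp : p ∈ V) :
    pdy (pdx w) p.1 p.2 = pdx (pdy w) p.1 p.2 := by
  have hd : DifferentiableAt ℝ (fderiv ℝ (fun p : ℝ × ℝ => w p.1 p.2)) p :=
    ((bz_fderiv_smooth hV hw).contDiffAt (hV.mem_nhds hp)).differentiableAt (by simp)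
  have hx : (fun p : ℝ × ℝ => pdx w p.1 p.2) =ᶠ[𝓝 p]
      fun q => fderiv ℝ (fun p : ℝ × ℝ => w p.1 p.2) q (1, 0) := by
    filter_upwards [hV.mem_nhds hp] with q hq using bz_pdx hV hw hq
  have hy : (fun p : ℝ × ℝ => pdy w p.1 p.2) =ᶠ[𝓝 p]
      fun q => fderiv ℝ (fun p : ℝ × ℝ => w p.1 p.2) q (0, 1) := by
    filter_upwards [hV.mem_nhds hp] with q hq using bz_pdy hV hw hq
  have hs : IsSymmSndFDerivAt ℝ (fun p : ℝ × ℝ => w p.1 p.2) p :=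
    (hw.contDiffAt (hV.mem_nhds hp)).isSymmSndFDerivAt (by simp; exact WithTop.coe_le_coe.mpr le_top)
  rw [bz_pdy hV (bz_pdx_smooth hV hw) hp, bz_pdx hV (bz_pdy_smooth hV hw) hp,
    hx.fderiv_eq, hy.fderiv_eq, fderiv_clm_apply hd (by fun_prop),
    fderiv_clm_apply hd (by fun_prop)]
  simp
  exact hs _ _

lemma bz_curve {V : Set (ℝ × ℝ)} (hV : IsOpen V) {w : ℝ → ℝ → ℝ}
    (hw : ContDiffOn ℝ (⊤ : ℕ∞) (fun p : ℝ × ℝ => w p.1 p.2) V) {m d : ℝ × ℝ} {t : ℝ}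
    (hp : m + t • d ∈ V) :
    HasDerivAt (fun t : ℝ => w (m + t • d).1 (m + t • d).2)
      (d.1 * pdx w (m + t • d).1 (m + t • d).2 + d.2 * pdy w (m + t • d).1 (m + t • d).2) t := by
  have h1 : HasDerivAt (fun t : ℝ => m + t • d) d t := by
    simpa using ((hasDerivAt_id t).smul_const d).const_add m
  have h := HasFDerivAt.comp_hasDerivAt (x := t) (f := fun t : ℝ => m + t • d)
    (hl := bz_hasFDerivAt hV hw hp) h1
  rw [bz_fderiv_apply hV hw hp] at h
  exact h

lemma bz_curv_zero {V : Set (ℝ × ℝ)} (hV : IsOpen V) {u : ℝ → ℝ → ℝ}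
    (hu : ContDiffOn ℝ (⊤ : ℕ∞) (fun p : ℝ × ℝ => u p.1 p.2) V) {m d : ℝ × ℝ}
    (hm : m ∈ V) (hd : d ≠ 0)
    (h0 : ∀ᶠ t : ℝ in 𝓝 0, u (m + t • d).1 (m + t • d).2 = 0) :
    curvNum u m.1 m.2 = 0 := by
  have hmV : ∀ᶠ t : ℝ in 𝓝 0, m + t • d ∈ V := by
    have hc : Continuous (fun t : ℝ => m + t • d) := by fun_prop
    exact hc.continuousAt.eventually (by simpa using hV.mem_nhds hm)
  have h1 : ∀ᶠ t : ℝ in 𝓝 0,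
      d.1 * pdx u (m + t • d).1 (m + t • d).2 + d.2 * pdy u (m + t • d).1 (m + t • d).2 = 0 := by
    filter_upwards [h0.eventually_nhds, hmV] with t ht htV
    have h := bz_curve hV hu htV
    have h' : HasDerivAt (fun t : ℝ => u (m + t • d).1 (m + t • d).2) 0 t :=
      (hasDerivAt_const t (0 : ℝ)).congr_of_eventuallyEq ht
    exact h.unique h'
  have hm0 : m + (0 : ℝ) • d ∈ V := by simpa using hm
  have hA := bz_curve hV (bz_pdx_smooth hV hu) hm0
  have hB := bz_curve hV (bz_pdy_smooth hV hu) hm0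
  have hC := (hA.const_mul d.1).add (hB.const_mul d.2)
  have hD : HasDerivAt (fun t : ℝ => d.1 * pdx u (m + t • d).1 (m + t • d).2
      + d.2 * pdy u (m + t • d).1 (m + t • d).2) 0 0 :=
    (hasDerivAt_const (0 : ℝ) (0 : ℝ)).congr_of_eventuallyEq h1
  have hE := hC.unique hD
  have hF := h1.self_of_nhds
  simp only [zero_smul, add_zero] at hE hF
  rw [bz_symm hV hu hm] at hE
  have hN : (d.1 ^ 2 + d.2 ^ 2) ≠ 0 := by
    intro h
    apply hd
    have ha : d.1 = 0 := by nlinarith [sq_nonneg d.1, sq_nonneg d.2]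
    have hb : d.2 = 0 := by nlinarith [sq_nonneg d.1, sq_nonneg d.2]
    exact Prod.ext ha hb
  have e1 : pd u 2 0 m.1 m.2 = pdx (pdx u) m.1 m.2 := rfl
  have e2 : pd u 1 1 m.1 m.2 = pdx (pdy u) m.1 m.2 := rfl
  have e3 : pd u 0 2 m.1 m.2 = pdy (pdy u) m.1 m.2 := rfl
  have e4 : pd u 1 0 m.1 m.2 = pdx u m.1 m.2 := rfl
  have e5 : pd u 0 1 m.1 m.2 = pdy u m.1 m.2 := rfl
  rw [curvNum, e1, e2, e3, e4, e5]
  generalize pdx (pdx u) m.1 m.2 = a at *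
  generalize pdx (pdy u) m.1 m.2 = b at *
  generalize pdy (pdy u) m.1 m.2 = c at *
  generalize pdx u m.1 m.2 = x at *
  generalize pdy u m.1 m.2 = y at *
  generalize d.1 = p at *
  generalize d.2 = q at *
  have hx : x * (p ^ 2 + q ^ 2) = -q * (y * p - x * q) := by linear_combination p * hF
  have hy : y * (p ^ 2 + q ^ 2) = p * (y * p - x * q) := by linear_combination q * hF
  have : (a * y ^ 2 - 2 * b * x * y + c * x ^ 2) * (p ^ 2 + q ^ 2) ^ 2 = 0 := by
    calc _ = a * (y * (p ^ 2 + q ^ 2)) ^ 2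
          - 2 * b * (x * (p ^ 2 + q ^ 2)) * (y * (p ^ 2 + q ^ 2))
          + c * (x * (p ^ 2 + q ^ 2)) ^ 2 := by ring
      _ = 0 := by rw [hx, hy]; linear_combination (y * p - x * q) ^ 2 * hE
  exact (mul_eq_zero.mp this).resolve_right (pow_ne_zero 2 hN)

lemma bz_hit {Ω T : Set (ℝ × ℝ)} (hopen : IsOpen Ω) (hT : IsPreconnected T)
    (h1 : (T ∩ Ω).Nonempty) (h2 : (T ∩ Ωᶜ).Nonempty) : (T ∩ frontier Ω).Nonempty := by
  by_contra hcon
  rw [Set.not_nonempty_iff_eq_empty] at hcon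
  have hnot : ∀ x ∈ T, x ∈ closure Ω → x ∈ Ω := by
    intro x hx hxc
    by_contra hxΩ
    have : x ∈ T ∩ frontier Ω := ⟨hx, by rw [hopen.frontier_eq]; exact ⟨hxc, hxΩ⟩⟩
    rw [hcon] at this
    exact this
  obtain ⟨y, hyT, hy⟩ := h2
  obtain ⟨x, _, hxΩ, hxc⟩ := hT Ω (closure Ω)ᶜ hopen isClosed_closure.isOpen_compl
    (fun x hx => by
      by_cases h : x ∈ closure Ω
      · exact Or.inl (hnot x hx h)
      · exact Or.inr h) h1 ⟨y, hyT, fun h => hy (hnot y hyT h)⟩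
  exact hxc (subset_closure hxΩ)

lemma bz_tangent_aux {Ω : Set (ℝ × ℝ)} (hopen : IsOpen Ω) (hconv : Convex ℝ Ω)
    {U : ℝ × ℝ → ℝ} (hbc : ∀ p ∈ frontier Ω, U p = 0) {p c e : ℝ × ℝ} (hp : p ∈ frontier Ω)
    (hc : c ∈ Ω) (hline : ∀ t : ℝ, p + t • e ∉ Ω) {L : ℝ × ℝ →L[ℝ] ℝ}
    (hL : HasFDerivAt U L p) (hsign : 0 ≤ L e * L (c - p)) : L e = 0 := by
  obtain ⟨δ, hδ, hδΩ⟩ : ∃ δ : ℝ, 0 < δ ∧ c + δ • e ∈ Ω := by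
    have hcont : Continuous (fun t : ℝ => c + t • e) := by fun_prop
    have : ∀ᶠ t : ℝ in 𝓝 0, c + t • e ∈ Ω :=
      hcont.continuousAt.eventually (by simpa using hopen.mem_nhds hc)
    have h2 : ∀ᶠ t : ℝ in 𝓝[>] 0, c + t • e ∈ Ω := this.filter_mono nhdsWithin_le_nhds
    obtain ⟨t, ht, ht'⟩ := (h2.and self_mem_nhdsWithin).exists
    exact ⟨t, ht', ht⟩
  have hit : ∀ τ : ℝ, 0 < τ → τ ≤ δ → ∃ s : ℝ, 0 ≤ s ∧ s ≤ τ / δ ∧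
      p + τ • e + s • (c - p) ∈ frontier Ω := by
    intro τ h0 h1
    have hq : 0 < τ / δ := by positivity
    have hpre : IsPreconnected ((fun s : ℝ => p + τ • e + s • (c - p)) '' Icc 0 (τ / δ)) :=
      isPreconnected_Icc.image _ (by fun_prop)
    have hin : p + τ • e + (τ / δ) • (c - p) ∈ Ω := by
      have := hconv.combo_closure_interior_mem_interior (frontier_subset_closure hp)
        (by rwa [hopen.interior_eq] : c + δ • e ∈ interior Ω)
        (a := 1 - τ / δ) (b := τ / δ) (by rw [sub_nonneg, div_le_one hδ]; exact h1) hq (by ring)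
      rw [hopen.interior_eq] at this
      convert this using 1
      ext <;> simp <;> field_simp <;> ring
    obtain ⟨_, ⟨s, hs, rfl⟩, hfr⟩ := bz_hit hopen hpre
      ⟨_, ⟨τ / δ, ⟨hq.le, le_rfl⟩, rfl⟩, hin⟩
      ⟨_, ⟨0, ⟨le_rfl, hq.le⟩, rfl⟩, by simpa using hline τ⟩
    exact ⟨s, hs.1, hs.2, hfr⟩
  set C : ℝ := ‖e‖ + ‖c - p‖ / δ + 1 with hCdef
  have hC : 0 < C := by positivity
  by_contra hne
  have hLe : 0 < |L e| := abs_pos.mpr hne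
  have hε : 0 < |L e| / (2 * C) := by positivity
  have hlo := hL.isLittleO.def hε
  rw [Metric.eventually_nhds_iff] at hlo
  obtain ⟨ρ, hρ, hball⟩ := hlo
  set τ : ℝ := min δ (ρ / (2 * C)) with hτ
  have hτ0 : 0 < τ := lt_min hδ (by positivity)
  obtain ⟨s, hs0, hs1, hsf⟩ := hit τ hτ0 (min_le_left _ _)
  have hdiff : p + τ • e + s • (c - p) - p = τ • e + s • (c - p) := by abel
  have hnorm : ‖τ • e + s • (c - p)‖ ≤ τ * C := by
    calc _ ≤ ‖τ • e‖ + ‖s • (c - p)‖ := norm_add_le _ _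
      _ = τ * ‖e‖ + s * ‖c - p‖ := by
        rw [norm_smul, norm_smul, Real.norm_of_nonneg hτ0.le, Real.norm_of_nonneg hs0]
      _ ≤ τ * ‖e‖ + τ / δ * ‖c - p‖ := by gcongr
      _ ≤ τ * C := by
        rw [hCdef]
        have : τ / δ * ‖c - p‖ = τ * (‖c - p‖ / δ) := by ring
        rw [this]; nlinarith
  have hτC : τ * C ≤ ρ / 2 := by
    calc τ * C ≤ ρ / (2 * C) * C := by gcongr; exact min_le_right _ _
      _ = ρ / 2 := by field_simp
  have hb := hball (y := p + τ • e + s • (c - p)) (by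
    rw [dist_eq_norm, hdiff]; linarith)
  rw [hdiff, hbc _ hsf, hbc _ hp, map_add, map_smul, map_smul, smul_eq_mul, smul_eq_mul] at hb
  have hb2 : |τ * L e + s * L (c - p)| ≤ |L e| / (2 * C) * (τ * C) := by
    have : ‖(0 : ℝ) - 0 - (τ * L e + s * L (c - p))‖ = |τ * L e + s * L (c - p)| := by
      rw [Real.norm_eq_abs, ← abs_neg]; congr 1; ring
    rw [this] at hb
    exact hb.trans (by gcongr)
  have hb3 : |L e| / (2 * C) * (τ * C) = |L e| * τ / 2 := by field_simp
  have hlow : τ * |L e| ≤ |τ * L e + s * L (c - p)| := by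
    have hx : 0 ≤ (τ * L e) * (s * L (c - p)) := by
      have := mul_nonneg (mul_nonneg hτ0.le hs0) hsign
      linarith
    have : |τ * L e| ≤ |τ * L e + s * L (c - p)| := by
      apply sq_le_sq.mp
      nlinarith [sq_nonneg (s * L (c - p))]
    rwa [abs_mul, abs_of_pos hτ0] at this
  nlinarith [mul_pos hτ0 hLe]

lemma bz_tangent {Ω : Set (ℝ × ℝ)} (hopen : IsOpen Ω) (hne : Ω.Nonempty) (hconv : Convex ℝ Ω)
    {U : ℝ × ℝ → ℝ} (hbc : ∀ p ∈ frontier Ω, U p = 0) {p e : ℝ × ℝ} (hp : p ∈ frontier Ω)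
    (hline : ∀ t : ℝ, p + t • e ∉ Ω) {L : ℝ × ℝ →L[ℝ] ℝ}
    (hL : HasFDerivAt U L p) : L e = 0 := by
  obtain ⟨c, hc⟩ := hne
  rcases le_total 0 (L e * L (c - p)) with h | h
  · exact bz_tangent_aux hopen hconv hbc hp hc hline hL h
  · have := bz_tangent_aux hopen hconv hbc hp hc (e := -e)
      (fun t => by simpa using hline (-t)) hL (by rw [map_neg]; linarith)
    rw [map_neg] at this
    linarith

/-- for each direction `θ ∈ [0,π)`, the zero set of
`u_θ = cos θ · u_x + sin θ · u_y` on the (positively curved) boundary of the convex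
domain `Ω` consists of exactly two points. -/
theorem boundary_zero_set_two_points
    (Ω : Set (ℝ × ℝ)) (hopen : IsOpen Ω) (hne : Ω.Nonempty)
    (hconv : Convex ℝ Ω) (hbdd : Bornology.IsBounded Ω)
    (u : ℝ → ℝ → ℝ) (f : ℝ → ℝ)
    (V : Set (ℝ × ℝ)) (hV : IsOpen V) (hΩV : closure Ω ⊆ V)
    (hu : ContDiffOn ℝ (⊤ : ℕ∞) (fun p : ℝ × ℝ => u p.1 p.2) V)
    (hf : ContDiff ℝ (⊤ : ℕ∞) f) (hf0 : 0 ≤ f 0)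
    (hpde : ∀ p ∈ Ω, -(pd u 2 0 p.1 p.2 + pd u 0 2 p.1 p.2) = f (u p.1 p.2))
    (hbc : ∀ p ∈ frontier Ω, u p.1 p.2 = 0)
    (hnz : ¬ ∀ p ∈ Ω, u p.1 p.2 = 0)
    (hcurv : ∀ p ∈ frontier Ω, curvNum u p.1 p.2 < 0) :
    ∀ θ : ℝ, 0 ≤ θ → θ < Real.pi →
      ∃ p₁ p₂ : ℝ × ℝ, p₁ ≠ p₂ ∧
        {p : ℝ × ℝ | p ∈ frontier Ω ∧
            Real.cos θ * pd u 1 0 p.1 p.2 + Real.sin θ * pd u 0 1 p.1 p.2 = 0}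
          = {p₁, p₂} := by
  intro θ _ _
  set c := Real.cos θ with hcdef
  set s := Real.sin θ with hsdef
  have hcs : c ^ 2 + s ^ 2 = 1 := Real.cos_sq_add_sin_sq θ
  set n : ℝ × ℝ → ℝ := fun q => -s * q.1 + c * q.2 with hn
  have hncont : Continuous n := by fun_prop
  -- openness: the functional has no extremum in Ω
  have hO : ∀ q ∈ Ω, (∃ q' ∈ Ω, n q < n q') ∧ (∃ q' ∈ Ω, n q' < n q) := by
    intro q hq
    have hcont : Continuous (fun t : ℝ => q + t • ((-s, c) : ℝ × ℝ)) := by fun_prop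
    have hev : ∀ᶠ t : ℝ in 𝓝 0, q + t • ((-s, c) : ℝ × ℝ) ∈ Ω :=
      hcont.continuousAt.eventually (by simpa using hopen.mem_nhds hq)
    have hval : ∀ t : ℝ, n (q + t • ((-s, c) : ℝ × ℝ)) = n q + t := by
      intro t
      simp only [hn, Prod.fst_add, Prod.snd_add, Prod.smul_fst, Prod.smul_snd, smul_eq_mul]
      linear_combination t * hcs
    constructor
    · have h2 : ∀ᶠ t : ℝ in 𝓝[>] 0, q + t • ((-s, c) : ℝ × ℝ) ∈ Ω :=
        hev.filter_mono nhdsWithin_le_nhds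
      obtain ⟨t, ht, ht'⟩ := (h2.and self_mem_nhdsWithin).exists
      refine ⟨_, ht, ?_⟩
      rw [hval]
      have : 0 < t := ht'
      linarith
    · have h2 : ∀ᶠ t : ℝ in 𝓝[<] 0, q + t • ((-s, c) : ℝ × ℝ) ∈ Ω :=
        hev.filter_mono nhdsWithin_le_nhds
      obtain ⟨t, ht, ht'⟩ := (h2.and self_mem_nhdsWithin).exists
      refine ⟨_, ht, ?_⟩
      rw [hval]
      have : t < 0 := ht'
      linarith
  have hgrad : ∀ p ∈ frontier Ω, ∀ d : ℝ × ℝ, (∀ t : ℝ, p + t • d ∉ Ω) →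
      d.1 * pd u 1 0 p.1 p.2 + d.2 * pd u 0 1 p.1 p.2 = 0 := by
    intro p hp d hd
    have hpV := hΩV (frontier_subset_closure hp)
    have := bz_tangent hopen hne hconv hbc hp hd (bz_hasFDerivAt hV hu hpV)
    rw [bz_fderiv_apply hV hu hpV] at this
    exact this
  -- uniqueness on a supporting line
  have huniq : ∀ p ∈ closure Ω, ∀ q ∈ closure Ω, n p = n q → (∀ z ∈ Ω, n z ≠ n p) → p = q := by
    intro p hp q hq hpq hz
    by_contra hne'
    have hd : q - p ≠ 0 := sub_ne_zero.mpr (Ne.symm hne')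
    have hmem : ∀ t : ℝ, |t| < 1 / 2 →
        p + (1 / 2 : ℝ) • (q - p) + t • (q - p) ∈ frontier Ω := by
      intro t ht
      rw [abs_lt] at ht
      rw [hopen.frontier_eq]
      constructor
      · have := hconv.closure hp hq (a := 1 / 2 - t) (b := 1 / 2 + t) (by linarith)
          (by linarith) (by ring)
        convert this using 1
        ext <;> simp <;> ring
      · intro hmm
        apply hz _ hmm
        simp only [hn, Prod.fst_add, Prod.snd_add, Prod.smul_fst, Prod.smul_snd, smul_eq_mul,
          Prod.fst_sub, Prod.snd_sub] at hpq ⊢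
        linear_combination (-(1 / 2 + t)) * hpq
    have hm := hmem 0 (by norm_num)
    rw [zero_smul, add_zero] at hm
    have hcz := bz_curv_zero hV hu (hΩV (frontier_subset_closure hm)) hd (by
      have : ∀ᶠ t : ℝ in 𝓝 0, |t| < 1 / 2 := by
        have hcont : Continuous (fun t : ℝ => |t|) := continuous_abs
        exact hcont.continuousAt.eventually (gt_mem_nhds (by norm_num))
      filter_upwards [this] with t ht using hbc _ (hmem t ht))
    exact absurd hcz (hcurv _ hm).ne
  -- points of the zero set are strict extrema of the functional
  have hext : ∀ p ∈ frontier Ω, c * pd u 1 0 p.1 p.2 + s * pd u 0 1 p.1 p.2 = 0 →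
      (∀ z ∈ Ω, n z < n p) ∨ (∀ z ∈ Ω, n p < n z) := by
    intro p hp h0
    have hpΩ : p ∉ Ω := by
      rw [hopen.frontier_eq] at hp; exact hp.2
    obtain ⟨F, hF⟩ := geometric_hahn_banach_open_point hconv hopen hpΩ
    have hFe : ∀ z : ℝ × ℝ, F z = z.1 * F (1, 0) + z.2 * F (0, 1) := by
      intro z
      have hd : z = z.1 • ((1 : ℝ), (0 : ℝ)) + z.2 • ((0 : ℝ), (1 : ℝ)) := by
        ext <;> simp
      conv_lhs => rw [hd]
      rw [map_add, map_smul, map_smul, smul_eq_mul, smul_eq_mul]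
    have h1 := hgrad p hp (-F (0, 1), F (1, 0)) (by
      intro t ht
      have := hF _ ht
      rw [map_add, map_smul, hFe (-F (0, 1), F (1, 0))] at this
      simp only [smul_eq_mul] at this
      nlinarith)
    simp only at h1
    have hc1 := hcurv p hp
    have hdet : c * F (1, 0) + s * F (0, 1) = 0 := by
      by_contra hdet
      have hx : pd u 1 0 p.1 p.2 = 0 := by
        have : (c * F (1, 0) + s * F (0, 1)) * pd u 1 0 p.1 p.2 = 0 := by
          linear_combination F (1, 0) * h0 - s * h1
        exact (mul_eq_zero.mp this).resolve_left hdet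
      have hy : pd u 0 1 p.1 p.2 = 0 := by
        have : (c * F (1, 0) + s * F (0, 1)) * pd u 0 1 p.1 p.2 = 0 := by
          linear_combination F (0, 1) * h0 + c * h1
        exact (mul_eq_zero.mp this).resolve_left hdet
      rw [curvNum, hx, hy] at hc1
      norm_num at hc1
    set μ := c * F (0, 1) - s * F (1, 0) with hμ
    have hFn : ∀ z, F z = μ * n z := by
      intro z
      rw [hFe z, hμ]
      simp only [hn]
      linear_combination (-(z.1 * F (1, 0) + z.2 * F (0, 1))) * hcs + (z.1 * c + z.2 * s) * hdet
    rcases lt_trichotomy μ 0 with h | h | h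
    · right
      intro z hz
      have := hF z hz
      rw [hFn, hFn] at this
      nlinarith
    · obtain ⟨z, hz⟩ := hne
      have := hF z hz
      rw [hFn, hFn, h] at this
      simp at this
    · left
      intro z hz
      have := hF z hz
      rw [hFn, hFn] at this
      exact lt_of_mul_lt_mul_left this h.le
  have hK : IsCompact (closure Ω) := hbdd.isCompact_closure
  obtain ⟨p₁, hp₁, hmax⟩ := hK.exists_isMaxOn hne.closure hncont.continuousOn
  obtain ⟨p₂, hp₂, hmin⟩ := hK.exists_isMinOn hne.closure hncont.continuousOn
  have hmax' : ∀ z ∈ closure Ω, n z ≤ n p₁ := fun z hz => hmax hz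
  have hmin' : ∀ z ∈ closure Ω, n p₂ ≤ n z := fun z hz => hmin hz
  have hmaxs : ∀ z ∈ Ω, n z < n p₁ := by
    intro z hz
    obtain ⟨q, hq, hlt⟩ := (hO z hz).1
    exact hlt.trans_le (hmax' q (subset_closure hq))
  have hmins : ∀ z ∈ Ω, n p₂ < n z := by
    intro z hz
    obtain ⟨q, hq, hlt⟩ := (hO z hz).2
    exact (hmin' q (subset_closure hq)).trans_lt hlt
  have hzero : ∀ p ∈ closure Ω, (∀ z ∈ Ω, n z ≠ n p) → p ∈ frontier Ω ∧
      c * pd u 1 0 p.1 p.2 + s * pd u 0 1 p.1 p.2 = 0 := by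
    intro p hp hz
    have hpf : p ∈ frontier Ω := by
      rw [hopen.frontier_eq]
      exact ⟨hp, fun h => hz p h rfl⟩
    refine ⟨hpf, hgrad p hpf (c, s) ?_⟩
    intro t ht
    apply hz _ ht
    simp only [hn, Prod.fst_add, Prod.snd_add, Prod.smul_fst, Prod.smul_snd, smul_eq_mul]
    ring
  refine ⟨p₁, p₂, ?_, ?_⟩
  · rintro rfl
    obtain ⟨z, hz⟩ := hne
    exact lt_asymm (hmaxs z hz) (hmins z hz)
  · ext p
    simp only [mem_setOf_eq, mem_insert_iff, mem_singleton_iff]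
    constructor
    · rintro ⟨hp, h0⟩
      have hpc := frontier_subset_closure hp
      rcases hext p hp h0 with h | h
      · left
        refine huniq p hpc p₁ hp₁ (le_antisymm (hmax' p hpc) ?_) (fun z hz => (h z hz).ne)
        exact closure_minimal (fun z hz => (h z hz).le)
          (isClosed_le hncont continuous_const) hp₁
      · right
        refine huniq p hpc p₂ hp₂ (le_antisymm ?_ (hmin' p hpc)) (fun z hz => (h z hz).ne')
        exact closure_minimal (fun z hz => (h z hz).le)
          (isClosed_le continuous_const hncont) hp₂
    · rintro (rfl | rfl)
      · exact hzero _ hp₁ (fun z hz => (hmaxs z hz).ne)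
      · exact hzero _ hp₂ (fun z hz => (hmins z hz).ne')
end

section
/- Let u be a nonconstant solution of -Δu = f(u) in B₁ with ∂u/∂x ≢ 0 on B₁, and suppose (0,0) is a degenerate local maximum point of u with u_xx(0,0) = u_xy(0,0) = 0. Let γ(t) = (x(t), y(t)), t ∈ (-ε, ε), be a C⁴ curve in B₁ with γ(0) = (0,0) and γ'(0) ≠ (0,0), consisting of maximum points of u, i.e. u(γ(t)) = u(0,0) and each γ(t) is a local maximum point of u. Then y'(0) = 0; and if moreover the curvature of γ at 0 vanishes, i.e. y''(0) = 0, then ∂⁴u/∂x⁴(0,0) = 0. -/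
open Filter Metric Set

open MeasureTheory
open scoped ContDiff

/-- derivative in direction x -/
noncomputable def Dx (F : ℝ × ℝ → ℝ) : ℝ × ℝ → ℝ := fun p => fderiv ℝ F p (1, 0)
/-- derivative in direction y -/
noncomputable def Dy (F : ℝ × ℝ → ℝ) : ℝ × ℝ → ℝ := fun p => fderiv ℝ F p (0, 1)

lemma smooth_D {F : ℝ × ℝ → ℝ} (h : ContDiff ℝ ∞ F) (v : ℝ × ℝ) :
    ContDiff ℝ ∞ (fun p => fderiv ℝ F p v) := by
  have : ContDiff ℝ ∞ (fderiv ℝ F) := h.fderiv_right (by simp)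
  exact this.clm_apply contDiff_const

lemma smooth_Dx {F : ℝ × ℝ → ℝ} (h : ContDiff ℝ ∞ F) : ContDiff ℝ ∞ (Dx F) := smooth_D h _
lemma smooth_Dy {F : ℝ × ℝ → ℝ} (h : ContDiff ℝ ∞ F) : ContDiff ℝ ∞ (Dy F) := smooth_D h _

lemma smooth_da {F : ℝ × ℝ → ℝ} (h : ContDiff ℝ ∞ F) (p : ℝ × ℝ) : DifferentiableAt ℝ F p :=
  (h.differentiable (by simp)) p

lemma Dx_mul {F G : ℝ × ℝ → ℝ} (hF : ContDiff ℝ ∞ F) (hG : ContDiff ℝ ∞ G) (p : ℝ × ℝ) :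
    Dx (fun q => F q * G q) p = F p * Dx G p + Dx F p * G p := by
  unfold Dx; rw [fderiv_fun_mul (smooth_da hF p) (smooth_da hG p)]; simp; ring
lemma Dy_mul {F G : ℝ × ℝ → ℝ} (hF : ContDiff ℝ ∞ F) (hG : ContDiff ℝ ∞ G) (p : ℝ × ℝ) :
    Dy (fun q => F q * G q) p = F p * Dy G p + Dy F p * G p := by
  unfold Dy; rw [fderiv_fun_mul (smooth_da hF p) (smooth_da hG p)]; simp; ring
lemma Dx_add {F G : ℝ × ℝ → ℝ} (hF : ContDiff ℝ ∞ F) (hG : ContDiff ℝ ∞ G) (p : ℝ × ℝ) :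
    Dx (fun q => F q + G q) p = Dx F p + Dx G p := by
  unfold Dx; rw [fderiv_fun_add (smooth_da hF p) (smooth_da hG p)]; simp
lemma Dy_add {F G : ℝ × ℝ → ℝ} (hF : ContDiff ℝ ∞ F) (hG : ContDiff ℝ ∞ G) (p : ℝ × ℝ) :
    Dy (fun q => F q + G q) p = Dy F p + Dy G p := by
  unfold Dy; rw [fderiv_fun_add (smooth_da hF p) (smooth_da hG p)]; simp
lemma Dx_neg (F : ℝ × ℝ → ℝ) (p : ℝ × ℝ) : Dx (fun q => - F q) p = - Dx F p := by
  unfold Dx; rw [fderiv_fun_neg]; simp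
lemma Dy_neg (F : ℝ × ℝ → ℝ) (p : ℝ × ℝ) : Dy (fun q => - F q) p = - Dy F p := by
  unfold Dy; rw [fderiv_fun_neg]; simp

lemma D_comm_at {F : ℝ × ℝ → ℝ} {p : ℝ × ℝ} (h : ContDiffAt ℝ ∞ F p) :
    Dx (Dy F) p = Dy (Dx F) p := by
  have hd : DifferentiableAt ℝ (fderiv ℝ F) p :=
    (h.fderiv_right (m := 1) (by norm_cast)).differentiableAt (by simp)
  have hs := (h.isSymmSndFDerivAt (by simp; norm_cast)) (1, 0) (0, 1)
  have key : ∀ v w : ℝ × ℝ, fderiv ℝ (fun q => fderiv ℝ F q v) p w = fderiv ℝ (fderiv ℝ F) p w v := by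
    intro v w
    have h1 := hd.hasFDerivAt.clm_apply (hasFDerivAt_const v p)
    rw [h1.fderiv]; simp
  unfold Dx Dy
  rw [key, key, hs]

lemma D_eq_zero_of_nhds {F : ℝ × ℝ → ℝ} {p : ℝ × ℝ} (h : F =ᶠ[nhds p] 0) (v : ℝ × ℝ) :
    fderiv ℝ F p v = 0 := by
  rw [h.fderiv_eq]; simp

lemma D_zero_off {F : ℝ × ℝ → ℝ} {p : ℝ × ℝ} (h : p ∉ tsupport F) (v : ℝ × ℝ) :
    fderiv ℝ F p v = 0 := D_eq_zero_of_nhds (notMem_tsupport_iff_eventuallyEq.mp h) v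

lemma int_cs {G : ℝ × ℝ → ℝ} (hG : Continuous G) (K : Set (ℝ × ℝ)) (hK : IsCompact K)
    (h : ∀ p, p ∉ K → G p = 0) : Integrable G :=
  hG.integrable_of_hasCompactSupport (HasCompactSupport.intro hK h)

lemma int_D {F : ℝ × ℝ → ℝ} (hF : ContDiff ℝ ∞ F) (hc : HasCompactSupport F) (v : ℝ × ℝ) :
    Integrable (fun p => fderiv ℝ F p v) ∧ ∫ p, fderiv ℝ F p v = 0 := by
  have hi : Integrable (fun p => fderiv ℝ F p v) :=
    int_cs (smooth_D hF v).continuous _ hc (fun p hp => D_zero_off hp v)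
  refine ⟨hi, ?_⟩
  have := integral_mul_fderiv_eq_neg_fderiv_mul_of_integrable (μ := (volume : Measure (ℝ × ℝ)))
    (f := fun _ : ℝ × ℝ => (1:ℝ)) (g := F) (v := v) (by simp) (by simpa using hi)
    (by simpa using int_cs hF.continuous _ hc (fun p hp => image_eq_zero_of_notMem_tsupport hp))
    (by simp) (fun x _ => smooth_da hF x)
  simpa using this

lemma carl0 {a b φ : ℝ × ℝ → ℝ} (ha : ContDiff ℝ ∞ a) (hb : ContDiff ℝ ∞ b) (hφ : ContDiff ℝ ∞ φ)
    (ca : HasCompactSupport a) (cb : HasCompactSupport b) :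
    ∫ p, (Dx (Dx φ) p + Dy (Dy φ) p) * (a p ^ 2 + b p ^ 2) ≤
    ∫ p, ((Dx a p - Dy b p - Dx φ p * a p + Dy φ p * b p) ^ 2
      + (Dx b p + Dy a p - Dx φ p * b p - Dy φ p * a p) ^ 2) := by
  set K := tsupport a ∪ tsupport b
  have hK : IsCompact K := ca.isCompact.union cb.isCompact
  have za : ∀ p, p ∉ K → a p = 0 := fun p hp =>
    image_eq_zero_of_notMem_tsupport (fun h => hp (Or.inl h))
  have zb : ∀ p, p ∉ K → b p = 0 := fun p hp =>
    image_eq_zero_of_notMem_tsupport (fun h => hp (Or.inr h))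
  have zax : ∀ p, p ∉ K → Dx a p = 0 := fun p hp => D_zero_off (fun h => hp (Or.inl h)) _
  have zay : ∀ p, p ∉ K → Dy a p = 0 := fun p hp => D_zero_off (fun h => hp (Or.inl h)) _
  have zbx : ∀ p, p ∉ K → Dx b p = 0 := fun p hp => D_zero_off (fun h => hp (Or.inr h)) _
  have zby : ∀ p, p ∉ K → Dy b p = 0 := fun p hp => D_zero_off (fun h => hp (Or.inr h)) _
  have hax := smooth_Dx ha
  have hay := smooth_Dy ha
  have hbx := smooth_Dx hb
  have hby := smooth_Dy hb
  have hfx := smooth_Dx hφ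
  have hfy := smooth_Dy hφ
  have hfxx := smooth_Dx hfx
  have hfyy := smooth_Dy hfy
  set F1 : ℝ × ℝ → ℝ := fun p => (2 * (Dy a p * b p)) + -(Dx φ p * (a p * a p + b p * b p)) with hF1
  set F2 : ℝ × ℝ → ℝ := fun p => -(2 * (Dx a p * b p)) + -(Dy φ p * (a p * a p + b p * b p)) with hF2
  have sF1 : ContDiff ℝ ∞ F1 := by fun_prop
  have sF2 : ContDiff ℝ ∞ F2 := by fun_prop
  have cF1 : HasCompactSupport F1 := HasCompactSupport.intro hK (fun p hp => by
    simp [hF1, za p hp, zb p hp])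
  have cF2 : HasCompactSupport F2 := HasCompactSupport.intro hK (fun p hp => by
    simp [hF2, za p hp, zb p hp])
  obtain ⟨i1, e1⟩ := int_D sF1 cF1 (1, 0)
  obtain ⟨i2, e2⟩ := int_D sF2 cF2 (0, 1)
  change Integrable (Dx F1) at i1
  change Integrable (Dy F2) at i2
  change ∫ p, Dx F1 p = 0 at e1
  change ∫ p, Dy F2 p = 0 at e2
  have c2 : ContDiff ℝ ∞ (fun _ : ℝ × ℝ => (2:ℝ)) := contDiff_const
  have d2x : ∀ p, Dx (fun _ : ℝ × ℝ => (2:ℝ)) p = 0 := fun p => by simp [Dx]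
  have d2y : ∀ p, Dy (fun _ : ℝ × ℝ => (2:ℝ)) p = 0 := fun p => by simp [Dy]
  have f1 : ∀ p, Dx F1 p = 2 * (Dy a p * Dx b p + Dx (Dy a) p * b p)
      - (Dx φ p * (2 * a p * Dx a p + 2 * b p * Dx b p) + Dx (Dx φ) p * (a p ^ 2 + b p ^ 2)) := by
    intro p
    rw [hF1, Dx_add (by fun_prop) (by fun_prop), Dx_neg, Dx_mul (by fun_prop) (by fun_prop),
      Dx_mul (by fun_prop) (by fun_prop), Dx_mul (by fun_prop) (by fun_prop),
      Dx_add (by fun_prop) (by fun_prop), Dx_mul ha ha, Dx_mul hb hb, d2x]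
    ring
  have f2 : ∀ p, Dy F2 p = -2 * (Dx a p * Dy b p + Dx (Dy a) p * b p)
      - (Dy φ p * (2 * a p * Dy a p + 2 * b p * Dy b p) + Dy (Dy φ) p * (a p ^ 2 + b p ^ 2)) := by
    intro p
    rw [D_comm_at ha.contDiffAt]
    rw [hF2, Dy_add (by fun_prop) (by fun_prop), Dy_neg, Dy_neg, Dy_mul (by fun_prop) (by fun_prop),
      Dy_mul (by fun_prop) (by fun_prop), Dy_mul (by fun_prop) (by fun_prop),
      Dy_add (by fun_prop) (by fun_prop), Dy_mul ha ha, Dy_mul hb hb, d2y]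
    ring
  have iL : Integrable (fun p => (Dx (Dx φ) p + Dy (Dy φ) p) * (a p ^ 2 + b p ^ 2)) :=
    int_cs (ContDiff.continuous (𝕜 := ℝ) (n := ∞) (by fun_prop)) K hK
      (fun p hp => by simp [za p hp, zb p hp])
  have iR : Integrable (fun p => ((Dx a p - Dy b p - Dx φ p * a p + Dy φ p * b p) ^ 2
      + (Dx b p + Dy a p - Dx φ p * b p - Dy φ p * a p) ^ 2)) :=
    int_cs (ContDiff.continuous (𝕜 := ℝ) (n := ∞) (by fun_prop)) K hK
      (fun p hp => by simp [za p hp, zb p hp, zax p hp, zay p hp, zbx p hp, zby p hp])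
  have : ∫ p, ((Dx (Dx φ) p + Dy (Dy φ) p) * (a p ^ 2 + b p ^ 2) + (Dx F1 p + Dy F2 p)) =
      ∫ p, (Dx (Dx φ) p + Dy (Dy φ) p) * (a p ^ 2 + b p ^ 2) := by
    have i12 : Integrable (fun p => Dx F1 p + Dy F2 p) := i1.add i2
    rw [integral_add iL i12, integral_add i1 i2, e1, e2]; ring
  rw [← this]
  refine integral_mono (iL.add (i1.add i2)) iR (fun p => ?_)
  dsimp only
  rw [f1, f2]
  nlinarith [sq_nonneg (Dx a p + Dy φ p * b p), sq_nonneg (Dx b p - Dy φ p * a p),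
    sq_nonneg (Dy b p + Dx φ p * a p), sq_nonneg (Dy a p - Dx φ p * b p)]

lemma carl1 {A B φ : ℝ × ℝ → ℝ} (hA : ContDiff ℝ ∞ A) (hB : ContDiff ℝ ∞ B) (hφ : ContDiff ℝ ∞ φ)
    (cA : HasCompactSupport A) (cB : HasCompactSupport B) :
    ∫ p, Real.exp (2 * φ p) * ((Dx (Dx φ) p + Dy (Dy φ) p) * (A p ^ 2 + B p ^ 2)) ≤
    ∫ p, Real.exp (2 * φ p) * ((Dx A p - Dy B p) ^ 2 + (Dx B p + Dy A p) ^ 2) := by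
  have hE : ContDiff ℝ ∞ (fun p => Real.exp (φ p)) := by fun_prop
  have ex : ∀ p, Dx (fun p => Real.exp (φ p)) p = Real.exp (φ p) * Dx φ p := by
    intro p; unfold Dx; rw [fderiv_exp (smooth_da hφ p)]; simp
  have ey : ∀ p, Dy (fun p => Real.exp (φ p)) p = Real.exp (φ p) * Dy φ p := by
    intro p; unfold Dy; rw [fderiv_exp (smooth_da hφ p)]; simp
  have h := carl0 (a := fun p => Real.exp (φ p) * A p) (b := fun p => Real.exp (φ p) * B p)
    (φ := φ) (by fun_prop) (by fun_prop) hφ cA.mul_left cB.mul_left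
  have e2 : ∀ p, Real.exp (2 * φ p) = Real.exp (φ p) ^ 2 := by
    intro p; rw [two_mul, Real.exp_add]; ring
  convert h using 3 with p p
  · rw [e2]; ring
  · rw [Dx_mul hE hA, Dx_mul hE hB, Dy_mul hE hA, Dy_mul hE hB, ex, ey, e2]; ring

lemma Dx_of_hasDerivAt {F : ℝ × ℝ → ℝ} {p : ℝ × ℝ} {d : ℝ} (hF : DifferentiableAt ℝ F p)
    (h : HasDerivAt (fun t => F (t, p.2)) d p.1) : Dx F p = d := by
  have h1 : HasDerivAt (fun t : ℝ => (t, p.2)) ((1 : ℝ), (0 : ℝ)) p.1 :=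
    (hasDerivAt_id _).prodMk (hasDerivAt_const _ _)
  have h2 := HasFDerivAt.comp_hasDerivAt (x := p.1) (f := fun t : ℝ => (t, p.2)) (l := F)
    (l' := fderiv ℝ F p) hF.hasFDerivAt h1
  exact h2.unique h

lemma Dy_of_hasDerivAt {F : ℝ × ℝ → ℝ} {p : ℝ × ℝ} {d : ℝ} (hF : DifferentiableAt ℝ F p)
    (h : HasDerivAt (fun t => F (p.1, t)) d p.2) : Dy F p = d := by
  have h1 : HasDerivAt (fun t : ℝ => (p.1, t)) ((0 : ℝ), (1 : ℝ)) p.2 :=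
    (hasDerivAt_const _ _).prodMk (hasDerivAt_id _)
  have h2 := HasFDerivAt.comp_hasDerivAt (x := p.2) (f := fun t : ℝ => (p.1, t)) (l := F)
    (l' := fderiv ℝ F p) hF.hasFDerivAt h1
  exact h2.unique h

/-- squared Euclidean distance to `(c1, c2)` -/
def sq2 (c1 c2 : ℝ) (p : ℝ × ℝ) : ℝ := (p.1 - c1) ^ 2 + (p.2 - c2) ^ 2

lemma sq2_smooth (c1 c2 : ℝ) : ContDiff ℝ ∞ (sq2 c1 c2) := by unfold sq2; fun_prop

lemma weight_lap (c1 c2 l τ : ℝ) (p : ℝ × ℝ) :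
    Dx (Dx (fun q => τ * Real.exp (-l * sq2 c1 c2 q))) p
      + Dy (Dy (fun q => τ * Real.exp (-l * sq2 c1 c2 q))) p
      = τ * (4 * l * (l * sq2 c1 c2 p - 1) * Real.exp (-l * sq2 c1 c2 p)) := by
  have hs := sq2_smooth c1 c2
  have hφ : ContDiff ℝ ∞ (fun q => τ * Real.exp (-l * sq2 c1 c2 q)) := by fun_prop
  have hx : Dx (fun q => τ * Real.exp (-l * sq2 c1 c2 q))
      = fun q => τ * (Real.exp (-l * sq2 c1 c2 q) * (-l * (2 * (q.1 - c1)))) := by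
    funext q
    apply Dx_of_hasDerivAt (smooth_da hφ q)
    have : HasDerivAt (fun t => sq2 c1 c2 (t, q.2)) (2 * (q.1 - c1)) q.1 := by
      unfold sq2
      simpa using (((hasDerivAt_id q.1).sub_const c1).pow 2).add_const ((q.2 - c2) ^ 2)
    exact ((this.const_mul (-l)).exp).const_mul τ
  have hy : Dy (fun q => τ * Real.exp (-l * sq2 c1 c2 q))
      = fun q => τ * (Real.exp (-l * sq2 c1 c2 q) * (-l * (2 * (q.2 - c2)))) := by
    funext q
    apply Dy_of_hasDerivAt (smooth_da hφ q)
    have : HasDerivAt (fun t => sq2 c1 c2 (q.1, t)) (2 * (q.2 - c2)) q.2 := by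
      unfold sq2
      simpa using (((hasDerivAt_id q.2).sub_const c2).pow 2).const_add ((q.1 - c1) ^ 2)
    exact ((this.const_mul (-l)).exp).const_mul τ
  have h1 := Dx_of_hasDerivAt (p := p) (smooth_da (smooth_Dx hφ) p)
    (d := τ * (Real.exp (-l * sq2 c1 c2 p) * (-l * (2 * (p.1 - c1))) * (-l * (2 * (p.1 - c1)))
      + Real.exp (-l * sq2 c1 c2 p) * (-l * (2 * 1)))) (by
    rw [hx]
    have : HasDerivAt (fun t => sq2 c1 c2 (t, p.2)) (2 * (p.1 - c1)) p.1 := by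
      unfold sq2
      simpa using (((hasDerivAt_id p.1).sub_const c1).pow 2).add_const ((p.2 - c2) ^ 2)
    exact (((this.const_mul (-l)).exp).mul
      ((((hasDerivAt_id p.1).sub_const c1).const_mul 2).const_mul (-l))).const_mul τ)
  have h2 := Dy_of_hasDerivAt (p := p) (smooth_da (smooth_Dy hφ) p)
    (d := τ * (Real.exp (-l * sq2 c1 c2 p) * (-l * (2 * (p.2 - c2))) * (-l * (2 * (p.2 - c2)))
      + Real.exp (-l * sq2 c1 c2 p) * (-l * (2 * 1)))) (by
    rw [hy]
    have : HasDerivAt (fun t => sq2 c1 c2 (p.1, t)) (2 * (p.2 - c2)) p.2 := by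
      unfold sq2
      simpa using (((hasDerivAt_id p.2).sub_const c2).pow 2).const_add ((p.1 - c1) ^ 2)
    exact (((this.const_mul (-l)).exp).mul
      ((((hasDerivAt_id p.2).sub_const c2).const_mul 2).const_mul (-l))).const_mul τ)
  rw [h1, h2]
  unfold sq2
  ring

lemma sq2_compact (c1 c2 R : ℝ) : IsCompact {p | sq2 c1 c2 p ≤ R} := by
  apply Metric.isCompact_of_isClosed_isBounded
  · exact isClosed_le (sq2_smooth c1 c2).continuous continuous_const
  · apply (Metric.isBounded_closedBall (x := (c1, c2)) (r := |R| + 1)).subset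
    intro p hp
    have hp' : (p.1 - c1) ^ 2 + (p.2 - c2) ^ 2 ≤ R := hp
    have hR := le_abs_self R
    have h0 := abs_nonneg R
    simp only [Metric.mem_closedBall, Prod.dist_eq, Real.dist_eq, max_le_iff]
    constructor
    · apply abs_le_of_sq_le_sq _ (by positivity)
      nlinarith [sq_nonneg (p.2 - c2)]
    · apply abs_le_of_sq_le_sq _ (by positivity)
      nlinarith [sq_nonneg (p.1 - c1)]

/-- energy density -/
noncomputable def En (V : ℝ × ℝ → ℝ) (p : ℝ × ℝ) : ℝ := V p ^ 2 + Dx V p ^ 2 + Dy V p ^ 2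

lemma uc_ineq {V χ φ : ℝ × ℝ → ℝ} (hV : ContDiff ℝ ∞ V) (hχ : ContDiff ℝ ∞ χ)
    (hφ : ContDiff ℝ ∞ φ) (cχ : HasCompactSupport χ) (C μ : ℝ)
    (hC : ∀ p, χ p ≠ 0 → |Dx (Dx V) p + Dy (Dy V) p| ≤ C * |V p|)
    (hμ : ∀ p, χ p ≠ 0 → En V p ≠ 0 → μ ≤ Dx (Dx φ) p + Dy (Dy φ) p) :
    (μ - 2 * (1 + C ^ 2)) * ∫ p, Real.exp (2 * φ p) * (χ p ^ 2 * En V p) ≤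
      ∫ p, Real.exp (2 * φ p) * (2 * (Dx χ p ^ 2 + Dy χ p ^ 2) * En V p) := by
  have hVx := smooth_Dx hV
  have hVy := smooth_Dy hV
  have hVxx := smooth_Dx hVx
  have hVyy := smooth_Dy hVy
  have hVxy := smooth_Dx hVy
  have hVyx := smooth_Dy hVx
  have hχx := smooth_Dx hχ
  have hχy := smooth_Dy hχ
  have hfx := smooth_Dx hφ
  have hfy := smooth_Dy hφ
  have hfxx := smooth_Dx hfx
  have hfyy := smooth_Dy hfy
  have hE : ContDiff ℝ ∞ (En V) := by unfold En; fun_prop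
  have zχ : ∀ p, p ∉ tsupport χ → χ p = 0 := fun p hp => image_eq_zero_of_notMem_tsupport hp
  have zχx : ∀ p, p ∉ tsupport χ → Dx χ p = 0 := fun p hp => D_zero_off hp _
  have zχy : ∀ p, p ∉ tsupport χ → Dy χ p = 0 := fun p hp => D_zero_off hp _
  have A := carl1 (A := fun p => χ p * V p) (B := fun p => 0) (φ := φ) (by fun_prop) (by fun_prop)
    hφ cχ.mul_right HasCompactSupport.zero
  have B := carl1 (A := fun p => χ p * Dx V p) (B := fun p => -(χ p * Dy V p)) (φ := φ)
    (by fun_prop) (by fun_prop) hφ cχ.mul_right cχ.mul_right.neg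
  have z0x : ∀ p, Dx (fun _ : ℝ × ℝ => (0:ℝ)) p = 0 := fun p => by simp [Dx]
  have z0y : ∀ p, Dy (fun _ : ℝ × ℝ => (0:ℝ)) p = 0 := fun p => by simp [Dy]
  simp only [Dx_neg, Dy_neg, z0x, z0y, Dx_mul hχ hV, Dy_mul hχ hV, Dx_mul hχ hVx, Dx_mul hχ hVy,
    Dy_mul hχ hVx, Dy_mul hχ hVy] at A B
  have cont : ∀ {G : ℝ × ℝ → ℝ}, ContDiff ℝ ∞ G → Continuous G := fun h => h.continuous
  have i1 := int_cs (G := fun p => Real.exp (2 * φ p) * ((Dx (Dx φ) p + Dy (Dy φ) p) *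
    ((χ p * V p) ^ 2 + 0 ^ 2))) (cont (by fun_prop)) _ cχ (fun p hp => by simp [zχ p hp])
  have i2 := int_cs (G := fun p => Real.exp (2 * φ p) * ((Dx (Dx φ) p + Dy (Dy φ) p) *
    ((χ p * Dx V p) ^ 2 + (-(χ p * Dy V p)) ^ 2))) (cont (by fun_prop)) _ cχ
    (fun p hp => by simp [zχ p hp])
  have i3 := int_cs (G := fun p => Real.exp (2 * φ p) * ((χ p * Dx V p + Dx χ p * V p - 0) ^ 2
    + (0 + (χ p * Dy V p + Dy χ p * V p)) ^ 2)) (cont (by fun_prop)) _ cχ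
    (fun p hp => by simp [zχ p hp, zχx p hp, zχy p hp])
  have i4 := int_cs (G := fun p => Real.exp (2 * φ p) *
    ((χ p * Dx (Dx V) p + Dx χ p * Dx V p - -(χ p * Dy (Dy V) p + Dy χ p * Dy V p)) ^ 2
    + (-(χ p * Dx (Dy V) p + Dx χ p * Dy V p) + (χ p * Dy (Dx V) p + Dy χ p * Dx V p)) ^ 2))
    (cont (by fun_prop)) _ cχ (fun p hp => by simp [zχ p hp, zχx p hp, zχy p hp])
  have i5 := int_cs (G := fun p => Real.exp (2 * φ p) * (χ p ^ 2 * En V p)) (cont (by fun_prop)) _ cχ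
    (fun p hp => by simp [zχ p hp])
  have i6 := int_cs (G := fun p => Real.exp (2 * φ p) * (2 * (Dx χ p ^ 2 + Dy χ p ^ 2) * En V p))
    (cont (by fun_prop)) _ cχ (fun p hp => by simp [zχx p hp, zχy p hp])
  have S1 : μ * ∫ p, Real.exp (2 * φ p) * (χ p ^ 2 * En V p) ≤
      (∫ p, Real.exp (2 * φ p) * ((Dx (Dx φ) p + Dy (Dy φ) p) * ((χ p * V p) ^ 2 + 0 ^ 2))) +
      ∫ p, Real.exp (2 * φ p) * ((Dx (Dx φ) p + Dy (Dy φ) p) *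
    ((χ p * Dx V p) ^ 2 + (-(χ p * Dy V p)) ^ 2)) := by
    rw [← integral_add i1 i2, ← integral_const_mul]
    refine integral_mono (i5.const_mul μ) (i1.add i2) (fun p => ?_)
    have he := Real.exp_pos (2 * φ p)
    dsimp only [Pi.add_apply]
    have : Real.exp (2 * φ p) * ((Dx (Dx φ) p + Dy (Dy φ) p) * ((χ p * V p) ^ 2 + 0 ^ 2)) +
      Real.exp (2 * φ p) * ((Dx (Dx φ) p + Dy (Dy φ) p) *
      ((χ p * Dx V p) ^ 2 + (-(χ p * Dy V p)) ^ 2)) =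
      (Dx (Dx φ) p + Dy (Dy φ) p) * (Real.exp (2 * φ p) * (χ p ^ 2 * En V p)) := by
      unfold En; ring
    rw [this]
    by_cases h1 : χ p = 0
    · simp [h1]
    by_cases h2 : En V p = 0
    · simp [h2]
    apply mul_le_mul_of_nonneg_right (hμ p h1 h2)
    unfold En; positivity
  have S2 : (∫ p, Real.exp (2 * φ p) * ((χ p * Dx V p + Dx χ p * V p - 0) ^ 2
    + (0 + (χ p * Dy V p + Dy χ p * V p)) ^ 2)) + (∫ p, Real.exp (2 * φ p) *
    ((χ p * Dx (Dx V) p + Dx χ p * Dx V p - -(χ p * Dy (Dy V) p + Dy χ p * Dy V p)) ^ 2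
    + (-(χ p * Dx (Dy V) p + Dx χ p * Dy V p) + (χ p * Dy (Dx V) p + Dy χ p * Dx V p)) ^ 2)) ≤
     2 * (1 + C ^ 2) * (∫ p, Real.exp (2 * φ p) * (χ p ^ 2 * En V p)) +
      ∫ p, Real.exp (2 * φ p) * (2 * (Dx χ p ^ 2 + Dy χ p ^ 2) * En V p) := by
    rw [← integral_add i3 i4, ← integral_const_mul, ← integral_add (i5.const_mul _) i6]
    refine integral_mono (i3.add i4) ((i5.const_mul _).add i6) (fun p => ?_)
    have he := Real.exp_pos (2 * φ p)
    dsimp only [Pi.add_apply]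
    rw [D_comm_at hV.contDiffAt]
    rw [mul_left_comm, ← mul_add, ← mul_add]
    apply mul_le_mul_of_nonneg_left _ he.le
    have hL : χ p ^ 2 * (Dx (Dx V) p + Dy (Dy V) p) ^ 2 ≤ χ p ^ 2 * (C ^ 2 * V p ^ 2) := by
      by_cases h1 : χ p = 0
      · simp [h1]
      apply mul_le_mul_of_nonneg_left _ (sq_nonneg _)
      have := pow_le_pow_left₀ (abs_nonneg _) (hC p h1) 2
      rwa [mul_pow, sq_abs, sq_abs] at this
    have h1 : (χ p * Dx V p + Dx χ p * V p - 0) ^ 2 + (0 + (χ p * Dy V p + Dy χ p * V p)) ^ 2 ≤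
        2 * χ p ^ 2 * (Dx V p ^ 2 + Dy V p ^ 2) + 2 * (Dx χ p ^ 2 + Dy χ p ^ 2) * V p ^ 2 := by
      nlinarith [sq_nonneg (χ p * Dx V p - Dx χ p * V p), sq_nonneg (χ p * Dy V p - Dy χ p * V p)]
    have h2 : (χ p * Dx (Dx V) p + Dx χ p * Dx V p - -(χ p * Dy (Dy V) p + Dy χ p * Dy V p)) ^ 2
    + (-(χ p * Dy (Dx V) p + Dx χ p * Dy V p) + (χ p * Dy (Dx V) p + Dy χ p * Dx V p)) ^ 2 ≤
        2 * (χ p ^ 2 * (Dx (Dx V) p + Dy (Dy V) p) ^ 2)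
        + 2 * (Dx χ p ^ 2 + Dy χ p ^ 2) * (Dx V p ^ 2 + Dy V p ^ 2) := by
      nlinarith [sq_nonneg (χ p * (Dx (Dx V) p + Dy (Dy V) p) - (Dx χ p * Dx V p + Dy χ p * Dy V p)),
        sq_nonneg (Dx χ p * Dy V p - Dy χ p * Dx V p)]
    have h3 : 0 ≤ χ p ^ 2 * V p ^ 2 := by positivity
    have h4 : 0 ≤ χ p ^ 2 * C ^ 2 * (Dx V p ^ 2 + Dy V p ^ 2) := by positivity
    unfold En
    linarith
  linarith

lemma uc_disc {V : ℝ × ℝ → ℝ} (hV : ContDiff ℝ ∞ V) (c1 c2 ρ R1 R C : ℝ) (hρ : 0 < ρ) (hR : R1 < R)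
    (hC : ∀ p, sq2 c1 c2 p < R → |Dx (Dx V) p + Dy (Dy V) p| ≤ C * |V p|)
    (h0 : ∀ p, sq2 c1 c2 p < ρ → V p = 0) (p₀ : ℝ × ℝ) (hp₀ : sq2 c1 c2 p₀ < R1) : V p₀ = 0 := by
  have hs := sq2_smooth c1 c2
  have hsc := hs.continuous
  have s0 : ∀ p, 0 ≤ sq2 c1 c2 p := fun p => by unfold sq2; positivity
  have hR1 : 0 < R1 := (s0 p₀).trans_lt hp₀
  set χ : ℝ × ℝ → ℝ := fun p => Real.smoothTransition ((R - sq2 c1 c2 p) / (R - R1)) with hχd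
  have hRR : 0 < R - R1 := by linarith
  have hχ : ContDiff ℝ ∞ χ :=
    (Real.smoothTransition.contDiff (n := ⊤)).comp ((contDiff_const.sub hs).div_const _)
  have χ0 : ∀ p, R ≤ sq2 c1 c2 p → χ p = 0 := fun p hp =>
    Real.smoothTransition.zero_of_nonpos (div_nonpos_of_nonpos_of_nonneg (by linarith) hRR.le)
  have χ1 : ∀ p, sq2 c1 c2 p ≤ R1 → χ p = 1 := fun p hp =>
    Real.smoothTransition.one_of_one_le ((one_le_div hRR).2 (by linarith))
  have cχ : HasCompactSupport χ := HasCompactSupport.intro (sq2_compact c1 c2 R) (fun p hp => by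
    apply χ0; simp at hp; exact hp.le)
  have gχ : ∀ p, sq2 c1 c2 p < R1 → ∀ v, fderiv ℝ χ p v = 0 := by
    intro p hp v
    have : χ =ᶠ[nhds p] fun _ => (1:ℝ) := by
      filter_upwards [(isOpen_lt hsc continuous_const).mem_nhds hp] with q hq
      exact χ1 q (le_of_lt hq)
    rw [this.fderiv_eq]; simp
  have hVx := smooth_Dx hV
  have hVy := smooth_Dy hV
  have hχx := smooth_Dx hχ
  have hχy := smooth_Dy hχ
  have hE : ContDiff ℝ ∞ (En V) := by unfold En; fun_prop
  have hE0 : ∀ p, 0 ≤ En V p := fun p => by unfold En; positivity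
  have hEρ : ∀ p, sq2 c1 c2 p < ρ → En V p = 0 := by
    intro p hp
    have : V =ᶠ[nhds p] 0 := by
      filter_upwards [(isOpen_lt hsc continuous_const).mem_nhds hp] with q hq
      exact h0 q hq
    simp [En, Dx, Dy, D_eq_zero_of_nhds this, h0 p hp]
  set l := 2 / ρ with hl
  have hlp : 0 < l := by positivity
  have hlρ : l * ρ = 2 := by rw [hl]; field_simp
  set m := 4 * l * Real.exp (-l * R) with hm
  have hmp : 0 < m := by positivity
  set K := 2 * (1 + C ^ 2) with hK
  have hχc := hχ.continuous
  have hEc := hE.continuous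
  set θ : ℝ × ℝ → ℝ := fun p => max 0 (R1 - sq2 c1 c2 p) with hθ
  have hθc : Continuous θ := by fun_prop
  set M := ∫ p, 2 * (Dx χ p ^ 2 + Dy χ p ^ 2) * En V p with hM
  set J := ∫ p, θ p * En V p with hJ
  have zχ : ∀ p, p ∉ tsupport χ → χ p = 0 := fun p hp => image_eq_zero_of_notMem_tsupport hp
  have zχx : ∀ p, p ∉ tsupport χ → Dx χ p = 0 := fun p hp => D_zero_off hp _
  have zχy : ∀ p, p ∉ tsupport χ → Dy χ p = 0 := fun p hp => D_zero_off hp _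
  have cont : ∀ {G : ℝ × ℝ → ℝ}, ContDiff ℝ ∞ G → Continuous G := fun h => h.continuous
  have zθ : ∀ p, p ∉ {p | sq2 c1 c2 p ≤ R} → θ p = 0 := by
    intro p hp
    replace hp : ¬ sq2 c1 c2 p ≤ R := hp
    rw [not_le] at hp
    simp only [hθ]
    exact max_eq_left (by linarith)
  have iJ : Integrable (fun p => θ p * En V p) :=
    int_cs (by fun_prop) _ (sq2_compact c1 c2 R) (fun p hp => by simp [zθ p hp])
  have iM : Integrable (fun p => 2 * (Dx χ p ^ 2 + Dy χ p ^ 2) * En V p) :=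
    int_cs (cont (by fun_prop)) _ cχ (fun p hp => by simp [zχx p hp, zχy p hp])
  have main : ∀ τ, 0 ≤ τ → K ≤ τ * m → (τ * m - K) * J ≤ R1 * M := by
    intro τ hτ hτK
    set φ : ℝ × ℝ → ℝ := fun q => τ * Real.exp (-l * sq2 c1 c2 q) with hφd
    have hφ : ContDiff ℝ ∞ φ := by fun_prop
    have hφc := hφ.continuous
    have h1 := uc_ineq hV hχ hφ cχ C (τ * m)
      (fun p hp => hC p (by by_contra h; exact hp (χ0 p (by linarith))))
      (fun p hp hEp => by
        have a1 : sq2 c1 c2 p < R := by by_contra h; exact hp (χ0 p (by linarith))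
        have a2 : ρ ≤ sq2 c1 c2 p := by by_contra h; exact hEp (hEρ p (by linarith))
        rw [hφd, weight_lap]
        apply mul_le_mul_of_nonneg_left _ hτ
        rw [hm]
        have b1 : Real.exp (-l * R) ≤ Real.exp (-l * sq2 c1 c2 p) := by
          apply Real.exp_le_exp.2; nlinarith
        have b2 : 1 ≤ l * sq2 c1 c2 p - 1 := by nlinarith
        have b3 : 4 * l * 1 ≤ 4 * l * (l * sq2 c1 c2 p - 1) := by
          apply mul_le_mul_of_nonneg_left b2 (by positivity)
        calc 4 * l * Real.exp (-l * R) ≤ 4 * l * Real.exp (-l * sq2 c1 c2 p) := by gcongr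
          _ ≤ _ := by
            apply mul_le_mul_of_nonneg_right _ (Real.exp_pos _).le
            linarith)
    set e := Real.exp (2 * (τ * Real.exp (-l * R1))) with he
    have hep : 0 < e := Real.exp_pos _
    have i5 := int_cs (G := fun p => Real.exp (2 * φ p) * (χ p ^ 2 * En V p)) (by fun_prop) _ cχ
      (fun p hp => by simp [zχ p hp])
    have i6 := int_cs (G := fun p => Real.exp (2 * φ p) * (2 * (Dx χ p ^ 2 + Dy χ p ^ 2) * En V p))
      (cont (by fun_prop)) _ cχ (fun p hp => by simp [zχx p hp, zχy p hp])
    have h2 : ∫ p, Real.exp (2 * φ p) * (2 * (Dx χ p ^ 2 + Dy χ p ^ 2) * En V p) ≤ e * M := by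
      rw [hM, ← integral_const_mul]
      refine integral_mono i6 (iM.const_mul e) (fun p => ?_)
      dsimp only
      by_cases hp : sq2 c1 c2 p < R1
      · have := gχ p hp
        simp [Dx, Dy, this]
      · apply mul_le_mul_of_nonneg_right
        · rw [he]
          apply Real.exp_le_exp.2
          apply mul_le_mul_of_nonneg_left _ (by norm_num)
          apply mul_le_mul_of_nonneg_left _ hτ
          apply Real.exp_le_exp.2; nlinarith
        · have := hE0 p
          positivity
    have h3 : e * J ≤ R1 * ∫ p, Real.exp (2 * φ p) * (χ p ^ 2 * En V p) := by
      rw [hJ, ← integral_const_mul, ← integral_const_mul]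
      refine integral_mono (iJ.const_mul e) (i5.const_mul R1) (fun p => ?_)
      dsimp only
      have := hE0 p
      by_cases hp : sq2 c1 c2 p < R1
      · rw [χ1 p hp.le]
        have t1 : θ p ≤ R1 := max_le hR1.le (by linarith [s0 p])
        have t2 : e ≤ Real.exp (2 * φ p) := by
          rw [he]
          apply Real.exp_le_exp.2
          apply mul_le_mul_of_nonneg_left _ (by norm_num)
          apply mul_le_mul_of_nonneg_left _ hτ
          apply Real.exp_le_exp.2; nlinarith
        calc e * (θ p * En V p) ≤ Real.exp (2 * φ p) * (R1 * En V p) := by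
              have : 0 ≤ θ p := le_max_left _ _
              gcongr
          _ = _ := by ring
      · have : θ p = 0 := max_eq_left (by linarith)
        rw [this]
        simp only [zero_mul, mul_zero]
        positivity
    have h4 : e * ((τ * m - K) * J) ≤ e * (R1 * M) := by
      calc e * ((τ * m - K) * J) = (τ * m - K) * (e * J) := by ring
        _ ≤ (τ * m - K) * (R1 * ∫ p, Real.exp (2 * φ p) * (χ p ^ 2 * En V p)) :=
            mul_le_mul_of_nonneg_left h3 (by linarith)
        _ = R1 * ((τ * m - K) * ∫ p, Real.exp (2 * φ p) * (χ p ^ 2 * En V p)) := by ring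
        _ ≤ R1 * (e * M) := mul_le_mul_of_nonneg_left (h1.trans h2) hR1.le
        _ = _ := by ring
    exact le_of_mul_le_mul_left h4 hep
  by_contra hne
  have hJpos : 0 < J := by
    apply Continuous.integral_pos_of_hasCompactSupport_nonneg_nonzero (x := p₀) (by fun_prop)
    · exact HasCompactSupport.intro (sq2_compact c1 c2 R) (fun p hp => by simp [zθ p hp])
    · intro p
      exact mul_nonneg (le_max_left _ _) (hE0 p)
    · apply ne_of_gt
      apply mul_pos
      · exact lt_max_of_lt_right (by linarith)
      · unfold En; positivity
  have hM0 : 0 ≤ M := integral_nonneg (fun p => by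
    have := hE0 p
    dsimp only [Pi.zero_apply]
    positivity)
  have hK0 : 0 < K := by positivity
  have hd : 0 < R1 * M + 1 := by positivity
  have e1 : (K + (R1 * M + 1) / J) / m * m = K + (R1 * M + 1) / J := by field_simp
  have := main ((K + (R1 * M + 1) / J) / m) (by positivity) (by
    rw [e1]; have : 0 < (R1 * M + 1) / J := by positivity
    linarith)
  rw [e1] at this
  have e2 : (K + (R1 * M + 1) / J - K) * J = R1 * M + 1 := by field_simp; ring
  linarith

lemma uc_square {V : ℝ × ℝ → ℝ} (hV : ContDiff ℝ ∞ V) (r C : ℝ) (hr : 0 < r)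
    (hC : ∀ p ∈ ball (0 : ℝ × ℝ) r, |Dx (Dx V) p + Dy (Dy V) p| ≤ C * |V p|)
    (h0 : V =ᶠ[nhds 0] 0) : ∀ p ∈ ball (0 : ℝ × ℝ) r, V p = 0 := by
  set Z := interior {p | V p = 0} with hZ
  have hsub : ball (0 : ℝ × ℝ) r ⊆ Z := by
    apply IsPreconnected.subset_of_closure_inter_subset (convex_ball _ _).isPreconnected
      isOpen_interior
    · refine ⟨0, mem_ball_self hr, ?_⟩
      rw [mem_interior_iff_mem_nhds]
      exact h0
    · rintro z ⟨hz, hzb⟩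
      obtain ⟨d, hd, hdb⟩ := Metric.isOpen_iff.1 isOpen_ball z hzb
      obtain ⟨c, hc, hcz⟩ := Metric.mem_closure_iff.1 hz (d / 8) (by positivity)
      obtain ⟨ρ, hρ, hρb⟩ := Metric.isOpen_iff.1 isOpen_interior c hc
      -- sup-norm vs Euclid
      have sub1 : ∀ p q : ℝ × ℝ, ∀ t, 0 < t → sq2 q.1 q.2 p < t ^ 2 → dist p q < t := by
        intro p q t ht h
        unfold sq2 at h
        rw [Prod.dist_eq, Real.dist_eq, Real.dist_eq, max_lt_iff]
        constructor
        · apply abs_lt_of_sq_lt_sq _ ht.le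
          nlinarith [sq_nonneg (p.2 - q.2)]
        · apply abs_lt_of_sq_lt_sq _ ht.le
          nlinarith [sq_nonneg (p.1 - q.1)]
      have sub2 : ∀ p q : ℝ × ℝ, ∀ t, dist p q < t → sq2 q.1 q.2 p < 2 * t ^ 2 := by
        intro p q t h
        rw [Prod.dist_eq, Real.dist_eq, Real.dist_eq, max_lt_iff] at h
        unfold sq2
        have h1 := sq_lt_sq' (abs_lt.1 h.1).1 (abs_lt.1 h.1).2
        have h2 := sq_lt_sq' (abs_lt.1 h.2).1 (abs_lt.1 h.2).2
        linarith
      rw [mem_interior_iff_mem_nhds]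
      refine Filter.mem_of_superset (ball_mem_nhds z (show 0 < d / 8 by positivity)) (fun p hp => ?_)
      have hpz : dist p z < d / 8 := hp
      have hpc : dist p c < d / 4 := by linarith [dist_triangle p z c]
      refine uc_disc hV c.1 c.2 (ρ ^ 2) (2 * (d / 4) ^ 2) ((d / 2) ^ 2) C (by positivity)
        (by nlinarith [sq_pos_of_pos hd]) ?_ ?_ p (sub2 p c _ hpc)
      · intro q hq
        apply hC
        apply hdb
        have := sub1 q c _ (by positivity) hq
        have h3 := dist_triangle q c z
        rw [dist_comm c z] at h3
        rw [mem_ball]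
        linarith
      · intro q hq
        have := hρb (sub1 q c _ hρ hq)
        have h : q ∈ {p | V p = 0} := interior_subset this
        exact h
  intro p hp
  have h : p ∈ {p | V p = 0} := interior_subset (hsub hp)
  exact h

lemma chain2 {F : ℝ × ℝ → ℝ} {g1 g2 : ℝ → ℝ} {d1 d2 t : ℝ}
    (hF : DifferentiableAt ℝ F (g1 t, g2 t)) (h1 : HasDerivAt g1 d1 t) (h2 : HasDerivAt g2 d2 t) :
    HasDerivAt (fun s => F (g1 s, g2 s)) (Dx F (g1 t, g2 t) * d1 + Dy F (g1 t, g2 t) * d2) t := by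
  have h := HasFDerivAt.comp_hasDerivAt (x := t) (f := fun s : ℝ => (g1 s, g2 s)) (l := F)
    (l' := fderiv ℝ F (g1 t, g2 t)) hF.hasFDerivAt (h1.prodMk h2)
  have e : ((d1, d2) : ℝ × ℝ) = d1 • (1, 0) + d2 • (0, 1) := by simp
  rw [e, map_add, map_smul, map_smul] at h
  have e2 : Dx F (g1 t, g2 t) * d1 + Dy F (g1 t, g2 t) * d2 =
      d1 • fderiv ℝ F (g1 t, g2 t) (1, 0) + d2 • fderiv ℝ F (g1 t, g2 t) (0, 1) := by
    simp only [Dx, Dy, smul_eq_mul]; ring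
  rw [e2]
  exact h

lemma deriv_param {F F' : ℝ → ℝ → ℝ} (hF : Continuous (fun p : ℝ × ℝ => F p.1 p.2))
    (hF' : Continuous (fun p : ℝ × ℝ => F' p.1 p.2))
    (hd : ∀ x t, HasDerivAt (fun y => F y t) (F' x t) x) (a b x₀ : ℝ) :
    HasDerivAt (fun x => ∫ t in a..b, F x t) (∫ t in a..b, F' x₀ t) x₀ := by
  obtain ⟨M, hM⟩ := ((isCompact_Icc (a := x₀ - 1) (b := x₀ + 1)).prod
    (isCompact_uIcc (a := a) (b := b))).exists_bound_of_continuousOn hF'.continuousOn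
  have c1 : ∀ x, Continuous (F x) := fun x => hF.comp (by fun_prop : Continuous fun t => (x, t))
  have c2 : ∀ x, Continuous (F' x) := fun x => hF'.comp (by fun_prop : Continuous fun t => (x, t))
  refine (intervalIntegral.hasDerivAt_integral_of_dominated_loc_of_deriv_le
    (F := F) (F' := F') (bound := fun _ => M) (s := Icc (x₀ - 1) (x₀ + 1))
    (Icc_mem_nhds (by linarith) (by linarith)) ?_ ?_ ?_ ?_ ?_ ?_).2
  · exact Filter.Eventually.of_forall (fun x => (c1 x).aestronglyMeasurable)
  · exact (c1 x₀).intervalIntegrable _ _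
  · exact (c2 x₀).aestronglyMeasurable
  · exact Filter.Eventually.of_forall (fun t ht x hx => hM (x, t) ⟨hx, uIoc_subset_uIcc ht⟩)
  · exact intervalIntegrable_const
  · exact Filter.Eventually.of_forall (fun t _ x _ => hd x t)

lemma polar_s19 {w : ℝ × ℝ → ℝ} (hw : ContDiff ℝ ∞ w) (C R : ℝ) (hC : 0 < C) (hR : 0 < R)
    (h : ∀ p, sq2 0 0 p < R ^ 2 → 0 ≤ w p ∧ Dx (Dx w) p + Dy (Dy w) p ≤ C * w p)
    (h00 : w 0 = 0) : w =ᶠ[nhds 0] 0 := by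
  have hx := smooth_Dx hw
  have hy := smooth_Dy hw
  have hxx := smooth_Dx hx
  have hxy := smooth_Dx hy
  have hyy := smooth_Dy hy
  have hcomm : ∀ p, Dy (Dx w) p = Dx (Dy w) p := fun p => (D_comm_at hw.contDiffAt).symm
  set P : ℝ → ℝ → ℝ × ℝ := fun r t => (r * Real.cos t, r * Real.sin t) with hP
  have sP : ∀ r t, sq2 0 0 (P r t) = r ^ 2 := by
    intro r t
    simp only [sq2, hP, sub_zero]
    nlinarith [Real.sin_sq_add_cos_sq t]
  have chr : ∀ {F : ℝ × ℝ → ℝ}, ContDiff ℝ ∞ F → ∀ r t, HasDerivAt (fun s => F (P s t))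
      (Dx F (P r t) * Real.cos t + Dy F (P r t) * Real.sin t) r := by
    intro F hF r t
    exact chain2 (smooth_da hF _) (by simpa using (hasDerivAt_id r).mul_const (Real.cos t))
      (by simpa using (hasDerivAt_id r).mul_const (Real.sin t))
  have cht : ∀ {F : ℝ × ℝ → ℝ}, ContDiff ℝ ∞ F → ∀ r t, HasDerivAt (fun s => F (P r s))
      (Dx F (P r t) * (r * -Real.sin t) + Dy F (P r t) * (r * Real.cos t)) t := by
    intro F hF r t
    exact chain2 (smooth_da hF _) ((Real.hasDerivAt_cos t).const_mul r)
      ((Real.hasDerivAt_sin t).const_mul r)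
  have hwc := hw.continuous
  have hxc := hx.continuous
  have hyc := hy.continuous
  have hxxc := hxx.continuous
  have hxyc := hxy.continuous
  have hyyc := hyy.continuous
  set W : ℝ → ℝ → ℝ := fun r t => w (P r t) with hW
  set W1 : ℝ → ℝ → ℝ := fun r t => Dx w (P r t) * Real.cos t + Dy w (P r t) * Real.sin t with hW1
  set W2 : ℝ → ℝ → ℝ := fun r t =>
    (Dx (Dx w) (P r t) * Real.cos t + Dy (Dx w) (P r t) * Real.sin t) * Real.cos t
    + (Dx (Dy w) (P r t) * Real.cos t + Dy (Dy w) (P r t) * Real.sin t) * Real.sin t with hW2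
  set T : ℝ → ℝ → ℝ := fun r t => -(Dx w (P r t) * Real.sin t) + Dy w (P r t) * Real.cos t with hT
  set T1 : ℝ → ℝ → ℝ := fun r t => -(Dx w (P r t) * Real.cos t + Dy w (P r t) * Real.sin t)
    + r * (Dx (Dx w) (P r t) * Real.sin t ^ 2 - 2 * Dx (Dy w) (P r t) * Real.sin t * Real.cos t
      + Dy (Dy w) (P r t) * Real.cos t ^ 2) with hT1
  set I : ℝ → ℝ := fun r => ∫ t in (-Real.pi)..Real.pi, W r t with hI
  set I1 : ℝ → ℝ := fun r => ∫ t in (-Real.pi)..Real.pi, W1 r t with hI1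
  set I2 : ℝ → ℝ := fun r => ∫ t in (-Real.pi)..Real.pi, W2 r t with hI2
  have hPc : Continuous (fun p : ℝ × ℝ => P p.1 p.2) := by fun_prop
  simp only [hcomm] at hW2
  have cW : Continuous (fun p : ℝ × ℝ => W p.1 p.2) := by simp only [hW]; fun_prop
  have cW1 : Continuous (fun p : ℝ × ℝ => W1 p.1 p.2) := by simp only [hW1]; fun_prop
  have cW2 : Continuous (fun p : ℝ × ℝ => W2 p.1 p.2) := by simp only [hW2]; fun_prop
  have cT1 : Continuous (fun p : ℝ × ℝ => T1 p.1 p.2) := by simp only [hT1]; fun_prop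
  have cc : ∀ {F : ℝ → ℝ → ℝ}, Continuous (fun p : ℝ × ℝ => F p.1 p.2) → ∀ x, Continuous (F x) :=
    fun hF x => hF.comp (by fun_prop : Continuous fun t => (x, t))
  have dI : ∀ r, HasDerivAt I (I1 r) r := fun r =>
    deriv_param cW cW1 (fun x t => chr hw x t) _ _ r
  have dI1 : ∀ r, HasDerivAt I1 (I2 r) r := fun r =>
    deriv_param cW1 cW2 (fun x t => ((chr hx x t).mul_const _).add ((chr hy x t).mul_const _)) _ _ r
  have dT : ∀ r t, HasDerivAt (T r) (T1 r t) t := by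
    intro r t
    have := (((cht hx r t).mul (Real.hasDerivAt_sin t)).neg).add
      ((cht hy r t).mul (Real.hasDerivAt_cos t))
    have e : T1 r t = -((Dx (Dx w) (P r t) * (r * -Real.sin t) + Dy (Dx w) (P r t) * (r * Real.cos t))
        * Real.sin t + Dx w (P r t) * Real.cos t) + ((Dx (Dy w) (P r t) * (r * -Real.sin t)
        + Dy (Dy w) (P r t) * (r * Real.cos t)) * Real.cos t + Dy w (P r t) * -Real.sin t) := by
      simp only [hT1, hcomm]; ring
    rw [e]
    exact this
  have iT : ∀ r, ∫ t in (-Real.pi)..Real.pi, T1 r t = 0 := by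
    intro r
    rw [intervalIntegral.integral_eq_sub_of_hasDerivAt (fun t _ => dT r t)
      ((cc cT1 r).intervalIntegrable _ _)]
    simp [hT, hP]
  have ode : ∀ r, 0 ≤ r → r < R → I1 r + r * I2 r ≤ C * r * I r := by
    intro r hr0 hrR
    have e1 : I1 r + r * I2 r = ∫ t in (-Real.pi)..Real.pi, (W1 r t + r * W2 r t) + T1 r t := by
      rw [intervalIntegral.integral_add, iT, intervalIntegral.integral_add,
        intervalIntegral.integral_const_mul]
      · simp [hI1, hI2]
      · exact (cc cW1 r).intervalIntegrable _ _
      · exact ((cc cW2 r).const_mul r).intervalIntegrable _ _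
      · exact ((cc cW1 r).add ((cc cW2 r).const_mul r)).intervalIntegrable _ _
      · exact (cc cT1 r).intervalIntegrable _ _
    rw [e1, hI]
    dsimp only
    rw [← intervalIntegral.integral_const_mul]
    apply intervalIntegral.integral_mono_on (by linarith [Real.pi_pos])
    · exact (((cc cW1 r).add ((cc cW2 r).const_mul r)).add (cc cT1 r)).intervalIntegrable _ _
    · exact ((cc cW r).const_mul _).intervalIntegrable _ _
    · intro t _
      have hp := (h (P r t) (by rw [sP]; exact pow_lt_pow_left₀ hrR hr0 (by norm_num))).2
      have e2 : (W1 r t + r * W2 r t) + T1 r t = r * (Dx (Dx w) (P r t) + Dy (Dy w) (P r t)) := by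
        simp only [hW1, hW2, hT1]
        have := Real.sin_sq_add_cos_sq t
        linear_combination r * (Dx (Dx w) (P r t) + Dy (Dy w) (P r t)) * this
      rw [e2]
      calc _ ≤ r * (C * w (P r t)) := mul_le_mul_of_nonneg_left hp hr0
        _ = _ := by simp only [hW]; ring
  obtain ⟨d, hd0, hdR, hdC⟩ : ∃ d, 0 < d ∧ d < R ∧ C * d ^ 2 < 4 := by
    refine ⟨min (R / 2) (1 / (C + 1)), by positivity, ?_, ?_⟩
    · exact (min_le_left _ _).trans_lt (by linarith)
    · have h1 : min (R / 2) (1 / (C + 1)) ≤ 1 / (C + 1) := min_le_right _ _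
      have h2 : 0 < min (R / 2) (1 / (C + 1)) := by positivity
      have h3 : min (R / 2) (1 / (C + 1)) ^ 2 ≤ (1 / (C + 1)) ^ 2 := pow_le_pow_left₀ h2.le h1 2
      have h4 : C * (1 / (C + 1)) ^ 2 < 4 := by
        rw [div_pow, one_pow, mul_one_div, div_lt_iff₀ (by positivity)]
        nlinarith
      nlinarith
  have I0 : I 0 = 0 := by
    simp only [hI, hW, hP, zero_mul]
    have : w ((0:ℝ), (0:ℝ)) = 0 := h00
    simp [this]
  have cI : Continuous I := continuous_iff_continuousAt.2 (fun r => (dI r).continuousAt)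
  have cI1 : Continuous I1 := continuous_iff_continuousAt.2 (fun r => (dI1 r).continuousAt)
  obtain ⟨rs, hrs, hmax⟩ := isCompact_Icc.exists_isMaxOn (nonempty_Icc.2 hd0.le)
    (cI.continuousOn (s := Icc 0 d))
  set J := I rs with hJ
  have hIJ : ∀ r ∈ Icc 0 d, I r ≤ J := fun r hr => hmax hr
  have hG : ∀ r ∈ Icc 0 d, r * I1 r ≤ C * J * r ^ 2 / 2 := by
    intro r hr
    have dG : ∀ x, HasDerivAt (fun x => x * I1 x - C * J * x ^ 2 / 2)
        (1 * I1 x + x * I2 x - C * J * (2 * x) / 2) x := by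
      intro x
      have h1 := (hasDerivAt_id x).mul (dI1 x)
      have h2 : HasDerivAt (fun x => C * J * x ^ 2 / 2) (C * J * (2 * x) / 2) x := by
        simpa using ((hasDerivAt_pow 2 x).const_mul (C * J)).div_const 2
      exact h1.sub h2
    have := antitoneOn_of_deriv_nonpos (convex_Icc 0 d)
      (f := fun x => x * I1 x - C * J * x ^ 2 / 2) (by fun_prop)
      (fun x _ => (dG x).differentiableAt.differentiableWithinAt)
      (fun x hx => by
        rw [interior_Icc] at hx
        rw [(dG x).deriv]
        have o := ode x hx.1.le (hx.2.trans hdR)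
        have := mul_le_mul_of_nonneg_left (hIJ x ⟨hx.1.le, hx.2.le⟩)
          (show 0 ≤ C * x from mul_nonneg hC.le hx.1.le)
        linarith)
    have := this (left_mem_Icc.2 hd0.le) hr hr.1
    simp at this
    linarith
  have hI3 : ∀ r ∈ Icc 0 d, I r ≤ C * J * r ^ 2 / 4 := by
    intro r hr
    have dG : ∀ x, HasDerivAt (fun x => I x - C * J * x ^ 2 / 4)
        (I1 x - C * J * (2 * x) / 4) x := by
      intro x
      have h2 : HasDerivAt (fun x => C * J * x ^ 2 / 4) (C * J * (2 * x) / 4) x := by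
        simpa using ((hasDerivAt_pow 2 x).const_mul (C * J)).div_const 4
      exact (dI x).sub h2
    have := antitoneOn_of_deriv_nonpos (convex_Icc 0 d)
      (f := fun x => I x - C * J * x ^ 2 / 4) (by fun_prop)
      (fun x _ => (dG x).differentiableAt.differentiableWithinAt)
      (fun x hx => by
        rw [interior_Icc] at hx
        rw [(dG x).deriv]
        have o := hG x ⟨hx.1.le, hx.2.le⟩
        have : x * I1 x ≤ x * (C * J * x / 2) := by linarith
        have := le_of_mul_le_mul_left this hx.1
        linarith)
    have := this (left_mem_Icc.2 hd0.le) hr hr.1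
    simp [I0] at this
    linarith
  have hJ0 : J ≤ 0 := by
    by_contra hJp
    push Not at hJp
    have h1 := hI3 rs hrs
    have h2 : rs ^ 2 ≤ d ^ 2 := pow_le_pow_left₀ hrs.1 hrs.2 2
    have h3 : C * J * rs ^ 2 ≤ C * J * d ^ 2 := mul_le_mul_of_nonneg_left h2 (by positivity)
    have h4 : C * d ^ 2 * J < 4 * J := mul_lt_mul_of_pos_right hdC hJp
    linarith
  have Wz : ∀ r ∈ Icc 0 d, ∀ t ∈ Icc (-Real.pi) Real.pi, w (P r t) = 0 := by
    intro r hr t ht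
    have nn : ∀ t, 0 ≤ W r t := fun t =>
      (h (P r t) (by rw [sP]; exact pow_lt_pow_left₀ (hr.2.trans_lt hdR) hr.1 (by norm_num))).1
    by_contra hne
    have : 0 < I r := intervalIntegral.integral_pos (by linarith [Real.pi_pos])
      (cc cW r).continuousOn (fun x _ => nn x) ⟨t, ht, lt_of_le_of_ne (nn t) (Ne.symm hne)⟩
    linarith [hIJ r hr]
  have hopen : {p : ℝ × ℝ | sq2 0 0 p < d ^ 2} ∈ nhds (0 : ℝ × ℝ) :=
    (isOpen_lt (sq2_smooth 0 0).continuous continuous_const).mem_nhds (by simp [sq2, hd0])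
  filter_upwards [hopen] with p hp
  have hp' : p.1 ^ 2 + p.2 ^ 2 < d ^ 2 := by simpa [sq2] using hp
  set z : ℂ := ⟨p.1, p.2⟩ with hz
  have hn : ‖z‖ ^ 2 = p.1 ^ 2 + p.2 ^ 2 := by
    rw [← Complex.normSq_eq_norm_sq, Complex.normSq_apply]; simp [hz]; ring
  have hzd : ‖z‖ ≤ d := by
    apply le_of_lt; apply lt_of_pow_lt_pow_left₀ 2 hd0.le; rw [hn]; exact hp'
  have := Wz ‖z‖ ⟨norm_nonneg _, hzd⟩ z.arg ⟨(Complex.neg_pi_lt_arg z).le, Complex.arg_le_pi z⟩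
  simp only [hP, Complex.norm_mul_cos_arg, Complex.norm_mul_sin_arg] at this
  simpa [hz] using this

lemma isOpen_B1 : IsOpen B1 := isOpen_ball

lemma smoothOn_D {G : ℝ × ℝ → ℝ} (h : ContDiffOn ℝ ∞ G B1) (v : ℝ × ℝ) :
    ContDiffOn ℝ ∞ (fun p => fderiv ℝ G p v) B1 :=
  (h.fderiv_of_isOpen isOpen_B1 (by simp)).clm_apply contDiffOn_const

/-- `G` is smooth on the ball and represents the curried function `g` there. -/
def BRel (g : ℝ → ℝ → ℝ) (G : ℝ × ℝ → ℝ) : Prop :=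
  ContDiffOn ℝ ∞ G B1 ∧ ∀ x y : ℝ, (x, y) ∈ B1 → g x y = G (x, y)

lemma BRel.at {g : ℝ → ℝ → ℝ} {G : ℝ × ℝ → ℝ} (h : BRel g G) {p : ℝ × ℝ} (hp : p ∈ B1) :
    ContDiffAt ℝ ∞ G p := h.1.contDiffAt (isOpen_B1.mem_nhds hp)

lemma BRel.da {g : ℝ → ℝ → ℝ} {G : ℝ × ℝ → ℝ} (h : BRel g G) {p : ℝ × ℝ} (hp : p ∈ B1) :
    DifferentiableAt ℝ G p := (h.at hp).differentiableAt (by simp)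

lemma BRel.pdx {g : ℝ → ℝ → ℝ} {G : ℝ × ℝ → ℝ} (h : BRel g G) : BRel (pdx g) (Dx G) := by
  refine ⟨smoothOn_D h.1 _, fun x y hp => ?_⟩
  have hG := h.da hp
  have h1 : HasDerivAt (fun t : ℝ => G (t, y)) (Dx G (x, y) * 1 + Dy G (x, y) * 0) x :=
    chain2 (g1 := fun t => t) (g2 := fun _ => y) hG (hasDerivAt_id x) (hasDerivAt_const x y)
  have h2 : (fun t : ℝ => g t y) =ᶠ[nhds x] fun t => G (t, y) := by
    have : ContinuousAt (fun t : ℝ => (t, y)) x := by fun_prop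
    filter_upwards [this.preimage_mem_nhds (isOpen_B1.mem_nhds hp)] with t ht
    exact h.2 t y ht
  unfold _root_.pdx
  rw [h2.deriv_eq, h1.deriv]; ring

lemma BRel.pdy {g : ℝ → ℝ → ℝ} {G : ℝ × ℝ → ℝ} (h : BRel g G) : BRel (pdy g) (Dy G) := by
  refine ⟨smoothOn_D h.1 _, fun x y hp => ?_⟩
  have hG := h.da hp
  have h1 : HasDerivAt (fun t : ℝ => G (x, t)) (Dx G (x, y) * 0 + Dy G (x, y) * 1) y :=
    chain2 (g1 := fun _ => x) (g2 := fun t => t) hG (hasDerivAt_const y x) (hasDerivAt_id y)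
  have h2 : (fun t : ℝ => g x t) =ᶠ[nhds y] fun t => G (x, t) := by
    have : ContinuousAt (fun t : ℝ => (x, t)) y := by fun_prop
    filter_upwards [this.preimage_mem_nhds (isOpen_B1.mem_nhds hp)] with t ht
    exact h.2 x t ht
  unfold _root_.pdy
  rw [h2.deriv_eq, h1.deriv]; ring

lemma D_congr {F G : ℝ × ℝ → ℝ} {p : ℝ × ℝ} (h : F =ᶠ[nhds p] G) :
    Dx F =ᶠ[nhds p] Dx G ∧ Dy F =ᶠ[nhds p] Dy G := by
  have := h.fderiv (𝕜 := ℝ)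
  constructor
  · filter_upwards [this] with q hq
    simp [Dx, hq]
  · filter_upwards [this] with q hq
    simp [Dy, hq]

/-- The constant is the only solution with a local maximum at a zero of `f`. -/
lemma const_of_zero {U : ℝ × ℝ → ℝ} {f : ℝ → ℝ} (hU : ContDiffOn ℝ ∞ U B1) (hf : ContDiff ℝ ∞ f)
    (hpde : ∀ p ∈ B1, -(Dx (Dx U) p + Dy (Dy U) p) = f (U p))
    (hmax : IsLocalMax U 0) (h0 : f (U 0) = 0) : ∀ p ∈ B1, U p = U 0 := by
  intro p₀ hp₀
  have hp₀' : ‖p₀‖ < 1 := by simpa [B1] using hp₀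
  set r := (1 + ‖p₀‖) / 2 with hr
  have hn := norm_nonneg p₀
  have hr0 : 0 < r := by positivity
  have hr1 : r < 1 := by linarith
  have hrp : ‖p₀‖ < r := by linarith
  set c := U 0 with hc
  let b : ContDiffBump (0 : ℝ × ℝ) := ⟨r, (1 + r) / 2, hr0, by linarith⟩
  set V : ℝ × ℝ → ℝ := fun p => b p * (U p - c) with hVd
  have hV : ContDiff ℝ ∞ V := by
    rw [contDiff_iff_contDiffAt]
    intro p
    by_cases hp : p ∈ B1
    · exact b.contDiff.contDiffAt.mul
        ((hU.contDiffAt (isOpen_B1.mem_nhds hp)).sub contDiffAt_const)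
    · have hts : p ∉ tsupport b := by
        rw [b.tsupport_eq]
        intro h
        apply hp
        have : dist p 0 ≤ (1 + r) / 2 := h
        simp only [B1, mem_ball]
        linarith
      have : V =ᶠ[nhds p] fun _ => 0 := by
        filter_upwards [notMem_tsupport_iff_eventuallyEq.mp hts] with q hq
        simp [hVd, hq]
      exact contDiffAt_const.congr_of_eventuallyEq this
  have hVU : ∀ p ∈ ball (0 : ℝ × ℝ) r, V p = U p - c := by
    intro p hp
    have : b p = 1 := b.one_of_mem_closedBall (ball_subset_closedBall hp)
    simp [hVd, this]
  have hbB : ball (0 : ℝ × ℝ) r ⊆ B1 := ball_subset_ball hr1.le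
  have hcB : closedBall (0 : ℝ × ℝ) r ⊆ B1 := closedBall_subset_ball hr1
  have hDD : ∀ p ∈ ball (0 : ℝ × ℝ) r, Dx (Dx V) p + Dy (Dy V) p = - f (U p) := by
    intro p hp
    have hev : V =ᶠ[nhds p] fun q => U q - c := by
      filter_upwards [isOpen_ball.mem_nhds hp] with q hq using hVU q hq
    have e1 : Dx (fun q => U q - c) = Dx U := by
      funext q; unfold Dx; rw [fderiv_sub_const]
    have e2 : Dy (fun q => U q - c) = Dy U := by
      funext q; unfold Dy; rw [fderiv_sub_const]
    have h1 := (D_congr (D_congr hev).1).1.self_of_nhds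
    have h2 := (D_congr (D_congr hev).2).2.self_of_nhds
    rw [e1] at h1
    rw [e2] at h2
    rw [h1, h2, ← hpde p (hbB hp)]; ring
  obtain ⟨M, hM⟩ := (isCompact_closedBall (0 : ℝ × ℝ) r).exists_bound_of_continuousOn
    (hU.continuousOn.mono hcB)
  obtain ⟨L, hL⟩ := (isCompact_Icc (a := -M) (b := M)).exists_bound_of_continuousOn
    ((hf.continuous_deriv (by simp)).continuousOn)
  have hmem : ∀ p ∈ ball (0 : ℝ × ℝ) r, U p ∈ Icc (-M) M := fun p hp =>
    abs_le.1 (hM p (ball_subset_closedBall hp))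
  have h0m : (0 : ℝ × ℝ) ∈ ball (0 : ℝ × ℝ) r := mem_ball_self hr0
  have hfL : ∀ p ∈ ball (0 : ℝ × ℝ) r, |f (U p)| ≤ L * |U p - c| := by
    intro p hp
    have := (convex_Icc (-M) M).norm_image_sub_le_of_norm_deriv_le (f := f) (C := L)
      (fun x _ => (hf.differentiable (by simp)) x) hL (hmem 0 h0m) (hmem p hp)
    rwa [h0, sub_zero] at this
  have hb : ∀ p ∈ ball (0 : ℝ × ℝ) r, |Dx (Dx V) p + Dy (Dy V) p| ≤ (|L| + 1) * |V p| := by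
    intro p hp
    rw [hDD p hp, abs_neg, hVU p hp]
    refine (hfL p hp).trans ?_
    apply mul_le_mul_of_nonneg_right _ (abs_nonneg _)
    linarith [le_abs_self L]
  have hnear : V =ᶠ[nhds 0] 0 := by
    obtain ⟨d, hd, hdb⟩ := Metric.eventually_nhds_iff.1 hmax
    set R := min d r with hR
    have hR0 : 0 < R := lt_min hd hr0
    have key := polar_s19 (w := fun p => - V p) hV.neg (|L| + 1) R (by positivity) hR0 (by
      intro p hp
      have hdist : dist p 0 < R := by
        simp only [sq2, sub_zero] at hp
        rw [Prod.dist_eq, Real.dist_eq, Real.dist_eq, max_lt_iff]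
        simp only [Prod.fst_zero, Prod.snd_zero, sub_zero]
        constructor
        · apply abs_lt_of_sq_lt_sq _ hR0.le
          nlinarith [sq_nonneg p.2]
        · apply abs_lt_of_sq_lt_sq _ hR0.le
          nlinarith [sq_nonneg p.1]
      have hpr : p ∈ ball (0 : ℝ × ℝ) r := hdist.trans_le (min_le_right _ _)
      have hle : U p ≤ c := hdb (hdist.trans_le (min_le_left _ _))
      have hVn : V p ≤ 0 := by rw [hVU p hpr]; linarith
      refine ⟨by linarith, ?_⟩
      have e1 : Dx (fun p => - V p) = fun p => - Dx V p := funext (Dx_neg V)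
      have e2 : Dy (fun p => - V p) = fun p => - Dy V p := funext (Dy_neg V)
      rw [e1, e2, Dx_neg, Dy_neg]
      have := hb p hpr
      rw [abs_of_nonpos hVn] at this
      linarith [neg_abs_le (Dx (Dx V) p + Dy (Dy V) p)])
      (by rw [hVU 0 h0m]; simp [hc])
    filter_upwards [key] with q hq
    simpa using hq
  have hp₀b : p₀ ∈ ball (0 : ℝ × ℝ) r := by simpa using hrp
  have := uc_square hV r (|L| + 1) hr0 hb hnear p₀ hp₀b
  rw [hVU p₀ hp₀b] at this
  linarith

/-- along a `C⁴` curve of maximum points through the degenerate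
maximum `(0,0)`, one has `y'(0) = 0`; and if moreover `y''(0) = 0` (vanishing
curvature of the curve at `0`), then `∂⁴u/∂x⁴(0,0) = 0`. -/
theorem curve_of_maxima
    (u : ℝ → ℝ → ℝ) (f : ℝ → ℝ)
    (hu : ContDiffOn ℝ (⊤ : ℕ∞) (fun p : ℝ × ℝ => u p.1 p.2) B1)
    (hf : ContDiff ℝ (⊤ : ℕ∞) f)
    (hpde : ∀ x y : ℝ, (x, y) ∈ B1 → -(pd u 2 0 x y + pd u 0 2 x y) = f (u x y))
    (hnc : ¬ ∃ c : ℝ, ∀ x y : ℝ, (x, y) ∈ B1 → u x y = c)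
    (hux : ¬ ∀ x y : ℝ, (x, y) ∈ B1 → pd u 1 0 x y = 0)
    (hcx : pd u 1 0 0 0 = 0) (hcy : pd u 0 1 0 0 = 0)
    (hmax : IsLocalMax (fun p : ℝ × ℝ => u p.1 p.2) (0, 0))
    (hdeg : pd u 2 0 0 0 * pd u 0 2 0 0 - (pd u 1 1 0 0) ^ 2 = 0)
    (hxx : pd u 2 0 0 0 = 0) (hxy : pd u 1 1 0 0 = 0)
    (γ₁ γ₂ : ℝ → ℝ) (ε : ℝ) (hε : 0 < ε)
    (hγ₁ : ContDiffOn ℝ 4 γ₁ (Set.Ioo (-ε) ε))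
    (hγ₂ : ContDiffOn ℝ 4 γ₂ (Set.Ioo (-ε) ε))
    (hγ0 : γ₁ 0 = 0 ∧ γ₂ 0 = 0)
    (hγ' : ¬ (deriv γ₁ 0 = 0 ∧ deriv γ₂ 0 = 0))
    (hγB1 : ∀ t ∈ Set.Ioo (-ε) ε, ((γ₁ t, γ₂ t) : ℝ × ℝ) ∈ B1)
    (hγval : ∀ t ∈ Set.Ioo (-ε) ε, u (γ₁ t) (γ₂ t) = u 0 0)
    (hγmax : ∀ t ∈ Set.Ioo (-ε) ε,
      IsLocalMax (fun p : ℝ × ℝ => u p.1 p.2) (γ₁ t, γ₂ t)) :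
    deriv γ₂ 0 = 0 ∧ (deriv (deriv γ₂) 0 = 0 → pd u 4 0 0 0 = 0) := by
  set U : ℝ × ℝ → ℝ := fun p => u p.1 p.2 with hUd
  have r00 : BRel u U := ⟨hu, fun x y _ => rfl⟩
  have rx := r00.pdx
  have ry := r00.pdy
  have rxx := rx.pdx
  have ryy := ry.pdy
  have rxy := ry.pdx
  have ryx := rx.pdy
  have rxxx := rxx.pdx
  have ryxx := rxx.pdy
  have rxxxx := rxxx.pdx
  have o : ((0:ℝ), (0:ℝ)) ∈ B1 := mem_ball_self one_pos
  have hpde' : ∀ p ∈ B1, -(Dx (Dx U) p + Dy (Dy U) p) = f (U p) := by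
    intro p hp
    rw [← rxx.2 p.1 p.2 hp, ← ryy.2 p.1 p.2 hp]
    exact hpde p.1 p.2 hp
  have zxx : Dx (Dx U) (0, 0) = 0 := by rw [← rxx.2 0 0 o]; exact hxx
  have zxy : Dx (Dy U) (0, 0) = 0 := by rw [← rxy.2 0 0 o]; exact hxy
  have zyx : Dy (Dx U) (0, 0) = 0 := by rw [← D_comm_at (r00.at o)]; exact zxy
  have nyy : Dy (Dy U) (0, 0) ≠ 0 := by
    intro hyy
    apply hnc
    refine ⟨U 0, fun x y hp => ?_⟩
    refine const_of_zero hu hf hpde' hmax ?_ (x, y) hp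
    have := hpde' (0, 0) o
    rw [zxx, hyy] at this
    change f (U (0, 0)) = 0
    linarith
  have hO : IsOpen (Ioo (-ε) ε) := isOpen_Ioo
  have hx1 : ContDiffOn ℝ 3 (deriv γ₁) (Ioo (-ε) ε) := hγ₁.deriv_of_isOpen hO (by norm_num)
  have hx2 : ContDiffOn ℝ 2 (deriv (deriv γ₁)) (Ioo (-ε) ε) := hx1.deriv_of_isOpen hO (by norm_num)
  have hy1 : ContDiffOn ℝ 3 (deriv γ₂) (Ioo (-ε) ε) := hγ₂.deriv_of_isOpen hO (by norm_num)
  have hy2 : ContDiffOn ℝ 2 (deriv (deriv γ₂)) (Ioo (-ε) ε) := hy1.deriv_of_isOpen hO (by norm_num)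
  have hasd : ∀ {g : ℝ → ℝ} {n : WithTop ℕ∞}, ContDiffOn ℝ n g (Ioo (-ε) ε) → n ≠ 0 →
      ∀ t ∈ Ioo (-ε) ε, HasDerivAt g (deriv g t) t := fun hg hn t ht =>
    ((hg.differentiableOn hn).differentiableAt (hO.mem_nhds ht)).hasDerivAt
  have dx0 := hasd hγ₁ (by norm_num)
  have dx1 := hasd hx1 (by norm_num)
  have dx2 := hasd hx2 (by norm_num)
  have dy0 := hasd hγ₂ (by norm_num)
  have dy1 := hasd hy1 (by norm_num)
  have dy2 := hasd hy2 (by norm_num)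
  have ch : ∀ {g : ℝ → ℝ → ℝ} {G : ℝ × ℝ → ℝ}, BRel g G → ∀ t ∈ Ioo (-ε) ε,
      HasDerivAt (fun s => G (γ₁ s, γ₂ s))
        (Dx G (γ₁ t, γ₂ t) * deriv γ₁ t + Dy G (γ₁ t, γ₂ t) * deriv γ₂ t) t :=
    fun h t ht => chain2 (h.da (hγB1 t ht)) (dx0 t ht) (dy0 t ht)
  have zero_of : ∀ {g : ℝ → ℝ} {d t : ℝ}, (∀ s ∈ Ioo (-ε) ε, g s = 0) → t ∈ Ioo (-ε) ε →
      HasDerivAt g d t → d = 0 := by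
    intro g d t hg ht hd
    have : g =ᶠ[nhds t] fun _ => (0:ℝ) := by
      filter_upwards [hO.mem_nhds ht] with s hs using hg s hs
    exact (hd.congr_of_eventuallyEq this.symm).unique (hasDerivAt_const t 0)
  have g1 : ∀ t ∈ Ioo (-ε) ε, Dx U (γ₁ t, γ₂ t) = 0 := fun t ht => by
    simp [Dx, (hγmax t ht).fderiv_eq_zero]
  have g2 : ∀ t ∈ Ioo (-ε) ε, Dy U (γ₁ t, γ₂ t) = 0 := fun t ht => by
    simp [Dy, (hγmax t ht).fderiv_eq_zero]
  have E1 : ∀ t ∈ Ioo (-ε) ε, Dx (Dx U) (γ₁ t, γ₂ t) * deriv γ₁ t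
      + Dy (Dx U) (γ₁ t, γ₂ t) * deriv γ₂ t = 0 := fun t ht => zero_of g1 ht (ch rx t ht)
  have E2 : ∀ t ∈ Ioo (-ε) ε, Dx (Dy U) (γ₁ t, γ₂ t) * deriv γ₁ t
      + Dy (Dy U) (γ₁ t, γ₂ t) * deriv γ₂ t = 0 := fun t ht => zero_of g2 ht (ch ry t ht)
  have t0 : (0:ℝ) ∈ Ioo (-ε) ε := ⟨by linarith, hε⟩
  have y1 : deriv γ₂ 0 = 0 := by
    have := E2 0 t0
    rw [hγ0.1, hγ0.2, zxy, zero_mul, zero_add] at this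
    exact (mul_eq_zero.1 this).resolve_left nyy
  have x1 : deriv γ₁ 0 ≠ 0 := fun h => hγ' ⟨h, y1⟩
  refine ⟨y1, fun y2 => ?_⟩
  have E3 := fun t ht => zero_of E1 ht
    (((ch rxx t ht).mul (dx1 t ht)).add ((ch ryx t ht).mul (dy1 t ht)))
  have E4 := zero_of E2 t0 (((ch rxy 0 t0).mul (dx1 0 t0)).add ((ch ryy 0 t0).mul (dy1 0 t0)))
  have E30 := E3 0 t0
  simp only [hγ0.1, hγ0.2, y1, y2, zxx, zxy, zyx] at E4 E30
  have zxxx : Dx (Dx (Dx U)) (0, 0) = 0 := by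
    have : Dx (Dx (Dx U)) (0, 0) * (deriv γ₁ 0 * deriv γ₁ 0) = 0 := by linarith
    exact (mul_eq_zero.1 this).resolve_right (mul_ne_zero x1 x1)
  have zxxy : Dx (Dx (Dy U)) (0, 0) = 0 := by
    have : Dx (Dx (Dy U)) (0, 0) * (deriv γ₁ 0 * deriv γ₁ 0) = 0 := by linarith
    exact (mul_eq_zero.1 this).resolve_right (mul_ne_zero x1 x1)
  have zyxx : Dy (Dx (Dx U)) (0, 0) = 0 := by
    rw [← D_comm_at (rx.at o)]
    have : Dy (Dx U) =ᶠ[nhds (0, 0)] Dx (Dy U) := by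
      filter_upwards [isOpen_B1.mem_nhds o] with q hq using (D_comm_at (r00.at hq)).symm
    rw [(D_congr this).1.self_of_nhds]
    exact zxxy
  have E5 := zero_of E3 t0
    ((((((ch rxxx 0 t0).mul (dx1 0 t0)).add ((ch ryxx 0 t0).mul (dy1 0 t0))).mul (dx1 0 t0)).add
      ((ch rxx 0 t0).mul (dx2 0 t0))).add
      (((((ch ryx.pdx 0 t0).mul (dx1 0 t0)).add ((ch ryx.pdy 0 t0).mul (dy1 0 t0))).mul
        (dy1 0 t0)).add ((ch ryx 0 t0).mul (dy2 0 t0))))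
  simp only [Pi.mul_apply, Pi.add_apply, hγ0.1, hγ0.2, y1, y2, zxx, zyx, zxxx, zyxx] at E5
  change pdx (pdx (pdx (pdx u))) 0 0 = 0
  rw [rxxxx.2 0 0 o]
  have : Dx (Dx (Dx (Dx U))) (0, 0) * (deriv γ₁ 0 * deriv γ₁ 0 * deriv γ₁ 0) = 0 := by linarith
  exact (mul_eq_zero.1 this).resolve_right (mul_ne_zero (mul_ne_zero x1 x1) x1)
end
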